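/- Let n = 3. The integers x ≥ 1, y ≥ 1, a ≥ 0, b ≥ 0 with gcd(x,y) = 1 satisfy x² + 5^a·11^b = y³ if and only if (a,b,x,y) is one of the nine tuples (0,1,4,3), (0,1,58,15), (0,2,2,5), (0,3,9324,443), (1,1,3,4), (1,1,419,56), (2,3,968,99), (3,1,37,14), (5,5,36599,1226). -/

import Mathlib

section

/-- Reduction of binary quadratic forms `a m² + 2 b m q + c q²` with `a c - b² = d`. -/
theorem form_red (d : ℤ) (hd : ∀ t : ℤ, t ^ 2 ≠ -d) :
    ∀ (k : ℕ) (a b c : ℤ), a.natAbs = k → a * c - b ^ 2 = d →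
      ∃ m q n b' c' : ℤ, (m ≠ 0 ∨ q ≠ 0) ∧ n = a * m ^ 2 + 2 * b * m * q + c * q ^ 2 ∧
        n * c' - b' ^ 2 = d ∧ 2 * |b'| ≤ |n| ∧ |n| ≤ |c'| := by
  intro k
  induction k using Nat.strong_induction_on with
  | _ k ih =>
  intro a b c hk h
  have ha : a ≠ 0 := by
    rintro rfl; exact hd b (by linarith)
  obtain ⟨s, hs⟩ : ∃ s : ℤ, 2 * |b + a * s| ≤ |a| := by
    have h1 := Int.emod_add_mul_ediv b a
    have h2 := Int.emod_nonneg b ha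
    have h3 := Int.emod_lt_abs b ha
    by_cases h4 : 2 * (b % a) ≤ |a|
    · refine ⟨-(b / a), ?_⟩
      have : b + a * -(b / a) = b % a := by linarith
      rw [this, abs_of_nonneg h2]; exact h4
    · push Not at h4
      rcases le_or_gt 0 a with h5 | h5
      · refine ⟨-(b / a) - 1, ?_⟩
        have : b + a * (-(b / a) - 1) = b % a - |a| := by rw [abs_of_nonneg h5]; linarith
        rw [this, abs_of_nonpos (by linarith)]; linarith
      · refine ⟨-(b / a) + 1, ?_⟩
        have : b + a * (-(b / a) + 1) = b % a - |a| := by rw [abs_of_neg h5]; linarith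
        rw [this, abs_of_nonpos (by linarith)]; linarith
  set b1 := b + a * s with hb1
  set c1 := a * s ^ 2 + 2 * b * s + c with hc1
  have h' : a * c1 - b1 ^ 2 = d := by rw [← h]; simp only [hb1, hc1]; ring
  by_cases hlt : |c1| < |a|
  · obtain ⟨m, q, n, b', c', h0, hn, h2, h3, h4⟩ :=
      ih c1.natAbs (by rw [← hk]; rw [Int.abs_eq_natAbs, Int.abs_eq_natAbs] at hlt; exact_mod_cast hlt) c1 b1 a rfl (by linarith)
    refine ⟨q + s * m, m, n, b', c', ?_, ?_, h2, h3, h4⟩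
    · by_cases hm : m = 0
      · left; subst hm; simpa using h0
      · right; exact hm
    · rw [hn]; simp only [hb1, hc1]; ring
  · exact ⟨1, 0, a, b1, c1, by simp, by ring, h', hs, not_lt.mp hlt⟩

/-- Cube extraction up to a bounded factor. -/
theorem cube_extract (a b x W y : ℤ) (hd : ∀ t : ℤ, t ^ 2 ≠ -(a * b)) (hy : y ≠ 0)
    (h : a * x ^ 2 + b * W ^ 2 = y ^ 3) (hW : IsCoprime W y) :
    ∃ p q n A B : ℤ, a * p ^ 2 + b * q ^ 2 = n * y ∧ A ^ 2 + a * b * B ^ 2 = n ^ 3 ∧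
      a * p ^ 3 - 3 * b * p * q ^ 2 = A * x - b * B * W ∧
      3 * a * p ^ 2 * q - b * q ^ 3 = A * W + a * B * x ∧
      (∃ b' c' : ℤ, n * c' - b' ^ 2 = a * b ∧ 2 * |b'| ≤ |n| ∧ |n| ≤ |c'|) := by
  obtain ⟨r, s, hrs⟩ := hW.pow_right (n := 3)
  obtain ⟨κ, hκ⟩ : ∃ κ, κ = x * r := ⟨_, rfl⟩
  have hx : x = κ * W + y ^ 3 * (x * s) := by
    rw [hκ]; linear_combination (-x) * hrs
  have hWc : IsCoprime (y ^ 3) (W ^ 2) := (IsCoprime.pow hW).symm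
  obtain ⟨g, hg⟩ : y ^ 3 ∣ a * κ ^ 2 + b := by
    apply hWc.dvd_of_dvd_mul_right
    have : (a * κ ^ 2 + b) * W ^ 2 = y ^ 3 * (1 - a * (x*s) * (x + κ * W)) := by
      have hx' : κ * W = x - y ^ 3 * (x * s) := by linarith
      linear_combination h + a * (κ * W + x - y ^ 3 * (x * s)) * hx' + a * y ^ 3 * (x * s) * hx'
    exact ⟨_, this⟩
  obtain ⟨m, q, n, b', c', h0, hn, h1, h2, h3⟩ :=
    form_red (a * b) hd _ (a * y) (a * κ) (y ^ 2 * g) rfl (by linear_combination (-a) * hg)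
  obtain ⟨p, hp⟩ : ∃ p, p = κ * q + y * m := ⟨_, rfl⟩
  obtain ⟨U, hU⟩ : ∃ U, U = a * p ^ 3 - 3 * b * p * q ^ 2 := ⟨_, rfl⟩
  obtain ⟨V, hV⟩ : ∃ V, V = 3 * a * p ^ 2 * q - b * q ^ 3 := ⟨_, rfl⟩
  have hb : b = y ^ 3 * g - a * κ ^ 2 := by linarith
  have hpq : a * p ^ 2 + b * q ^ 2 = n * y := by
    rw [hn, hp, hb]; ring
  obtain ⟨e, he⟩ : y ^ 3 ∣ κ * V - U := by
    refine ⟨-(a * m ^ 3) - κ * g * q ^ 3 + 3 * g * p * q ^ 2, ?_⟩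
    have hm : y * m = p - κ * q := by linarith
    have : y ^ 3 * (a * m ^ 3) = a * (p - κ * q) ^ 3 := by rw [← hm]; ring
    rw [hU, hV]
    linear_combination this + (-(κ * q ^ 3) + 3 * p * q ^ 2) * hb
  obtain ⟨B, hB⟩ : y ^ 3 ∣ V * x - U * W :=
    ⟨V * (x * s) + e * W, by linear_combination V * hx + W * he⟩
  obtain ⟨A, hA⟩ : y ^ 3 ∣ a * U * x + b * V * W :=
    ⟨a * U * (x * s) + g * V * W - a * κ * W * e, by
      linear_combination a * U * hx + V * W * hb - a * κ * W * he⟩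
  have hy3 : y ^ 3 ≠ 0 := pow_ne_zero 3 hy
  have hN : a * U ^ 2 + b * V ^ 2 = n ^ 3 * y ^ 3 := by
    rw [hU, hV]; linear_combination ((n*y)^2 + (n*y) * (a * p ^ 2 + b * q ^ 2) + (a * p ^ 2 + b * q ^ 2)^2) * hpq
  refine ⟨p, q, n, A, B, hpq, ?_, ?_, ?_, b', c', h1, h2, h3⟩
  · have : (y ^ 3) ^ 2 * (A ^ 2 + a * b * B ^ 2) = (y ^ 3) ^ 2 * n ^ 3 := by
      have e1 : (y ^ 3) ^ 2 * (A ^ 2 + a * b * B ^ 2) = (a * U * x + b * V * W) ^ 2 + a * b * (V * x - U * W) ^ 2 := by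
        rw [hA, hB]; ring
      rw [e1]
      linear_combination (a * x ^ 2 + b * W ^ 2) * hN + n ^ 3 * y ^ 3 * h
    exact mul_left_cancel₀ (pow_ne_zero 2 hy3) this
  · rw [← hU]
    apply mul_left_cancel₀ hy3
    linear_combination (-U) * h + x * hA - b * W * hB
  · rw [← hV]
    apply mul_left_cancel₀ hy3
    linear_combination (-V) * h + W * hA + a * x * hB
end

section

theorem red_bound {n d b' c' : ℤ} (hn : 0 < n) (h1 : n * c' - b' ^ 2 = d) (h2 : 2 * |b'| ≤ |n|)
    (h3 : |n| ≤ |c'|) (hd : 0 < d) : 3 * n ^ 2 ≤ 4 * d := by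
  rw [abs_of_pos hn] at h2 h3
  have hc : 0 < c' := by
    by_contra hc
    nlinarith [sq_nonneg b', mul_nonneg hn.le (by linarith : (0:ℤ) ≤ -c')]
  rw [abs_of_pos hc] at h3
  have : (2 * |b'|) ^ 2 ≤ n ^ 2 := by gcongr
  rw [mul_pow, sq_abs] at this
  nlinarith

theorem cube_extract_pos (d x W y : ℤ) (hd : 0 < d) (hy : 0 < y)
    (h : x ^ 2 + d * W ^ 2 = y ^ 3) (hW : IsCoprime W y) :
    ∃ p q n A B : ℤ, p ^ 2 + d * q ^ 2 = n * y ∧ A ^ 2 + d * B ^ 2 = n ^ 3 ∧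
      p ^ 3 - 3 * d * p * q ^ 2 = A * x - d * B * W ∧
      3 * p ^ 2 * q - d * q ^ 3 = A * W + B * x ∧ 0 < n ∧ 3 * n ^ 2 ≤ 4 * d := by
  obtain ⟨p, q, n, A, B, h1, h2, h3, h4, b', c', h5, h6, h7⟩ :=
    cube_extract 1 d x W y (by intro t ht; nlinarith [sq_nonneg t]) hy.ne' (by linarith) hW
  have hn : 0 < n := by
    have h0 : 0 ≤ n * y := by rw [← h1]; nlinarith [sq_nonneg p, mul_nonneg hd.le (sq_nonneg q)]
    rcases lt_trichotomy n 0 with h | h | h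
    · nlinarith
    · subst h; nlinarith [sq_nonneg b']
    · exact h
  refine ⟨p, q, n, A, B, by linarith, by linarith, by linarith, by linarith, hn, ?_⟩
  exact red_bound hn (by linarith) h6 h7 hd

theorem sq_bound {B k : ℤ} (h : B ^ 2 < (k + 1) ^ 2) (hk : 0 ≤ k) : -k ≤ B ∧ B ≤ k := by
  have := abs_lt_of_sq_lt_sq h (by linarith)
  rw [abs_lt] at this
  omega

theorem cube1 (x W y : ℤ) (hy : 0 < y) (h : x ^ 2 + W ^ 2 = y ^ 3) (hW : IsCoprime W y) :
    ∃ p q : ℤ, p ^ 3 - 3 * p * q ^ 2 = x ∧ 3 * p ^ 2 * q - q ^ 3 = W ∧ p ^ 2 + q ^ 2 = y := by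
  obtain ⟨p, q, n, A, B, h1, h2, h3, h4, hn, hn2⟩ :=
    cube_extract_pos 1 x W y one_pos hy (by linarith) hW
  have hn1 : n = 1 := by nlinarith
  subst hn1
  have hB := sq_bound (B := B) (k := 1) (by nlinarith [sq_nonneg A]) (by norm_num)
  have hA := sq_bound (B := A) (k := 1) (by nlinarith [sq_nonneg B]) (by norm_num)
  obtain ⟨hB1, hB2⟩ := hB
  obtain ⟨hA1, hA2⟩ := hA
  interval_cases A <;> interval_cases B <;> norm_num at h2
  · exact ⟨-p, -q, by linarith, by linarith, by linarith⟩
  ·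
    exact ⟨q, -p, by linarith, by linarith, by linarith⟩
  · exact ⟨-q, p, by linarith, by linarith, by linarith⟩
  · exact ⟨p, q, by linarith, by linarith, by linarith⟩

theorem cube5 (x W y : ℤ) (hy : 0 < y) (h : x ^ 2 + 5 * W ^ 2 = y ^ 3) (hW : IsCoprime W y) :
    ∃ p q : ℤ, p ^ 3 - 15 * p * q ^ 2 = x ∧ 3 * p ^ 2 * q - 5 * q ^ 3 = W ∧ p ^ 2 + 5 * q ^ 2 = y := by
  obtain ⟨p, q, n, A, B, h1, h2, h3, h4, hn, hn2⟩ :=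
    cube_extract_pos 5 x W y (by norm_num) hy (by linarith) hW
  have hn1 : n ≤ 2 := by nlinarith
  have hB := sq_bound (B := B) (k := 1) (by interval_cases n <;> nlinarith [sq_nonneg A]) (by norm_num)
  have hA := sq_bound (B := A) (k := 2) (by interval_cases n <;> nlinarith [sq_nonneg B]) (by norm_num)
  obtain ⟨hB1, hB2⟩ := hB
  obtain ⟨hA1, hA2⟩ := hA
  interval_cases n <;> interval_cases A <;> interval_cases B <;> norm_num at h2
  · exact ⟨-p, -q, by linarith, by linarith, by linarith⟩
  · exact ⟨p, q, by linarith, by linarith, by linarith⟩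

theorem cube11 (x W y : ℤ) (hy : 0 < y) (h : x ^ 2 + 11 * W ^ 2 = y ^ 3) (hW : IsCoprime W y) :
    ∃ p q : ℤ, p ^ 3 - 33 * p * q ^ 2 = 8 * x ∧ 3 * p ^ 2 * q - 11 * q ^ 3 = 8 * W ∧
      p ^ 2 + 11 * q ^ 2 = 4 * y := by
  obtain ⟨p, q, n, A, B, h1, h2, h3, h4, hn, hn2⟩ :=
    cube_extract_pos 11 x W y (by norm_num) hy (by linarith) hW
  have hn1 : n ≤ 3 := by nlinarith
  have hB := sq_bound (B := B) (k := 1) (by interval_cases n <;> nlinarith [sq_nonneg A]) (by norm_num)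
  have hA := sq_bound (B := A) (k := 5) (by interval_cases n <;> nlinarith [sq_nonneg B]) (by norm_num)
  obtain ⟨hB1, hB2⟩ := hB
  obtain ⟨hA1, hA2⟩ := hA
  have key : ∀ e P Q : ℤ, P ^ 3 - 33 * P * Q ^ 2 = 27 * (8 * x) →
      3 * P ^ 2 * Q - 11 * Q ^ 3 = 27 * (8 * W) → P ^ 2 + 11 * Q ^ 2 = 9 * (4 * y) →
      ∃ p q : ℤ, p ^ 3 - 33 * p * q ^ 2 = 8 * x ∧ 3 * p ^ 2 * q - 11 * q ^ 3 = 8 * W ∧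
      p ^ 2 + 11 * q ^ 2 = 4 * y := by
    intro e P Q e1 e2 e3
    obtain ⟨P', rfl⟩ : (3:ℤ) ∣ P := by
      apply Int.prime_three.dvd_of_dvd_pow (n := 3)
      exact ⟨11 * P * Q ^ 2 + 9 * (8 * x), by linarith⟩
    obtain ⟨Q', rfl⟩ : (3:ℤ) ∣ Q := by
      apply Int.prime_three.dvd_of_dvd_pow (n := 3)
      exact ⟨4 * Q ^ 3 - (3 * P') ^ 2 * Q + 9 * (8 * W), by linarith⟩
    exact ⟨P', Q', by linarith, by linarith, by linarith⟩
  interval_cases n <;> interval_cases A <;> interval_cases B <;> norm_num at h2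
  · exact ⟨-2*p, -2*q, by linarith, by linarith, by linarith⟩
  · exact ⟨2*p, 2*q, by linarith, by linarith, by linarith⟩
  all_goals first
    | exact key 1 (p + 11 * q) (q - p) (by linarith) (by linarith) (by linarith)
    | exact key 1 (p - 11 * q) (q + p) (by linarith) (by linarith) (by linarith)
    | exact key 1 (-(p + 11 * q)) (-(q - p)) (by linarith) (by linarith) (by linarith)
    | exact key 1 (-(p - 11 * q)) (-(q + p)) (by linarith) (by linarith) (by linarith)

theorem cube55 (x W y : ℤ) (hy : 0 < y) (h : x ^ 2 + 55 * W ^ 2 = y ^ 3) (hW : IsCoprime W y) :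
    (∃ p q : ℤ, p ^ 3 - 165 * p * q ^ 2 = x ∧ 3 * p ^ 2 * q - 55 * q ^ 3 = W ∧
      p ^ 2 + 55 * q ^ 2 = y) ∨
    (∃ p q e : ℤ, (e = 1 ∨ e = -1) ∧ p ^ 3 - 165 * p * q ^ 2 = 3 * x - 55 * e * W ∧
      3 * p ^ 2 * q - 55 * q ^ 3 = 3 * W + e * x ∧ p ^ 2 + 55 * q ^ 2 = 4 * y) := by
  obtain ⟨p, q, n, A, B, h1, h2, h3, h4, hn, hn2⟩ :=
    cube_extract_pos 55 x W y (by norm_num) hy (by linarith) hW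
  have hn1 : n ≤ 8 := by nlinarith
  have hB := sq_bound (B := B) (k := 3) (by interval_cases n <;> nlinarith [sq_nonneg A]) (by norm_num)
  obtain ⟨hB1, hB2⟩ := hB
  have hA := sq_bound (B := A) (k := 22) (by interval_cases n <;> nlinarith [sq_nonneg B]) (by norm_num)
  obtain ⟨hA1, hA2⟩ := hA
  have key : ∀ p q : ℤ, p ^ 3 - 165 * p * q ^ 2 = 8 * x →
      3 * p ^ 2 * q - 55 * q ^ 3 = 8 * W → p ^ 2 + 55 * q ^ 2 = 4 * y →
      (∃ p q : ℤ, p ^ 3 - 165 * p * q ^ 2 = x ∧ 3 * p ^ 2 * q - 55 * q ^ 3 = W ∧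
      p ^ 2 + 55 * q ^ 2 = y) := by
    intro P Q e1 e2 e3
    have hpar : P % 2 = 0 ∧ Q % 2 = 0 := by
      have hm : (P ^ 3 - 165 * P * Q ^ 2) % 8 = 0 := by omega
      have hm' : (P ^ 2 + 55 * Q ^ 2) % 4 = 0 := by omega
      have hP : P % 8 = 0 ∨ P % 8 = 1 ∨ P % 8 = 2 ∨ P % 8 = 3 ∨ P % 8 = 4 ∨ P % 8 = 5 ∨ P % 8 = 6 ∨ P % 8 = 7 := by omega
      have hQ : Q % 8 = 0 ∨ Q % 8 = 1 ∨ Q % 8 = 2 ∨ Q % 8 = 3 ∨ Q % 8 = 4 ∨ Q % 8 = 5 ∨ Q % 8 = 6 ∨ Q % 8 = 7 := by omega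
      have h4P : P % 4 = (P % 8) % 4 := by omega
      have h4Q : Q % 4 = (Q % 8) % 4 := by omega
      have h2P : P % 2 = (P % 8) % 2 := by omega
      have h2Q : Q % 2 = (Q % 8) % 2 := by omega
      rw [h2P, h2Q]
      rcases hP with hP | hP | hP | hP | hP | hP | hP | hP <;>
      rcases hQ with hQ | hQ | hQ | hQ | hQ | hQ | hQ | hQ <;>
      simp [pow_succ, Int.sub_emod, Int.add_emod, Int.mul_emod, hP, hQ, h4P, h4Q] at hm hm' ⊢
    obtain ⟨P', rfl⟩ := Int.dvd_of_emod_eq_zero hpar.1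
    obtain ⟨Q', rfl⟩ := Int.dvd_of_emod_eq_zero hpar.2
    exact ⟨P', Q', by linarith, by linarith, by linarith⟩
  have hn' : n = 1 ∨ n = 4 := by
    clear h1 h3 h4 hn2 key h hW hy
    interval_cases n <;> first | omega | (exfalso; interval_cases B <;>
      (have : ∃ k : ℤ, A ^ 2 = k := ⟨_, rfl⟩
       interval_cases A <;> omega))
  rcases hn' with rfl | rfl
  · left
    interval_cases B <;> interval_cases A <;> norm_num at h2
    · exact ⟨-p, -q, by linarith, by linarith, by linarith⟩
    · exact ⟨p, q, by linarith, by linarith, by linarith⟩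
  · interval_cases B <;> interval_cases A <;> norm_num at h2
    · right; exact ⟨-p, -q, 1, by simp, by linarith, by linarith, by linarith⟩
    · right; exact ⟨p, q, -1, by simp, by linarith, by linarith, by linarith⟩
    · left; exact key (-p) (-q) (by linarith) (by linarith) (by linarith)
    · left; exact key p q (by linarith) (by linarith) (by linarith)
    · right; exact ⟨-p, -q, -1, by simp, by linarith, by linarith, by linarith⟩
    · right; exact ⟨p, q, 1, by simp, by linarith, by linarith, by linarith⟩
end

section

/-- Orbits of the fundamental automorph of `3u² - 11v²`. -/
def pel (u v : ℤ) : ℕ → ℤ × ℤ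
  | 0 => (u, v)
  | n + 1 => (23 * (pel u v n).1 + 44 * (pel u v n).2, 12 * (pel u v n).1 + 23 * (pel u v n).2)

theorem pel_per (u v m : ℤ) (N : ℕ) (h1 : (pel u v N).1 ≡ u [ZMOD m])
    (h2 : (pel u v N).2 ≡ v [ZMOD m]) (n : ℕ) :
    (pel u v (n + N)).1 ≡ (pel u v n).1 [ZMOD m] ∧ (pel u v (n + N)).2 ≡ (pel u v n).2 [ZMOD m] := by
  induction n with
  | zero => simpa [pel] using ⟨h1, h2⟩
  | succ k ih =>
    rw [show k + 1 + N = (k + N) + 1 by ring]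
    simp only [pel]
    exact ⟨(ih.1.mul_left 23).add (ih.2.mul_left 44), (ih.1.mul_left 12).add (ih.2.mul_left 23)⟩

theorem pel_mod (u v m : ℤ) (N : ℕ) (h1 : (pel u v N).1 ≡ u [ZMOD m])
    (h2 : (pel u v N).2 ≡ v [ZMOD m]) (n : ℕ) :
    (pel u v n).2 ≡ (pel u v (n % N)).2 [ZMOD m] := by
  have key : ∀ q r : ℕ, (pel u v (r + N * q)).2 ≡ (pel u v r).2 [ZMOD m] := by
    intro q r
    induction q with
    | zero => simp
    | succ q ih =>
      rw [show r + N * (q + 1) = (r + N * q) + N by ring]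
      exact (pel_per u v m N h1 h2 _).2.trans ih
  have := key (n / N) (n % N)
  rwa [Nat.mod_add_div] at this

theorem pell_one : ∀ (k : ℕ) (u v : ℤ), v.natAbs = k → 0 < u → 0 < v → 3 * u ^ 2 - 11 * v ^ 2 = 1 →
    ∃ n, (u, v) = pel 2 1 n := by
  intro k
  induction k using Nat.strong_induction_on with
  | _ k ih =>
  intro u v hk hu hv h
  by_cases hs : v < 7
  · have hu6 : u ≤ 20 := by nlinarith
    refine ⟨0, ?_⟩
    simp only [pel]
    have : v = 1 := by
      interval_cases v
      · rfl
      all_goals (exfalso; interval_cases u <;> omega)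
    subst this
    have : u = 2 := by nlinarith
    rw [this]
  · push Not at hs
    have a1 : 0 < 23 * v - 12 * u := by nlinarith
    have a2 : 23 * v - 12 * u < v := by nlinarith
    have a3 : 0 < 23 * u - 44 * v := by nlinarith
    obtain ⟨n, hn⟩ := ih (23 * v - 12 * u).natAbs (by omega) (23 * u - 44 * v) (23 * v - 12 * u) rfl a3 a1
      (by nlinarith)
    refine ⟨n + 1, ?_⟩
    simp only [pel, ← hn]
    ext <;> simp <;> ring

theorem pell_eight : ∀ (k : ℕ) (u v : ℤ), v.natAbs = k → 0 < u → 0 < v → 3 * u ^ 2 - 11 * v ^ 2 = -8 →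
    ∃ n, (u, v) = pel 1 1 n ∨ (u, v) = pel (-1) 1 n := by
  intro k
  induction k using Nat.strong_induction_on with
  | _ k ih =>
  intro u v hk hu hv h
  by_cases hs : v < 20
  · have hu6 : u < 40 := by nlinarith
    have hv' : v = 1 ∨ v = 11 := by
      clear ih hk
      interval_cases v <;> first | omega | skip
      all_goals (exfalso; interval_cases u <;> omega)
    rcases hv' with rfl | rfl
    · refine ⟨0, Or.inl ?_⟩
      have : u = 1 := by nlinarith
      simp [pel, this]
    · refine ⟨1, Or.inr ?_⟩
      have : u = 21 := by nlinarith
      simp [pel, this]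
  · push Not at hs
    have a1 : 0 < 23 * v - 12 * u := by nlinarith
    have a2 : 23 * v - 12 * u < v := by nlinarith
    have a3 : 0 < 23 * u - 44 * v := by nlinarith
    obtain ⟨n, hn⟩ := ih (23 * v - 12 * u).natAbs (by omega) (23 * u - 44 * v) (23 * v - 12 * u) rfl a3 a1
      (by nlinarith)
    refine ⟨n + 1, ?_⟩
    rcases hn with hn | hn
    · left
      simp only [pel, ← hn]
      ext <;> simp <;> ring
    · right
      simp only [pel, ← hn]
      ext <;> simp <;> ring

theorem pell_one_373 (u v : ℤ) (hu : 0 < u) (hv : 0 < v) (h : 3 * u ^ 2 - 11 * v ^ 2 = 1)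
    (h11 : (11:ℤ) ∣ v) : (373:ℤ) ∣ v := by
  obtain ⟨n, hn⟩ := pell_one _ u v rfl hu hv h
  have hv2 : v = (pel 2 1 n).2 := by rw [← hn]
  have e1 := pel_mod 2 1 11 11 (by decide) (by decide) n
  have e2 := pel_mod 2 1 373 11 (by decide) (by decide) n
  rw [← hv2] at e1 e2
  have e3 : (pel 2 1 (n % 11)).2 % 11 = 0 := by
    rw [← e1]; exact Int.emod_eq_zero_of_dvd h11
  have key : ∀ r < 11, (pel 2 1 r).2 % 11 = 0 → (pel 2 1 r).2 % 373 = 0 := by decide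
  have := key _ (Nat.mod_lt n (by norm_num)) e3
  exact Int.dvd_of_emod_eq_zero (by rw [e2]; exact this)

/-- `3u² = 1 + 11^(2m+1)` forces `m = 0`. -/
theorem three_sq_eq (u : ℤ) (m : ℕ) (h : 3 * u ^ 2 = 1 + 11 ^ (2 * m + 1)) : m = 0 ∧ u ^ 2 = 4 := by
  by_cases hm : m = 0
  · subst hm; exact ⟨rfl, by norm_num at h; linarith⟩
  exfalso
  have hu : u ≠ 0 := by rintro rfl; have : (0:ℤ) < 11 ^ (2 * m + 1) := by positivity
                        linarith
  have h1 := pell_one_373 |u| (11 ^ m) (abs_pos.mpr hu) (by positivity) (by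
    rw [sq_abs, h]; ring) (dvd_pow_self _ hm)
  have h2 := (Int.prime_iff_natAbs_prime.mpr (by norm_num : Nat.Prime (Int.natAbs 373))).dvd_of_dvd_pow h1
  norm_num at h2

theorem pel_key1 : ∀ r < 30, ∀ u ∈ ([1, -1] : List ℤ), (pel u 1 r).2 % 5 = 0 →
    (pel u 1 r).2 ^ 44 % 89 ≠ 1 ∨ (pel u 1 r).2 ^ 1080 % 2161 ≠ 1 := by
  decide +kernel

theorem pel_key2 : ∀ r < 121, ∀ u ∈ ([1, -1] : List ℤ), (pel u 1 r).2 % 121 = 0 →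
    (pel u 1 r).2 ^ 48 % 241 ≠ 1 := by
  decide +kernel

set_option exponentiation.threshold 2000 in
theorem pell_eight_sol (u V : ℤ) (i j : ℕ) (hV : V = 5 ^ i * 11 ^ j) (h : 3 * u ^ 2 + 8 = 11 * V ^ 2) :
    i = 0 ∧ j ≤ 1 := by
  have hu : u ≠ 0 := by
    rintro rfl; omega
  obtain ⟨n, hn⟩ : ∃ n, ∃ e ∈ ([1, -1] : List ℤ), (|u|, V) = pel e 1 n := by
    obtain ⟨n, hn | hn⟩ := pell_eight _ |u| V rfl (abs_pos.mpr hu) (by rw [hV]; positivity) (by rw [sq_abs]; linarith)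
    exacts [⟨n, 1, by simp, hn⟩, ⟨n, -1, by simp, hn⟩]
  obtain ⟨e, he, hn⟩ := hn
  have hv2 : V = (pel e 1 n).2 := by rw [← hn]
  have per : ∀ e ∈ ([1, -1] : List ℤ), ((pel e 1 30).1 ≡ e [ZMOD (5 * 89 * 2161)] ∧ (pel e 1 30).2 ≡ 1 [ZMOD (5*89*2161)]) ∧
      ((pel e 1 121).1 ≡ e [ZMOD (121 * 241)] ∧ (pel e 1 121).2 ≡ 1 [ZMOD (121*241)]) := by
    unfold Int.ModEq
    decide +kernel
  obtain ⟨⟨p1, p2⟩, p3, p4⟩ := per e he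
  have e1 := pel_mod e 1 _ 30 p1 p2 n
  have e2 := pel_mod e 1 _ 121 p3 p4 n
  rw [← hv2] at e1 e2
  constructor
  · by_contra hi
    have h5 : (pel e 1 (n % 30)).2 % 5 = 0 := by
      have := (e1.of_mul_right _ : V ≡ _ [ZMOD 5 * 89]).of_mul_right 89
      rw [← this, hV]
      exact Int.emod_eq_zero_of_dvd ((dvd_pow_self _ hi).mul_right _)
    have h89 : V ≡ (pel e 1 (n % 30)).2 [ZMOD 89] := (e1.of_mul_right _ : V ≡ _ [ZMOD 5 * 89]).of_mul_left 5
    have h2161 : V ≡ (pel e 1 (n % 30)).2 [ZMOD 2161] := e1.of_mul_left _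
    have q1 : V ^ 44 ≡ 1 [ZMOD 89] := by
      rw [hV, mul_pow, ← pow_mul, ← pow_mul, mul_comm i, mul_comm j, pow_mul, pow_mul]
      have a : (5:ℤ) ^ 44 ≡ 1 [ZMOD 89] := by decide
      have b : (11:ℤ) ^ 44 ≡ 1 [ZMOD 89] := by decide
      simpa using (a.pow i).mul (b.pow j)
    have q2 : V ^ 1080 ≡ 1 [ZMOD 2161] := by
      rw [hV, mul_pow, ← pow_mul, ← pow_mul, mul_comm i, mul_comm j, pow_mul, pow_mul]
      have a : (5:ℤ) ^ 1080 ≡ 1 [ZMOD 2161] := by unfold Int.ModEq; decide +kernel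
      have b : (11:ℤ) ^ 1080 ≡ 1 [ZMOD 2161] := by unfold Int.ModEq; decide +kernel
      simpa using (a.pow i).mul (b.pow j)
    rcases pel_key1 _ (Nat.mod_lt n (by norm_num)) e he h5 with h | h
    · exact h (((h89.pow 44).symm.trans q1))
    · exact h (((h2161.pow 1080).symm.trans q2))
  · by_contra hj
    push Not at hj
    obtain ⟨k, rfl⟩ : ∃ k, j = 2 + k := ⟨j - 2, by omega⟩
    by_cases hi : i = 0
    · subst hi
      have h121 : (pel e 1 (n % 121)).2 % 121 = 0 := by
        have := (e2.of_mul_right _ : V ≡ _ [ZMOD 121])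
        rw [← this, hV]
        apply Int.emod_eq_zero_of_dvd
        exact ⟨11 ^ k, by ring⟩
      have h241 : V ≡ (pel e 1 (n % 121)).2 [ZMOD 241] := e2.of_mul_left _
      have q1 : V ^ 48 ≡ 1 [ZMOD 241] := by
        rw [hV, pow_zero, one_mul, ← pow_mul, mul_comm _ 48, pow_mul]
        have b : (11:ℤ) ^ 48 ≡ 1 [ZMOD 241] := by decide
        simpa using (b.pow (2 + k))
      exact pel_key2 _ (Nat.mod_lt n (by norm_num)) e he h121 ((h241.pow 48).symm.trans q1)
    · exfalso
      have h5 : (pel e 1 (n % 30)).2 % 5 = 0 := by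
        have := (e1.of_mul_right _ : V ≡ _ [ZMOD 5 * 89]).of_mul_right 89
        rw [← this, hV]
        exact Int.emod_eq_zero_of_dvd ((dvd_pow_self _ hi).mul_right _)
      have h89 : V ≡ (pel e 1 (n % 30)).2 [ZMOD 89] := (e1.of_mul_right _ : V ≡ _ [ZMOD 5 * 89]).of_mul_left 5
      have h2161 : V ≡ (pel e 1 (n % 30)).2 [ZMOD 2161] := e1.of_mul_left _
      have q1 : V ^ 44 ≡ 1 [ZMOD 89] := by
        rw [hV, mul_pow, ← pow_mul, ← pow_mul, mul_comm i, mul_comm (2 + k), pow_mul, pow_mul]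
        have a : (5:ℤ) ^ 44 ≡ 1 [ZMOD 89] := by decide
        have b : (11:ℤ) ^ 44 ≡ 1 [ZMOD 89] := by decide
        simpa using (a.pow i).mul (b.pow (2 + k))
      have q2 : V ^ 1080 ≡ 1 [ZMOD 2161] := by
        rw [hV, mul_pow, ← pow_mul, ← pow_mul, mul_comm i, mul_comm (2 + k), pow_mul, pow_mul]
        have a : (5:ℤ) ^ 1080 ≡ 1 [ZMOD 2161] := by unfold Int.ModEq; decide +kernel
        have b : (11:ℤ) ^ 1080 ≡ 1 [ZMOD 2161] := by unfold Int.ModEq; decide +kernel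
        simpa using (a.pow i).mul (b.pow (2 + k))
      rcases pel_key1 _ (Nat.mod_lt n (by norm_num)) e he h5 with h | h
      · exact h (((h89.pow 44).symm.trans q1))
      · exact h (((h2161.pow 1080).symm.trans q2))
end

section

theorem eleven_of_dvd (r : ℤ) (α β : ℕ) (h : r ∣ 5 ^ α * 11 ^ β) (h5 : ¬ (5:ℤ) ∣ r) :
    ∃ j, r = 11 ^ j ∨ r = -11 ^ j := by
  have p5 : Prime (5:ℤ) := Nat.prime_iff_prime_int.mp (by norm_num)
  have p11 : Prime (11:ℤ) := Nat.prime_iff_prime_int.mp (by norm_num)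
  have hc : IsCoprime r (5 ^ α) := ((p5.coprime_iff_not_dvd.mpr h5).symm).pow_right
  have := hc.dvd_of_dvd_mul_left h
  obtain ⟨j, -, hj⟩ := (dvd_prime_pow p11 β).1 this
  exact ⟨j, Int.associated_iff.mp hj⟩

theorem five_of_dvd (r : ℤ) (α β : ℕ) (h : r ∣ 5 ^ α * 11 ^ β) (h5 : ¬ (11:ℤ) ∣ r) :
    ∃ j, r = 5 ^ j ∨ r = -5 ^ j := by
  have p5 : Prime (5:ℤ) := Nat.prime_iff_prime_int.mp (by norm_num)
  have p11 : Prime (11:ℤ) := Nat.prime_iff_prime_int.mp (by norm_num)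
  have hc : IsCoprime r (11 ^ β) := ((p11.coprime_iff_not_dvd.mpr h5).symm).pow_right
  have := hc.dvd_of_dvd_mul_right h
  obtain ⟨j, -, hj⟩ := (dvd_prime_pow p5 α).1 this
  exact ⟨j, Int.associated_iff.mp hj⟩

theorem not_both {l W y : ℤ} (hl : ¬ IsUnit l) (h : IsCoprime W y) (h1 : l ∣ W) (h2 : l ∣ y) : False :=
  hl (h.isUnit_of_dvd' h1 h2)

theorem nu5 : ¬ IsUnit (5:ℤ) := by decide
theorem nu11 : ¬ IsUnit (11:ℤ) := by decide
theorem nu3 : ¬ IsUnit (3:ℤ) := by decide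
theorem nu2 : ¬ IsUnit (2:ℤ) := by decide

theorem m11 (j : ℕ) : (11:ℤ) ^ j % 5 = 1 := by
  have : (11:ℤ) ^ j ≡ 1 ^ j [ZMOD 5] := Int.ModEq.pow j (by decide)
  simpa [Int.ModEq] using this

theorem m11_3 (j : ℕ) : (11:ℤ) ^ (2 * j) % 3 = 1 := by
  have : ((11:ℤ) ^ 2) ^ j ≡ 1 ^ j [ZMOD 3] := Int.ModEq.pow j (by decide)
  rw [pow_mul]
  simpa [Int.ModEq] using this

/-- 3 p^2 - q^2 divisible by 5 forces both divisible -/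
theorem mod5_a (p q : ℤ) (h : (5:ℤ) ∣ 3 * p ^ 2 - q ^ 2) : (5:ℤ) ∣ p ∧ (5:ℤ) ∣ q := by
  have hp : p % 5 = 0 ∨ p % 5 = 1 ∨ p % 5 = 2 ∨ p % 5 = 3 ∨ p % 5 = 4 := by omega
  have hq : q % 5 = 0 ∨ q % 5 = 1 ∨ q % 5 = 2 ∨ q % 5 = 3 ∨ q % 5 = 4 := by omega
  have h' := Int.emod_eq_zero_of_dvd h
  rcases hp with hp | hp | hp | hp | hp <;> rcases hq with hq | hq | hq | hq | hq <;>
    simp [pow_two, Int.sub_emod, Int.mul_emod, hp, hq] at h' <;> omega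

theorem mod5_b (p r : ℤ) (h : (3 * p ^ 2 - r) % 5 = 0) (hr : r % 5 = 1 ∨ r % 5 = 4) : False := by
  have hp : p % 5 = 0 ∨ p % 5 = 1 ∨ p % 5 = 2 ∨ p % 5 = 3 ∨ p % 5 = 4 := by omega
  rcases hp with hp | hp | hp | hp | hp <;> rcases hr with hr | hr <;>
    simp [pow_two, Int.sub_emod, Int.mul_emod, hp, hr] at h

theorem mod3_a (q : ℤ) : q ^ 2 % 3 = 0 ∨ q ^ 2 % 3 = 1 := by
  have hp : q % 3 = 0 ∨ q % 3 = 1 ∨ q % 3 = 2 := by omega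
  rcases hp with hp | hp | hp <;> simp [pow_two, Int.mul_emod, hp]

theorem mod11_a (p : ℤ) (h : (3 * p ^ 2 + 1) % 11 = 0) : False := by
  have hp : p % 11 = 0 ∨ p % 11 = 1 ∨ p % 11 = 2 ∨ p % 11 = 3 ∨ p % 11 = 4 ∨ p % 11 = 5 ∨
    p % 11 = 6 ∨ p % 11 = 7 ∨ p % 11 = 8 ∨ p % 11 = 9 ∨ p % 11 = 10 := by omega
  rcases hp with hp | hp | hp | hp | hp | hp | hp | hp | hp | hp | hp <;>
    simp [pow_two, Int.add_emod, Int.mul_emod, hp] at h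

theorem part_d1 (α β : ℕ) (x y : ℤ) (hx : 0 < x) (hy : 0 < y)
    (h : x ^ 2 + (5 ^ α * 11 ^ β) ^ 2 = y ^ 3) (hW : IsCoprime (5 ^ α * 11 ^ β) y) :
    α = 0 ∧ β = 1 ∧ x = 2 ∧ y = 5 := by
  obtain ⟨p, q, h1, h2, h3⟩ := cube1 x _ y hy h hW
  have hqr : q * (3 * p ^ 2 - q ^ 2) = 5 ^ α * 11 ^ β := by linear_combination h2
  have h5 : ¬ (5:ℤ) ∣ 3 * p ^ 2 - q ^ 2 := by
    intro hd
    obtain ⟨a, b⟩ := mod5_a _ _ hd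
    refine not_both nu5 hW ?_ ?_
    · rw [← hqr]; exact b.mul_right _
    · rw [← h3]; exact dvd_add (a.pow (by norm_num)) (b.pow (by norm_num))
  obtain ⟨j, hj⟩ := eleven_of_dvd _ α β ⟨q, by rw [← hqr]; ring⟩ h5
  by_cases hj0 : j = 0
  · subst hj0
    exfalso
    rcases hj with hj | hj
    · have := mod3_a q; simp at hj; omega
    · simp at hj
      have hq : q = -(5 ^ α * 11 ^ β) := by rw [hj] at hqr; linarith
      have ha : α = 0 := by
        by_contra ha
        obtain ⟨k, rfl⟩ := Nat.exists_eq_succ_of_ne_zero ha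
        refine mod5_b p (-1) ?_ (by decide)
        have : 3 * p ^ 2 - -1 = 5 * (5 ^ k * 11 ^ β * -q) := by
          rw [show 3 * p ^ 2 = q ^ 2 - 1 by linarith, pow_two]; nth_rw 1 [hq]; rw [pow_succ]; ring
        rw [this]; simp
      have hb : β = 0 := by
        by_contra ha
        obtain ⟨k, rfl⟩ := Nat.exists_eq_succ_of_ne_zero ha
        refine mod11_a p ?_
        have : 3 * p ^ 2 + 1 = 11 * (5 ^ α * 11 ^ k * -q) := by
          rw [show 3 * p ^ 2 = q ^ 2 - 1 by linarith, pow_two]; nth_rw 1 [hq]; rw [pow_succ]; ring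
        rw [this]; simp
      subst ha hb
      simp at hq
      subst hq
      have : p = 0 := by nlinarith
      subst this
      simp at h1; omega
  · obtain ⟨k, rfl⟩ := Nat.exists_eq_succ_of_ne_zero hj0
    have h11 : (11:ℤ) ∣ 3 * p ^ 2 - q ^ 2 := by
      rcases hj with hj | hj <;> rw [hj, pow_succ] <;> simp
    have hq11 : ¬ (11:ℤ) ∣ q := by
      intro hd
      have p11 : Prime (11:ℤ) := Nat.prime_iff_prime_int.mp (by norm_num)
      have e : (11:ℤ) ∣ 3 * p ^ 2 := by
        have := dvd_add h11 (hd.pow (two_ne_zero)); simpa using this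
      have e2 : (11:ℤ) ∣ p := by
        rcases p11.dvd_or_dvd e with e | e
        · norm_num at e
        · exact p11.dvd_of_dvd_pow e
      refine not_both nu11 hW ?_ ?_
      · rw [← hqr]; exact hd.mul_right _
      · rw [← h3]; exact dvd_add (e2.pow (by norm_num)) (hd.pow (by norm_num))
    obtain ⟨i, hi⟩ := five_of_dvd _ α β ⟨_, hqr.symm⟩ hq11
    have hi0 : i = 0 := by
      by_contra hi0
      obtain ⟨l, rfl⟩ := Nat.exists_eq_succ_of_ne_zero hi0
      have := m11 (k+1)
      have hq5 : (5:ℤ) ∣ q := by rcases hi with hi | hi <;> rw [hi, pow_succ] <;> simp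
      obtain ⟨t, ht⟩ := hq5
      have e : q ^ 2 = 5 * (5 * t ^ 2) := by rw [ht]; ring
      rcases hj with hj | hj
      · exact mod5_b p (11 ^ (k+1)) (by simp only [Nat.succ_eq_add_one] at hj; omega) (by omega)
      · exact mod5_b p (-11 ^ (k+1)) (by simp only [Nat.succ_eq_add_one] at hj; omega) (by omega)
    subst hi0
    have hqq : q ^ 2 = 1 := by rcases hi with hi | hi <;> simp [hi]
    have hj' : 3 * p ^ 2 = 1 + 11 ^ (k + 1) := by
      rcases hj with hj | hj
      · simp only [Nat.succ_eq_add_one] at hj; linarith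
      · simp only [Nat.succ_eq_add_one] at hj
        have : (1:ℤ) ≤ 11 ^ k := one_le_pow₀ (by norm_num)
        rw [pow_succ 11 k] at hj
        nlinarith [sq_nonneg p]
    have hpar : ∃ m, k + 1 = 2 * m + 1 := by
      rcases Nat.even_or_odd' (k+1) with ⟨m, hm | hm⟩
      · rw [hm] at hj'; have := m11_3 m; omega
      · exact ⟨m, hm⟩
    obtain ⟨m, hm⟩ := hpar
    rw [hm] at hj'
    obtain ⟨rfl, hp⟩ := three_sq_eq _ _ hj'
    have hk : k = 0 := by omega
    subst hk
    have hx2 : x ^ 2 = 4 := by rw [← h1]; linear_combination (p^4 - 6 * p^2 * q^2 + 9 * q^4 + 4 * p^2 - 24*q^2 + 16 ) * hp + (-24*p^2 +36 *q^2 - 60 +24*p^2) * hqq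
    have hW11 : (5:ℤ) ^ α * 11 ^ β = 11 := by
      have : (5:ℤ) ^ α * 11 ^ β ≥ 1 := by
        have : (0:ℤ) < 5 ^ α * 11 ^ β := by positivity
        linarith
      have hsq : ((5:ℤ) ^ α * 11 ^ β)^2 = 11 ^ 2 := by
        rw [← hqr, mul_pow, show 3 * p^2 - q^2 = 11 by linarith, hqq]; norm_num
      nlinarith
    have hα : α = 0 := by
      by_contra ha
      obtain ⟨k, rfl⟩ := Nat.exists_eq_succ_of_ne_zero ha
      rw [pow_succ] at hW11
      have : (5:ℤ) ∣ 11 := ⟨5 ^ k * 11 ^ β, by linarith⟩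
      norm_num at this
    subst hα
    have hβ : β = 1 := by
      have : (11:ℕ) ^ β = 11 ^ 1 := by have : (11:ℤ)^β = 11^1 := by simpa using hW11
                                       exact_mod_cast this
      exact Nat.pow_right_injective (le_refl _ |>.trans (by norm_num)) this
    refine ⟨rfl, hβ, by nlinarith, by linarith⟩


theorem part_d5like (d p q y : ℤ) (α β : ℕ) (hd : (5:ℤ) ∣ d)
    (hW : IsCoprime (5 ^ α * 11 ^ β) y)
    (h2 : q * (3 * p ^ 2 - d * q ^ 2) = 5 ^ α * 11 ^ β) (h3 : p ^ 2 + d * q ^ 2 = y) : False := by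
  have p5 : Prime (5:ℤ) := Nat.prime_iff_prime_int.mp (by norm_num)
  have h5 : ¬ (5:ℤ) ∣ 3 * p ^ 2 - d * q ^ 2 := by
    intro h
    have e : (5:ℤ) ∣ 3 * p ^ 2 := by
      have := dvd_add h (hd.mul_right (q ^ 2)); simpa using this
    have e2 : (5:ℤ) ∣ p := by
      rcases p5.dvd_or_dvd e with e | e
      · norm_num at e
      · exact p5.dvd_of_dvd_pow e
    refine not_both nu5 hW ?_ ?_
    · rw [← h2]; exact h.mul_left _
    · rw [← h3]; exact dvd_add (e2.pow (by norm_num)) (hd.mul_right _)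
  obtain ⟨j, hj⟩ := eleven_of_dvd _ α β ⟨q, by rw [← h2]; ring⟩ h5
  obtain ⟨t, rfl⟩ := hd
  have := m11 j
  have e : 5 * t * q ^ 2 = 5 * (t * q ^ 2) := by ring
  rcases hj with hj | hj
  · exact mod5_b p (11 ^ j) (by omega) (by omega)
  · exact mod5_b p (-11 ^ j) (by omega) (by omega)

theorem part_d5 (α β : ℕ) (x y : ℤ) (hy : 0 < y)
    (h : x ^ 2 + 5 * (5 ^ α * 11 ^ β) ^ 2 = y ^ 3) (hW : IsCoprime (5 ^ α * 11 ^ β) y) : False := by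
  obtain ⟨p, q, h1, h2, h3⟩ := cube5 x _ y hy h hW
  exact part_d5like 5 p q y α β (by norm_num) hW (by linear_combination h2) h3

theorem sq8 (p : ℤ) (h : p % 2 = 1) : p ^ 2 % 8 = 1 := by
  have hp : p % 8 = 1 ∨ p % 8 = 3 ∨ p % 8 = 5 ∨ p % 8 = 7 := by omega
  rcases hp with hp | hp | hp | hp <;> simp [pow_two, Int.mul_emod, hp]

theorem d11_core (p q r' : ℤ) (y : ℤ) (α β : ℕ) (k l : ℤ) (hk : k = 1 ∨ k = 8) (hl : l = 1 ∨ l = 4)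
    (hW : IsCoprime (5 ^ α * 11 ^ β) y) (hr : 3 * p ^ 2 - 11 * q ^ 2 = k * r')
    (h2 : q * r' = 5 ^ α * 11 ^ β) (h3 : p ^ 2 + 11 * q ^ 2 = l * y) : r' = 1 ∨ r' = -1 := by
  have p5 : Prime (5:ℤ) := Nat.prime_iff_prime_int.mp (by norm_num)
  have p11 : Prime (11:ℤ) := Nat.prime_iff_prime_int.mp (by norm_num)
  have h11 : ¬ (11:ℤ) ∣ r' := by
    intro h
    have e : (11:ℤ) ∣ 3 * p ^ 2 := by
      rw [show 3 * p ^ 2 = k * r' + 11 * q ^ 2 by linarith]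
      exact dvd_add (h.mul_left _) ⟨_, rfl⟩
    have e2 : (11:ℤ) ∣ p := by
      rcases p11.dvd_or_dvd e with e | e
      · norm_num at e
      · exact p11.dvd_of_dvd_pow e
    refine not_both nu11 hW ?_ ?_
    · rw [← h2]; exact h.mul_left _
    · have : (11:ℤ) ∣ l * y := by rw [← h3]; exact dvd_add (e2.pow (by norm_num)) ⟨_, rfl⟩
      rcases p11.dvd_or_dvd this with e | e
      · rcases hl with rfl | rfl <;> norm_num at e
      · exact e
  have h5 : ¬ (5:ℤ) ∣ r' := by
    intro h
    obtain ⟨a, b⟩ := mod5_a p q (by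
      rw [show 3 * p ^ 2 - q ^ 2 = k * r' + 5 * (2 * q ^ 2) by linarith]
      exact dvd_add (h.mul_left _) ⟨_, rfl⟩)
    refine not_both nu5 hW ?_ ?_
    · rw [← h2]; exact h.mul_left _
    · have : (5:ℤ) ∣ l * y := by
        rw [← h3]; exact dvd_add (a.pow (by norm_num)) ((b.pow (by norm_num)).mul_left _)
      rcases p5.dvd_or_dvd this with e | e
      · rcases hl with rfl | rfl <;> norm_num at e
      · exact e
  obtain ⟨j, hj⟩ := eleven_of_dvd _ α β ⟨q, by rw [← h2]; ring⟩ h5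
  have : j = 0 := by
    by_contra h0
    obtain ⟨t, rfl⟩ := Nat.exists_eq_succ_of_ne_zero h0
    apply h11
    rcases hj with hj | hj <;> rw [hj, pow_succ] <;> simp
  subst this
  simpa using hj

theorem part_d11 (α β : ℕ) (x y : ℤ) (hx : 0 < x) (hy : 0 < y)
    (h : x ^ 2 + 11 * (5 ^ α * 11 ^ β) ^ 2 = y ^ 3) (hW : IsCoprime (5 ^ α * 11 ^ β) y) :
    (α = 0 ∧ β = 0 ∧ x = 4 ∧ y = 3) ∨ (α = 0 ∧ β = 0 ∧ x = 58 ∧ y = 15) ∨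
      (α = 0 ∧ β = 1 ∧ x = 9324 ∧ y = 443) := by
  obtain ⟨p, q, h1, h2, h3⟩ := cube11 x _ y hy h hW
  have hpar : (p % 2 = 1 ∧ q % 2 = 1) ∨ (p % 2 = 0 ∧ q % 2 = 0) := by
    have : (p ^ 2 + 11 * q ^ 2) % 2 = 0 := by omega
    rcases Int.emod_two_eq_zero_or_one p with hp | hp <;>
      rcases Int.emod_two_eq_zero_or_one q with hq | hq <;>
      simp [pow_two, Int.add_emod, Int.mul_emod, hp, hq] at this ⊢
  rcases hpar with ⟨hp, hq⟩ | ⟨hp, hq⟩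
  · have e1 := sq8 p hp
    have e2 := sq8 q hq
    obtain ⟨r, hr⟩ : (8:ℤ) ∣ 3 * p ^ 2 - 11 * q ^ 2 := by omega
    have hqr : q * r = 5 ^ α * 11 ^ β := by
      have : 8 * (q * r) = 8 * (5 ^ α * 11 ^ β) := by linear_combination h2 - q * hr
      linarith
    have := mod3_a q
    rcases d11_core p q r y α β 8 4 (by simp) (by simp) hW hr hqr h3 with rfl | rfl
    · clear hqr h2 h1 h hW h3 e1 e2; omega
    · have hq' : q ^ 2 = (5 ^ α * 11 ^ β) ^ 2 := by rw [← hqr]; ring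
      obtain ⟨ha, hb⟩ := pell_eight_sol p (5 ^ α * 11 ^ β) α β rfl (by rw [← hq']; linarith)
      subst ha
      have hb' : β = 0 ∨ β = 1 := by omega
      rcases hb' with rfl | rfl
      · simp at hq' h
        left
        have hy3 : y = 3 := by rcases hq' with rfl | rfl <;> linarith
        subst hy3
        exact ⟨rfl, rfl, by nlinarith, rfl⟩
      · norm_num at hq' h
        right; right
        have hy3 : y = 443 := by linarith
        subst hy3
        exact ⟨rfl, rfl, by nlinarith, rfl⟩
  · obtain ⟨p, rfl⟩ : ∃ t, p = 2 * t := ⟨p / 2, by omega⟩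
    obtain ⟨q, rfl⟩ : ∃ t, q = 2 * t := ⟨q / 2, by omega⟩
    have hqr : q * (3 * p ^ 2 - 11 * q ^ 2) = 5 ^ α * 11 ^ β := by
      have : 8 * (q * (3 * p ^ 2 - 11 * q ^ 2)) = 8 * (5 ^ α * 11 ^ β) := by linear_combination h2
      linarith
    have := mod3_a q
    have hc := d11_core p q _ y α β 1 1 (by simp) (by simp) hW (by rw [one_mul]) hqr (by linarith)
    rcases hc with hc | hc
    · rw [hc, mul_one] at hqr
      have ha : α = 0 := by
        by_contra h0
        obtain ⟨t, rfl⟩ := Nat.exists_eq_succ_of_ne_zero h0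
        have : q = 5 * (5 ^ t * 11 ^ β) := by rw [hqr, pow_succ]; ring
        refine mod5_b p 1 ?_ (by decide)
        rw [show 3 * p ^ 2 - 1 = 11 * q ^ 2 by linarith, this]
        apply Int.emod_eq_zero_of_dvd
        exact ⟨11 * 5 * (5 ^ t * 11 ^ β) ^ 2, by ring⟩
      subst ha
      obtain ⟨hb, hp4⟩ := three_sq_eq p β (by
        rw [show 3 * p ^ 2 = 1 + 11 * q ^ 2 by linarith, hqr]; ring)
      subst hb
      simp at hqr h
      subst hqr
      have hy3 : y = 15 := by linarith
      subst hy3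
      exact Or.inr (Or.inl ⟨rfl, rfl, by nlinarith, rfl⟩)
    · omega

/-- the second shape forces y even -/
theorem second_even (p q e x W y : ℤ) (he : e = 1 ∨ e = -1)
    (h : x ^ 2 + 55 * W ^ 2 = y ^ 3)
    (h1 : p ^ 3 - 165 * p * q ^ 2 = 3 * x - 55 * e * W)
    (h3 : p ^ 2 + 55 * q ^ 2 = 4 * y) : y % 2 = 0 := by
  have hpar : (p % 2 = 1 ∧ q % 2 = 1) ∨ (p % 2 = 0 ∧ q % 2 = 0) := by
    have : (p ^ 2 + 55 * q ^ 2) % 2 = 0 := by omega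
    rcases Int.emod_two_eq_zero_or_one p with hp | hp <;>
      rcases Int.emod_two_eq_zero_or_one q with hq | hq <;>
      simp [pow_two, Int.add_emod, Int.mul_emod, hp, hq] at this ⊢
  rcases hpar with ⟨hp, hq⟩ | ⟨hp, hq⟩
  · have e1 := sq8 p hp
    have e2 := sq8 q hq
    omega
  · obtain ⟨p, rfl⟩ : ∃ t, p = 2 * t := ⟨p / 2, by omega⟩
    obtain ⟨q, rfl⟩ : ∃ t, q = 2 * t := ⟨q / 2, by omega⟩
    have hy : (2:ℤ) ∣ y ^ 3 := by
      rw [← h]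
      have e2 : e ^ 2 = 1 := by rcases he with rfl | rfl <;> norm_num
      have : x = 55 * e * W - 2 * x + 8 * (p ^ 3 - 165 * p * q ^ 2) := by linarith
      have h8 : (2:ℤ) ∣ x - e * W := by
        refine ⟨27 * e * W - x + 4 * (p ^ 3 - 165 * p * q ^ 2), by linarith⟩
      obtain ⟨t, ht⟩ := h8
      have hx : x = e * W + 2 * t := by linarith
      rw [hx]
      exact ⟨28 * W ^ 2 + 2 * e * W * t + 2 * t ^ 2, by linear_combination W ^ 2 * e2⟩
    have := Int.prime_two.dvd_of_dvd_pow hy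
    omega

theorem part_d55_odd (α β : ℕ) (x y : ℤ) (hy : 0 < y) (hodd : y % 2 = 1)
    (h : x ^ 2 + 55 * (5 ^ α * 11 ^ β) ^ 2 = y ^ 3) (hW : IsCoprime (5 ^ α * 11 ^ β) y) : False := by
  rcases cube55 x _ y hy h hW with ⟨p, q, h1, h2, h3⟩ | ⟨p, q, e, he, h1, h2, h3⟩
  · exact part_d5like 55 p q y α β (by norm_num) hW (by linear_combination h2) h3
  · have := second_even p q e x _ y he h h1 h3
    omega
end

section

theorem zm_sq (m : ℕ) (A B n : ℤ) (h : A ^ 2 - 165 * B ^ 2 = n ^ 3) :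
    (A : ZMod m) ^ 2 - 165 * (B : ZMod m) ^ 2 = (n : ZMod m) ^ 3 := by
  exact_mod_cast congrArg (Int.cast : ℤ → ZMod m) h

theorem n165 (n A B b' c' : ℤ) (h : A ^ 2 - 165 * B ^ 2 = n ^ 3) (h1 : n * c' - b' ^ 2 = -165)
    (h2 : 2 * |b'| ≤ |n|) (h3 : |n| ≤ |c'|) : n = 1 ∨ n = 4 ∨ n = -11 := by
  have hb : 4 * b' ^ 2 ≤ n ^ 2 := by
    have : (2 * |b'|) ^ 2 ≤ |n| ^ 2 := by gcongr
    rw [mul_pow, sq_abs, sq_abs] at this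
    linarith
  have hnc : n ^ 2 ≤ |n * c'| := by
    rw [abs_mul, ← sq_abs]
    nlinarith [abs_nonneg n]
  have hn : n ^ 2 ≤ 165 := by
    rcases abs_cases (n * c') with ⟨h4, _⟩ | ⟨h4, _⟩ <;> nlinarith
  have hn1 := sq_bound (B := n) (k := 12) (by linarith) (by norm_num)
  have hb1 := sq_bound (B := b') (k := 6) (by nlinarith) (by norm_num)
  obtain ⟨n1, n2⟩ := hn1
  obtain ⟨b1, b2⟩ := hb1
  have z3 := zm_sq 3 A B n h
  have z5 := zm_sq 5 A B n h
  have z11 := zm_sq 11 A B n h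
  have z16 := zm_sq 16 A B n h
  have k3 : ∀ a b : ZMod 3, a ^ 2 - 165 * b ^ 2 ≠ 2 := by decide
  have k5 : ∀ a b : ZMod 5, a ^ 2 - 165 * b ^ 2 ≠ 2 ∧ a ^ 2 - 165 * b ^ 2 ≠ 3 := by decide
  have k11 : ∀ a b : ZMod 11, a ^ 2 - 165 * b ^ 2 ≠ 2 ∧ a ^ 2 - 165 * b ^ 2 ≠ 6 ∧
    a ^ 2 - 165 * b ^ 2 ≠ 7 ∧ a ^ 2 - 165 * b ^ 2 ≠ 8 ∧ a ^ 2 - 165 * b ^ 2 ≠ 10 := by decide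
  have k16 : ∀ a b : ZMod 16, a ^ 2 - 165 * b ^ 2 ≠ 8 := by decide
  have k3 := k3 A B
  have k5 := k5 A B
  have k11 := k11 A B
  have k16 := k16 A B
  rw [z3] at k3
  rw [z5] at k5
  rw [z11] at k11
  rw [z16] at k16
  clear z3 z5 z11 z16 h h2 h3 hnc hb hn
  interval_cases n <;> first
    | (left; rfl)
    | (right; left; rfl)
    | (right; right; rfl)
    | (exfalso; revert k3; decide)
    | (exfalso; revert k5; decide)
    | (exfalso; revert k11; decide)
    | (exfalso; revert k16; decide)
    | (exfalso; interval_cases b' <;> omega)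

theorem unit165 (α β p q s : ℤ) (hα : (α = 1 ∧ β = 165) ∨ (α = 3 ∧ β = 55)) : ∀ (k : ℕ) (u v A B : ℤ), B.natAbs ≤ k →
    A ^ 2 - 165 * B ^ 2 = 1 → α * u ^ 2 - β * v ^ 2 = 4 * s → (2:ℤ) ∣ u - v →
    α * u ^ 3 + 3 * β * u * v ^ 2 = 8 * (A * p + β * B * q) →
    3 * α * u ^ 2 * v + β * v ^ 3 = 8 * (A * q + α * B * p) →
    ∃ u v : ℤ, α * u ^ 2 - β * v ^ 2 = 4 * s ∧ (2:ℤ) ∣ u - v ∧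
      α * u ^ 3 + 3 * β * u * v ^ 2 = 8 * p ∧ 3 * α * u ^ 2 * v + β * v ^ 3 = 8 * q := by
  have hαβ : α * β = 165 := by rcases hα with ⟨rfl, rfl⟩ | ⟨rfl, rfl⟩ <;> norm_num
  have podd : ∃ a, α = 2 * a + 1 := by
    rcases Int.even_or_odd' α with ⟨a, h | h⟩
    · rw [h, mul_assoc] at hαβ; omega
    · exact ⟨a, h⟩
  have qodd : ∃ a, β = 2 * a + 1 := by
    rcases Int.even_or_odd' β with ⟨a, h | h⟩
    · rw [h, mul_left_comm] at hαβ; omega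
    · exact ⟨a, h⟩
  obtain ⟨a, ha⟩ := podd
  obtain ⟨b, hb⟩ := qodd
  intro k
  induction k with
  | zero =>
    intro u v A B hB h1 h2 h3 h4 h5
    have hB0 : B = 0 := by omega
    subst hB0
    have : (A - 1) * (A + 1) = 0 := by linarith
    rcases mul_eq_zero.mp this with h | h
    · have : A = 1 := by linarith
      subst this
      exact ⟨u, v, h2, h3, by linarith, by linarith⟩
    · have : A = -1 := by linarith
      subst this
      exact ⟨-u, -v, by linarith, by omega, by linarith, by linarith⟩
  | succ k ih =>
    intro u v A B hB h1 h2 h3 h4 h5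
    by_cases hB0 : B.natAbs ≤ k
    · exact ih u v A B hB0 h1 h2 h3 h4 h5
    have hBk : B.natAbs = k + 1 := by omega
    obtain ⟨t, ht⟩ := h3
    have key : ∃ e : ℤ, (e = 1 ∨ e = -1) ∧ (1079 * B - 84 * e * A).natAbs < B.natAbs := by
      have hBne : B ^ 2 ≥ 4 := by
        by_contra hlt
        have : -1 ≤ B ∧ B ≤ 1 := sq_bound (B := B) (k := 1) (by linarith) (by norm_num)
        obtain ⟨l1, l2⟩ := this
        have : B ≠ 0 := by omega
        have hB1 : B ^ 2 = 1 := by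
          have : B = 1 ∨ B = -1 := by omega
          rcases this with rfl | rfl <;> norm_num
        have hA : A ^ 2 = 166 := by linarith
        have : A ≤ 12 := by nlinarith
        have : -12 ≤ A := by nlinarith
        nlinarith
      have hAB : ∃ e : ℤ, (e = 1 ∨ e = -1) ∧ 0 ≤ e * A * B := by
        rcases le_total 0 (A * B) with h | h
        · exact ⟨1, Or.inl rfl, by linarith⟩
        · exact ⟨-1, Or.inr rfl, by linarith⟩
      obtain ⟨e, he, h0⟩ := hAB
      refine ⟨e, he, ?_⟩
      have he2 : e ^ 2 = 1 := by rcases he with rfl | rfl <;> norm_num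
      rw [Int.natAbs_lt_iff_sq_lt]
      have h6 : (e * A * B) ^ 2 = B ^ 2 * (1 + 165 * B ^ 2) := by
        have : A ^ 2 = 1 + 165 * B ^ 2 := by linarith
        rw [← this]; linear_combination (A ^ 2 * B ^ 2) * he2
      set x := e * A * B with hx
      set y := B ^ 2 with hy
      have h7 : (1079 * B - 84 * e * A) ^ 2 = 1079 ^ 2 * y - 2 * 1079 * 84 * x + 84 ^ 2 * (1 + 165 * y) := by
        rw [hx, hy]
        linear_combination (84 ^ 2 * A ^ 2) * he2 + 84 ^ 2 * h1
      rw [h7]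
      by_contra hcon
      push Not at hcon
      have h8 : 181272 * x ≤ 2328480 * y + 7056 := by linarith
      have h9 : (181272 * x) ^ 2 ≤ (2328480 * y + 7056) ^ 2 := by
        apply pow_le_pow_left₀ (by linarith) h8
      have : (181272 * x) ^ 2 = 181272 ^ 2 * (y * (1 + 165 * y)) := by rw [mul_pow, h6]
      nlinarith
    obtain ⟨e, he, hlt⟩ := key
    have he2 : e * e = 1 := by rcases he with rfl | rfl <;> norm_num
    obtain ⟨f, hf⟩ : ∃ f, e = 2 * f + 1 := by
      rcases he with rfl | rfl
      · exact ⟨0, by norm_num⟩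
      · exact ⟨-1, by norm_num⟩
    have hu : u = v + 2 * t := by linarith
    obtain ⟨u', hu'⟩ : ∃ u', 2 * u' = 13 * u - e * β * v := by
      refine ⟨13 * t + 6 * v - (2 * f * b + f + b) * v, ?_⟩
      rw [hu, hf, hb]; ring
    obtain ⟨v', hv'⟩ : ∃ v', 2 * v' = 13 * v - e * α * u := by
      refine ⟨6 * v - (2 * f * a + f + a) * v - (2 * f + 1) * (2 * a + 1) * t, ?_⟩
      rw [hu, hf, ha]; ring
    refine ih u' v' (1079 * A - 84 * 165 * e * B) (1079 * B - 84 * e * A) (by omega) ?_ ?_ ?_ ?_ ?_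
    · linear_combination h1 + (84 ^ 2 * A ^ 2 * (-165) + (84 * 165) ^ 2 * B ^ 2) * he2
    · have : 4 * (α * u' ^ 2 - β * v' ^ 2) = 4 * (4 * s) := by
        have e1 : 4 * u' ^ 2 = (13 * u - e * β * v) ^ 2 := by rw [← hu']; ring
        have e2 : 4 * v' ^ 2 = (13 * v - e * α * u) ^ 2 := by rw [← hv']; ring
        linear_combination α * e1 - β * e2 + 4 * h2 + (α * β * (β * v ^ 2 - α * u ^ 2)) * he2 +
          (β * v ^ 2 - α * u ^ 2) * hαβ
      linarith
    ·
      have h10 : 2 * (u' - v') = 13 * (u - v) + e * (α * u - β * v) := by linear_combination hu' - hv'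
      rcases Int.even_or_odd' (u' - v') with ⟨w, hw | hw⟩
      · exact ⟨w, hw⟩
      · exfalso
        have h11 : α * u' ^ 2 - β * v' ^ 2 = 4 * s := by
          have : 4 * (α * u' ^ 2 - β * v' ^ 2) = 4 * (4 * s) := by
            have e1 : 4 * u' ^ 2 = (13 * u - e * β * v) ^ 2 := by rw [← hu']; ring
            have e2 : 4 * v' ^ 2 = (13 * v - e * α * u) ^ 2 := by rw [← hv']; ring
            linear_combination α * e1 - β * e2 + 4 * h2 + (α * β * (β * v ^ 2 - α * u ^ 2)) * he2 +
              (β * v ^ 2 - α * u ^ 2) * hαβ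
          linarith
        have hu1 : u' = v' + 2 * w + 1 := by linarith
        have h12 : (α * u' ^ 2 - β * v' ^ 2) % 2 = 1 := by
          rw [hu1, ha, hb]
          have : (2 * a + 1) * (v' + 2 * w + 1) ^ 2 - (2 * b + 1) * v' ^ 2 =
            2 * (a * (v' + 2 * w + 1) ^ 2 + 2 * w ^ 2 + 2 * w * v' + 2 * w + v' - b * v' ^ 2) + 1 := by ring
          rw [this]; omega
        omega
    · have e1 : 8 * (α * u' ^ 3 + 3 * β * u' * v' ^ 2) =
          α * (13 * u - e * β * v) ^ 3 + 3 * β * (13 * u - e * β * v) * (13 * v - e * α * u) ^ 2 := by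
        rw [← hu', ← hv']; ring
      have e2 : α * (13 * u - e * β * v) ^ 3 + 3 * β * (13 * u - e * β * v) * (13 * v - e * α * u) ^ 2 =
          8 * (1079 * (α * u ^ 3 + 3 * β * u * v ^ 2) - 84 * e * β * (3 * α * u ^ 2 * v + β * v ^ 3)) := by
        rcases he with rfl | rfl <;> rcases hα with ⟨rfl, rfl⟩ | ⟨rfl, rfl⟩ <;> ring
      rw [e2, h4, h5] at e1
      have e3 : 8 * (1079 * (8 * (A * p + β * B * q)) - 84 * e * β * (8 * (A * q + α * B * p))) =
        8 * (8 * ((1079 * A - 84 * 165 * e * B) * p + β * (1079 * B - 84 * e * A) * q)) := by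
        linear_combination (-(8 * 8 * 84 * e * B * p)) * hαβ
      linarith
    · have e1 : 8 * (3 * α * u' ^ 2 * v' + β * v' ^ 3) =
          3 * α * (13 * u - e * β * v) ^ 2 * (13 * v - e * α * u) + β * (13 * v - e * α * u) ^ 3 := by
        rw [← hu', ← hv']; ring
      have e2 : 3 * α * (13 * u - e * β * v) ^ 2 * (13 * v - e * α * u) + β * (13 * v - e * α * u) ^ 3 =
          8 * (1079 * (3 * α * u ^ 2 * v + β * v ^ 3) - 84 * e * α * (α * u ^ 3 + 3 * β * u * v ^ 2)) := by
        rcases he with rfl | rfl <;> rcases hα with ⟨rfl, rfl⟩ | ⟨rfl, rfl⟩ <;> ring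
      rw [e2, h4, h5] at e1
      have e3 : 8 * (1079 * (8 * (A * q + α * B * p)) - 84 * e * α * (8 * (A * p + β * B * q))) =
        8 * (8 * ((1079 * A - 84 * 165 * e * B) * q + α * (1079 * B - 84 * e * A) * p)) := by
        linear_combination (-(8 * 8 * 84 * e * B * q)) * hαβ
      linarith

theorem dvd8_u (α β u v : ℤ) (hα : (α = 1 ∧ β = 165) ∨ (α = 3 ∧ β = 55)) (h : (2:ℤ) ∣ u - v) :
    (8:ℤ) ∣ α * u ^ 3 + 3 * β * u * v ^ 2 ∧ (8:ℤ) ∣ 3 * α * u ^ 2 * v + β * v ^ 3 := by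
  have k : ∀ u v : ZMod 8, 4 * (u - v) = 0 → (1 * u ^ 3 + 3 * 165 * u * v ^ 2 = 0 ∧
    3 * 1 * u ^ 2 * v + 165 * v ^ 3 = 0) ∧ (3 * u ^ 3 + 3 * 55 * u * v ^ 2 = 0 ∧
    3 * 3 * u ^ 2 * v + 55 * v ^ 3 = 0) := by decide
  obtain ⟨t, ht⟩ := h
  have h4 : (4:ZMod 8) * ((u : ZMod 8) - v) = 0 := by
    have : ((4 * (u - v) : ℤ) : ZMod 8) = 0 := (ZMod.intCast_zmod_eq_zero_iff_dvd _ 8).mpr ⟨t, by push_cast; linarith⟩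
    exact_mod_cast this
  have k' := k u v h4
  rcases hα with ⟨rfl, rfl⟩ | ⟨rfl, rfl⟩
  · exact ⟨(ZMod.intCast_zmod_eq_zero_iff_dvd _ 8).mp (by exact_mod_cast k'.1.1),
      (ZMod.intCast_zmod_eq_zero_iff_dvd _ 8).mp (by exact_mod_cast k'.1.2)⟩
  · exact ⟨(ZMod.intCast_zmod_eq_zero_iff_dvd _ 8).mp (by exact_mod_cast k'.2.1),
      (ZMod.intCast_zmod_eq_zero_iff_dvd _ 8).mp (by exact_mod_cast k'.2.2)⟩

theorem four165 (α β p q s u v A B : ℤ) (hα : (α = 1 ∧ β = 165) ∨ (α = 3 ∧ β = 55))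
    (hs : s % 2 = 1) (hps : α * p ^ 2 - β * q ^ 2 = s ^ 3) (hAB : A ^ 2 - 165 * B ^ 2 = 64)
    (h2 : α * u ^ 2 - β * v ^ 2 = 4 * s)
    (h4 : α * u ^ 3 + 3 * β * u * v ^ 2 = A * p + β * B * q)
    (h5 : 3 * α * u ^ 2 * v + β * v ^ 3 = A * q + α * B * p) :
    ∃ u v : ℤ, α * u ^ 2 - β * v ^ 2 = 4 * s ∧ (2:ℤ) ∣ u - v ∧
      α * u ^ 3 + 3 * β * u * v ^ 2 = 8 * p ∧ 3 * α * u ^ 2 * v + β * v ^ 3 = 8 * q := by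
  have huv : (2:ℤ) ∣ u - v := by
    have : (2:ℤ) ∣ (u - v) ^ 2 := by
      rcases hα with ⟨rfl, rfl⟩ | ⟨rfl, rfl⟩
      · exact ⟨2 * s + 83 * v ^ 2 - u * v, by linear_combination h2⟩
      · exact ⟨2 * s - u ^ 2 + 28 * v ^ 2 - u * v, by linear_combination h2⟩
    exact Int.prime_two.dvd_of_dvd_pow this
  obtain ⟨d1, d2⟩ := dvd8_u α β u v hα huv
  have hs8 : IsCoprime (8:ℤ) (s ^ 3) := by
    have : IsCoprime (2:ℤ) s := by
      rw [Int.prime_two.coprime_iff_not_dvd]; omega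
    have := this.pow (m := 3) (n := 3)
    norm_num at this; exact this
  have hB : (8:ℤ) ∣ B := by
    apply hs8.dvd_of_dvd_mul_left
    rw [h4] at d1
    rw [h5] at d2
    have : s ^ 3 * B = (A * q + α * B * p) * p - (A * p + β * B * q) * q := by
      rw [← hps]; ring
    rw [this]
    exact dvd_sub (d2.mul_right _) (d1.mul_right _)
  have hA : (8:ℤ) ∣ A := by
    apply hs8.dvd_of_dvd_mul_left
    rw [h4] at d1
    rw [h5] at d2
    have : s ^ 3 * A = (A * p + β * B * q) * (α * p) - (A * q + α * B * p) * (β * q) := by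
      rw [← hps]; ring
    rw [this]
    exact dvd_sub (d1.mul_right _) (d2.mul_right _)
  obtain ⟨A', rfl⟩ := hA
  obtain ⟨B', rfl⟩ := hB
  exact unit165 α β p q s hα _ u v A' B' le_rfl (by linarith) h2 huv (by linarith) (by linarith)

theorem cube165 (α β p q s : ℤ) (hα : (α = 1 ∧ β = 165) ∨ (α = 3 ∧ β = 55))
    (hs : s % 2 = 1) (hps : α * p ^ 2 - β * q ^ 2 = s ^ 3) (hqs : IsCoprime q s)
    (h11 : ¬ (11:ℤ) ∣ p) :
    ∃ u v : ℤ, α * u ^ 2 - β * v ^ 2 = 4 * s ∧ (2:ℤ) ∣ u - v ∧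
      α * u ^ 3 + 3 * β * u * v ^ 2 = 8 * p ∧ 3 * α * u ^ 2 * v + β * v ^ 3 = 8 * q := by
  have hαβ : α * β = 165 := by rcases hα with ⟨rfl, rfl⟩ | ⟨rfl, rfl⟩ <;> norm_num
  have hd : ∀ t : ℤ, t ^ 2 ≠ -(α * -β) := by
    intro t ht
    have ht : t ^ 2 = 165 := by linarith
    have := sq_bound (B := t) (k := 12) (by linarith) (by norm_num)
    obtain ⟨l1, l2⟩ := this
    nlinarith
  obtain ⟨u, v, n, A, B, e1, e2, e3, e4, b', c', g1, g2, g3⟩ :=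
    cube_extract α (-β) p q s hd (by rintro rfl; norm_num at hs) (by linarith) hqs
  have e2' : A ^ 2 - 165 * B ^ 2 = n ^ 3 := by linear_combination e2 + B ^ 2 * hαβ
  rcases n165 n A B b' c' e2' (by linarith) g2 g3 with rfl | rfl | rfl
  · exact four165 α β p q s (2 * u) (2 * v) (8 * A) (8 * B) hα hs hps (by linarith) (by linarith)
      (by linarith) (by linarith)
  · exact four165 α β p q s u v A B hα hs hps (by linarith) (by linarith)
      (by linarith) (by linarith)
  · have p11 : Prime (11:ℤ) := Nat.prime_iff_prime_int.mp (by norm_num)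
    have c11 : ∀ {w : ℤ}, (11:ℤ) ∣ w ^ 2 → (11:ℤ) ∣ w := fun h => p11.dvd_of_dvd_pow h
    have hu : (11:ℤ) ∣ u := by
      apply c11
      rcases hα with ⟨rfl, rfl⟩ | ⟨rfl, rfl⟩
      · exact ⟨15 * v ^ 2 - s, by linarith⟩
      · have : (11:ℤ) ∣ 3 * u ^ 2 := ⟨5 * v ^ 2 - s, by linarith⟩
        exact (p11.dvd_or_dvd this).resolve_left (by norm_num)
    obtain ⟨u1, rfl⟩ := hu
    have hA : (11:ℤ) ∣ A := c11 ⟨15 * B ^ 2 - 121, by linarith⟩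
    obtain ⟨A1, rfl⟩ := hA
    have hB : (11:ℤ) ∣ B := by
      rcases hα with ⟨rfl, rfl⟩ | ⟨rfl, rfl⟩
      · have : (11:ℤ) ∣ B * p := ⟨33 * u1 ^ 2 * v + 15 * v ^ 3 - A1 * q, by linarith⟩
        exact (p11.dvd_or_dvd this).resolve_right h11
      · have : (11:ℤ) ∣ 3 * (B * p) := ⟨99 * u1 ^ 2 * v + 5 * v ^ 3 - A1 * q, by linarith⟩
        have := (p11.dvd_or_dvd this).resolve_left (by norm_num)
        exact (p11.dvd_or_dvd this).resolve_right h11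
    obtain ⟨B1, rfl⟩ := hB
    have hA : (11:ℤ) ∣ A1 := c11 ⟨15 * B1 ^ 2 - 1, by linarith⟩
    obtain ⟨A2, rfl⟩ := hA
    have hn : 11 * A2 ^ 2 - 15 * B1 ^ 2 = -1 := by linarith
    rcases hα with ⟨rfl, rfl⟩ | ⟨rfl, rfl⟩
    · refine four165 1 165 p q s (11 * u1 + 15 * v) (u1 + v) (8 * (77 * A2 + 90 * B1)) (8 * (6 * A2 + 7 * B1))
        (Or.inl ⟨rfl, rfl⟩) hs hps ?_ ?_ ?_ ?_
      · linear_combination (-64) * hn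
      · linarith
      · linarith
      · linarith
    · refine four165 3 55 p q s (11 * u1 + 5 * v) (3 * u1 + v) (8 * (77 * A2 + 90 * B1)) (8 * (6 * A2 + 7 * B1))
        (Or.inr ⟨rfl, rfl⟩) hs hps ?_ ?_ ?_ ?_
      · linear_combination (-64) * hn
      · linarith
      · linarith
      · linarith
end

section

theorem cop_congr {a b b' : ℤ} (h : IsCoprime a b) (k : ℤ) (e : b' = b + a * k) : IsCoprime a b' := by
  rw [e]; exact h.add_mul_left_right k

theorem cube165' (α β p q s : ℤ) (hα : (α = 1 ∧ β = 165) ∨ (α = 3 ∧ β = 55))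
    (hs : s % 2 = 1) (hps : α * p ^ 2 - β * q ^ 2 = s ^ 3) (hqs : IsCoprime q s)
    (h11 : ¬ (11:ℤ) ∣ p) (hpq : IsCoprime p q) :
    ∃ c u v : ℤ, (c = 1 ∨ c = 2) ∧ α * u ^ 2 - β * v ^ 2 = c ^ 2 * s ∧ IsCoprime v u ∧
      α * u ^ 3 + 3 * β * u * v ^ 2 = c ^ 3 * p ∧ 3 * α * u ^ 2 * v + β * v ^ 3 = c ^ 3 * q := by
  obtain ⟨u, v, h1, ⟨t, ht⟩, h2, h3⟩ := cube165 α β p q s hα hs hps hqs h11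
  have hc : ∃ c u v : ℤ, ((c = 1 ∨ c = 2) ∧ α * u ^ 2 - β * v ^ 2 = c ^ 2 * s ∧
      α * u ^ 3 + 3 * β * u * v ^ 2 = c ^ 3 * p ∧ 3 * α * u ^ 2 * v + β * v ^ 3 = c ^ 3 * q) ∧
      (∀ l : ℤ, Prime l → l ∣ u → l ∣ v → ¬ l ∣ c) := by
    rcases Int.even_or_odd' u with ⟨u', hu | hu⟩
    · have hv : v = 2 * (u' - t) := by linarith
      refine ⟨1, u', u' - t, ⟨Or.inl rfl, ?_, ?_, ?_⟩, ?_⟩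
      · rw [hu, hv] at h1; linarith
      · rw [hu, hv] at h2; linarith
      · rw [hu, hv] at h3; linarith
      · intro l hl _ _ h; exact hl.not_isUnit (isUnit_of_dvd_one h)
    · refine ⟨2, u, v, ⟨Or.inr rfl, by linarith, by linarith, by linarith⟩, ?_⟩
      intro l hl h _ h'
      have : l ∣ 1 := by
        have := dvd_sub h (h'.mul_right u')
        rw [hu] at this; simpa using this
      exact hl.not_isUnit (isUnit_of_dvd_one this)
  obtain ⟨c, u, v, ⟨hc, e1, e2, e3⟩, e4⟩ := hc
  refine ⟨c, u, v, hc, e1, ?_, e2, e3⟩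
  apply isCoprime_of_prime_dvd
  · rintro ⟨rfl, rfl⟩
    have hc0 : c ^ 2 * s = 0 := by linarith
    have : s ≠ 0 := by rintro rfl; norm_num at hs
    have : c ≠ 0 := by rcases hc with rfl | rfl <;> norm_num
    simp_all
  · intro l hl hv hu
    have hlc := e4 l hl hu hv
    have hlc3 : ¬ l ∣ c ^ 3 := fun h => hlc (hl.dvd_of_dvd_pow h)
    have hp : l ∣ p := by
      have : l ∣ c ^ 3 * p := by
        rw [← e2, show α * u ^ 3 + 3 * β * u * v ^ 2 = u * (α * u ^ 2 + 3 * β * v ^ 2) by ring]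
        exact hu.mul_right _
      exact (hl.dvd_or_dvd this).resolve_left hlc3
    have hq : l ∣ q := by
      have : l ∣ c ^ 3 * q := by
        rw [← e3, show 3 * α * u ^ 2 * v + β * v ^ 3 = v * (3 * α * u ^ 2 + β * v ^ 2) by ring]
        exact hv.mul_right _
      exact (hl.dvd_or_dvd this).resolve_left hlc3
    exact not_both hl.not_isUnit hpq hp hq

theorem cop_w {w : ℤ} (i j : ℕ) (hw : w = 5 ^ i * 11 ^ j) {N : ℤ} (h5 : ¬ (5:ℤ) ∣ N) (h11 : ¬ (11:ℤ) ∣ N) :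
    IsCoprime w N := by
  have p5 : Prime (5:ℤ) := Nat.prime_iff_prime_int.mp (by norm_num)
  have p11 : Prime (11:ℤ) := Nat.prime_iff_prime_int.mp (by norm_num)
  rw [hw]
  exact IsCoprime.mul_left (p5.coprime_iff_not_dvd.mpr h5).pow_left
    (p11.coprime_iff_not_dvd.mpr h11).pow_left

/-- The conclusion of the 3-division. -/
def Div3 (w z N : ℤ) : Prop := ∃ l g m κ : ℤ, m ^ 2 + 55 * w ^ 2 * g ^ 6 = l ^ 3 ∧ IsCoprime l g ∧
  ¬ (5:ℤ) ∣ l ∧ ¬ (11:ℤ) ∣ l ∧ g ≠ 0 ∧ 0 < κ ∧ κ ≤ 5184 ∧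
  9 * l ^ 2 * g ^ 2 * (l ^ 3 - 4 * (55 * w ^ 2) * g ^ 6) ^ 2 = κ * z ^ 2 ∧
  l ^ 9 + 96 * (55 * w ^ 2) * l ^ 6 * g ^ 6 + 48 * (55 * w ^ 2) ^ 2 * l ^ 3 * g ^ 12
    - 64 * (55 * w ^ 2) ^ 3 * g ^ 18 = κ * N

theorem core3 {w : ℤ} (i j : ℕ) (hw : w = 5 ^ i * 11 ^ j) (U v r s c k p q z N : ℤ)
    (hc : c = 1 ∨ c = 2) (hk : k = 1 ∨ k = 3) (hr : r ≠ 0) (hvU : IsCoprime v U) (h5 : ¬ (5:ℤ) ∣ U)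
    (h11 : ¬ (11:ℤ) ∣ U) (e1 : v * (U ^ 2 + 55 * v ^ 2) = w * (c * r) ^ 3)
    (e2 : U ^ 2 - 165 * v ^ 2 = k * c ^ 2 * s) (e3 : U * (U ^ 2 + 495 * v ^ 2) = k ^ 2 * c ^ 3 * p)
    (e4 : p ^ 2 + 55 * q ^ 2 = N) (e5 : k ^ 2 * q = 9 * w * r ^ 3) (e6 : k * z = 3 * r * s) :
    Div3 w z N := by
  have p5 : Prime (5:ℤ) := Nat.prime_iff_prime_int.mp (by norm_num)
  have p11 : Prime (11:ℤ) := Nat.prime_iff_prime_int.mp (by norm_num)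
  have hL5 : ¬ (5:ℤ) ∣ U ^ 2 + 55 * v ^ 2 := by
    intro h
    have : (5:ℤ) ∣ U ^ 2 := by
      have := dvd_sub h (⟨11 * v ^ 2, by ring⟩ : (5:ℤ) ∣ 55 * v ^ 2); simpa using this
    exact h5 (p5.dvd_of_dvd_pow this)
  have hL11 : ¬ (11:ℤ) ∣ U ^ 2 + 55 * v ^ 2 := by
    intro h
    have : (11:ℤ) ∣ U ^ 2 := by
      have := dvd_sub h (⟨5 * v ^ 2, by ring⟩ : (11:ℤ) ∣ 55 * v ^ 2); simpa using this
    exact h11 (p11.dvd_of_dvd_pow this)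
  have hwL := cop_w i j hw hL5 hL11
  have hw0 : w ≠ 0 := by rw [hw]; positivity
  obtain ⟨v', hv'⟩ : w ∣ v := hwL.dvd_of_dvd_mul_right ⟨_, e1⟩
  have e1' : v' * (U ^ 2 + 55 * v ^ 2) = (c * r) ^ 3 := by
    apply mul_left_cancel₀ hw0
    rw [← e1, hv']; ring
  have hvL : IsCoprime v' (U ^ 2 + 55 * v ^ 2) := by
    have h1 : IsCoprime v' (U ^ 2) := by
      have : IsCoprime v' U := hvU.of_isCoprime_of_dvd_left ⟨w, by rw [hv']; ring⟩
      exact this.pow_right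
    exact cop_congr h1 (55 * v * w) (by rw [hv']; ring)
  obtain ⟨⟨g, hg⟩, ⟨l, hl⟩⟩ := Int.eq_pow_of_mul_eq_pow_odd hvL (by decide : Odd 3) e1'
  have hgl : g * l = c * r := by
    have : (g * l) ^ 3 = (c * r) ^ 3 := by rw [mul_pow, ← hg, ← hl, e1']
    exact (Odd.strictMono_pow (by decide : Odd 3)).injective this
  have hc0 : c ≠ 0 := by rcases hc with rfl | rfl <;> norm_num
  have hk0 : k ≠ 0 := by rcases hk with rfl | rfl <;> norm_num
  have hvg : v = w * g ^ 3 := by rw [hv', hg]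
  have hv2 : v ^ 2 = w ^ 2 * g ^ 6 := by rw [hvg]; ring
  refine ⟨l, g, U, k ^ 4 * c ^ 6, ?_, ?_, ?_, ?_, ?_, by positivity, ?_, ?_, ?_⟩
  · rw [← hl, hv2]; ring
  · have := hvL
    rw [hg, hl] at this
    exact ((IsCoprime.pow_iff (by norm_num) (by norm_num)).mp this).symm
  · intro h; apply hL5; rw [hl]; exact dvd_pow h (by norm_num)
  · intro h; apply hL11; rw [hl]; exact dvd_pow h (by norm_num)
  · rintro rfl
    have : c * r = 0 := by linarith
    rcases mul_eq_zero.mp this with h | h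
    · exact hc0 h
    · exact hr h
  · rcases hc with rfl | rfl <;> rcases hk with rfl | rfl <;> norm_num
  · have h1 : l ^ 3 - 4 * (55 * w ^ 2) * g ^ 6 = k * c ^ 2 * s := by
      rw [← hl, ← e2, hv2]; ring
    rw [h1, show 9 * l ^ 2 * g ^ 2 * (k * c ^ 2 * s) ^ 2 = 9 * (g * l) ^ 2 * (k * c ^ 2 * s) ^ 2 by ring, hgl]
    linear_combination (-(c ^ 6 * k ^ 2 * (k * z + 3 * r * s))) * e6
  · have h1 : l ^ 9 + 96 * (55 * w ^ 2) * l ^ 6 * g ^ 6 + 48 * (55 * w ^ 2) ^ 2 * l ^ 3 * g ^ 12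
      - 64 * (55 * w ^ 2) ^ 3 * g ^ 18 = (l ^ 3) ^ 3 + 96 * (55 * v ^ 2) * (l ^ 3) ^ 2 +
        48 * (55 * v ^ 2) ^ 2 * l ^ 3 - 64 * (55 * v ^ 2) ^ 3 := by
      rw [hv2]; ring
    rw [h1, ← hl, ← e4]
    have h2 : 9 * (v * (U ^ 2 + 55 * v ^ 2)) = k ^ 2 * c ^ 3 * q := by
      rw [e1]; linear_combination (-c ^ 3) * e5
    have h3 : k ^ 4 * c ^ 6 * (p ^ 2 + 55 * q ^ 2) = (k ^ 2 * c ^ 3 * p) ^ 2 + 55 * (k ^ 2 * c ^ 3 * q) ^ 2 := by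
      ring
    rw [h3, ← e3, ← h2]
    ring

theorem div3 {w : ℤ} (i j : ℕ) (hw : w = 5 ^ i * 11 ^ j) (M z N : ℤ) (hN : 0 < N) (hz : z ≠ 0)
    (h : M ^ 2 + 55 * (w * z ^ 3) ^ 2 = N ^ 3) (hodd : N % 2 = 1) (hc : IsCoprime z N)
    (h5 : ¬ (5:ℤ) ∣ N) (h11 : ¬ (11:ℤ) ∣ N) : Div3 w z N := by
  have p5 : Prime (5:ℤ) := Nat.prime_iff_prime_int.mp (by norm_num)
  have p11 : Prime (11:ℤ) := Nat.prime_iff_prime_int.mp (by norm_num)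
  have p3 : Prime (3:ℤ) := Int.prime_three
  have hw0 : w ≠ 0 := by rw [hw]; positivity
  have hcN : IsCoprime (w * z ^ 3) N := IsCoprime.mul_left (cop_w i j hw h5 h11) hc.pow_left
  rcases cube55 M (w * z ^ 3) N hN h hcN with ⟨p, q, e1, e2, e3⟩ | ⟨p, q, e, he, e1, e2, e3⟩
  swap
  · exfalso
    have := second_even p q e M (w * z ^ 3) N he h e1 e3
    omega
  have hp5 : ¬ (5:ℤ) ∣ p := by
    rintro ⟨t, rfl⟩; exact h5 ⟨5 * t ^ 2 + 11 * q ^ 2, by linarith⟩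
  have hp11 : ¬ (11:ℤ) ∣ p := by
    rintro ⟨t, rfl⟩; exact h11 ⟨11 * t ^ 2 + 5 * q ^ 2, by linarith⟩
  have hqN : IsCoprime q N := hcN.of_isCoprime_of_dvd_left ⟨3 * p ^ 2 - 55 * q ^ 2, by linarith⟩
  have hpq : IsCoprime p q := by
    have h1 : IsCoprime q (p ^ 2) := by
      exact cop_congr hqN (-(55 * q)) (by linarith)
    exact ((IsCoprime.pow_right_iff (by norm_num)).mp h1).symm
  have hpqw := cop_w i j hw hp5 hp11
  have hwF : IsCoprime w (3 * p ^ 2 - 55 * q ^ 2) := by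
    apply cop_w i j hw
    · intro hd
      have : (5:ℤ) ∣ 3 * p ^ 2 := by
        have := dvd_add hd (⟨11 * q ^ 2, by ring⟩ : (5:ℤ) ∣ 55 * q ^ 2); simpa using this
      exact hp5 (p5.dvd_of_dvd_pow ((p5.dvd_or_dvd this).resolve_left (by norm_num)))
    · intro hd
      have : (11:ℤ) ∣ 3 * p ^ 2 := by
        have := dvd_add hd (⟨5 * q ^ 2, by ring⟩ : (11:ℤ) ∣ 55 * q ^ 2); simpa using this
      exact hp11 (p11.dvd_of_dvd_pow ((p11.dvd_or_dvd this).resolve_left (by norm_num)))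
  obtain ⟨q', rfl⟩ : w ∣ q := hwF.dvd_of_dvd_mul_right ⟨z ^ 3, by linarith⟩
  have e2' : q' * (3 * p ^ 2 - 55 * (w * q') ^ 2) = z ^ 3 := by
    apply mul_left_cancel₀ hw0; linear_combination e2
  have hparity : (p - w * q') % 2 = 1 := by
    rcases Int.even_or_odd' (p - w * q') with ⟨t, ht | ht⟩
    · exfalso
      have hp : p = w * q' + 2 * t := by linarith
      rw [hp] at e3
      have : N = 2 * (28 * (w * q') ^ 2 + 2 * t * (w * q') + 2 * t ^ 2) := by linear_combination -e3
      omega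
    · omega
  have hpar2 : ∀ a b : ℤ, (p - w * q') % 2 = 1 → a % 2 = 1 → b % 2 = 1 →
      (a * p ^ 2 - b * (w * q') ^ 2) % 2 = 1 := by
    intro a b h0 ha hb
    have hp : p % 2 = 0 ∧ (w * q') % 2 = 1 ∨ p % 2 = 1 ∧ (w * q') % 2 = 0 := by omega
    rcases hp with ⟨h1, h2⟩ | ⟨h1, h2⟩ <;>
      simp [Int.sub_emod, Int.mul_emod a, Int.mul_emod b, pow_two, Int.mul_emod p, Int.mul_emod (w * q') (w * q'), h1, h2, ha, hb]
  by_cases h3 : (3:ℤ) ∣ q'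
  ·
    have hp3 : ¬ (3:ℤ) ∣ p := fun hp => not_both nu3 hpq hp (h3.mul_left w)
    obtain ⟨t, rfl⟩ := h3
    have hz3 : (3:ℤ) ∣ z := by
      apply p3.dvd_of_dvd_pow (n := 3)
      exact ⟨_, by rw [← e2', mul_assoc]⟩
    obtain ⟨z', rfl⟩ := hz3
    have e4 : t * (p ^ 2 - 165 * (w * t) ^ 2) = 3 * z' ^ 3 := by
      have : 9 * (t * (p ^ 2 - 165 * (w * t) ^ 2)) = 9 * (3 * z' ^ 3) := by linear_combination e2'
      linarith
    have hFp : ¬ (3:ℤ) ∣ p ^ 2 - 165 * (w * t) ^ 2 := by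
      intro hd
      have : (3:ℤ) ∣ p ^ 2 := by
        have := dvd_add hd (⟨55 * (w * t) ^ 2, by ring⟩ : (3:ℤ) ∣ 165 * (w * t) ^ 2); simpa using this
      exact hp3 (p3.dvd_of_dvd_pow this)
    obtain ⟨t', rfl⟩ : (3:ℤ) ∣ t := (p3.dvd_or_dvd ⟨_, e4⟩).resolve_right hFp
    have e5 : t' * (p ^ 2 - 165 * (w * (3 * t')) ^ 2) = z' ^ 3 := by
      have : 3 * (t' * (p ^ 2 - 165 * (w * (3 * t')) ^ 2)) = 3 * z' ^ 3 := by linear_combination e4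
      linarith
    have hpt : IsCoprime t' p := (hpq.symm).of_isCoprime_of_dvd_left ⟨9 * w, by ring⟩
    have hcop : IsCoprime t' (p ^ 2 - 165 * (w * (3 * t')) ^ 2) := by
      exact cop_congr (hpt.pow_right (n := 2)) (-(165 * 9 * w ^ 2 * t')) (by ring)
    obtain ⟨⟨r, hr⟩, ⟨s, hs⟩⟩ := Int.eq_pow_of_mul_eq_pow_odd hcop (by decide : Odd 3) e5
    have hrs : r * s = z' := by
      have : (r * s) ^ 3 = z' ^ 3 := by rw [mul_pow, ← hr, ← hs, e5]
      exact (Odd.strictMono_pow (by decide : Odd 3)).injective this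
    have hsodd : s % 2 = 1 := by
      have h1 : (1 * p ^ 2 - 165 * (w * (3 * t')) ^ 2) % 2 = 1 := by
        have := hpar2 1 165 hparity (by norm_num) (by norm_num)
        have e : 1 * p ^ 2 - 165 * (w * (3 * t')) ^ 2 = (1 * p ^ 2 - 165 * (w * (3 * (3 * t'))) ^ 2) +
          2 * (660 * (w * (3 * t')) ^ 2) := by ring
        rw [e]; omega
      rw [one_mul, hs] at h1
      by_contra h2
      have : (2:ℤ) ∣ s := by omega
      have : (2:ℤ) ∣ s ^ 3 := dvd_pow this (by norm_num)
      omega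
    have hms : IsCoprime (w * (3 * t')) s := by
      have h1 : IsCoprime (w * (3 * t')) (p ^ 2 - 165 * (w * (3 * t')) ^ 2) := by
        have h0 : IsCoprime (w * (3 * t')) p := (hpq.symm).of_isCoprime_of_dvd_left ⟨3, by ring⟩
        exact cop_congr (h0.pow_right (n := 2)) (-(165 * (w * (3 * t')))) (by ring)
      rw [hs] at h1
      exact (IsCoprime.pow_right_iff (by norm_num)).mp h1
    have hpm : IsCoprime p (w * (3 * t')) := hpq.of_isCoprime_of_dvd_right ⟨3, by ring⟩
    obtain ⟨c, u, v, hc, f1, f2, f3, f4⟩ := cube165' 1 165 p (w * (3 * t')) s (Or.inl ⟨rfl, rfl⟩) hsodd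
      (by linarith) hms hp11 hpm
    have hc5 : ¬ (5:ℤ) ∣ c ^ 3 := by rcases hc with rfl | rfl <;> norm_num
    have hc11 : ¬ (11:ℤ) ∣ c ^ 3 := by rcases hc with rfl | rfl <;> norm_num
    refine core3 i j hw u v r s c 1 p (9 * w * r ^ 3) (3 * z') N hc (Or.inl rfl) ?_ f2 ?_ ?_ ?_ ?_ ?_ ?_ ?_ ?_
    · rintro rfl; apply hz; rw [← hrs]; ring
    · intro hd
      have : (5:ℤ) ∣ c ^ 3 * p := by
        rw [← f3, show 1 * u ^ 3 + 3 * 165 * u * v ^ 2 = u * (u ^ 2 + 495 * v ^ 2) by ring]; exact hd.mul_right _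
      exact ((p5.dvd_or_dvd this).elim hc5 hp5)
    · intro hd
      have : (11:ℤ) ∣ c ^ 3 * p := by
        rw [← f3, show 1 * u ^ 3 + 3 * 165 * u * v ^ 2 = u * (u ^ 2 + 495 * v ^ 2) by ring]; exact hd.mul_right _
      exact ((p11.dvd_or_dvd this).elim hc11 hp11)
    · rw [hr] at f4; linarith
    · linarith
    · linarith
    · rw [← e3, hr]; ring
    · ring
    · rw [← hrs]; ring
  ·
    have hpq' : IsCoprime q' p := (hpq.symm).of_isCoprime_of_dvd_left ⟨w, by ring⟩
    have h3q : IsCoprime q' 3 := (p3.coprime_iff_not_dvd.mpr h3).symm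
    have hcop : IsCoprime q' (3 * p ^ 2 - 55 * (w * q') ^ 2) := by
      exact cop_congr (h3q.mul_right (hpq'.pow_right (n := 2))) (-(55 * w ^ 2 * q')) (by ring)
    obtain ⟨⟨r, hr⟩, ⟨s, hs⟩⟩ := Int.eq_pow_of_mul_eq_pow_odd hcop (by decide : Odd 3) e2'
    have hrs : r * s = z := by
      have : (r * s) ^ 3 = z ^ 3 := by rw [mul_pow, ← hr, ← hs, e2']
      exact (Odd.strictMono_pow (by decide : Odd 3)).injective this
    have hsodd : s % 2 = 1 := by
      have h1 := hpar2 3 55 hparity (by norm_num) (by norm_num)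
      rw [hs] at h1
      by_contra h2
      have : (2:ℤ) ∣ s := by omega
      have : (2:ℤ) ∣ s ^ 3 := dvd_pow this (by norm_num)
      omega
    have h3w : ¬ (3:ℤ) ∣ w := by
      rw [hw]; intro hd
      rcases p3.dvd_or_dvd hd with hd | hd
      · exact absurd (p3.dvd_of_dvd_pow hd) (by norm_num)
      · exact absurd (p3.dvd_of_dvd_pow hd) (by norm_num)
    have h3wq : ¬ (3:ℤ) ∣ w * q' := fun hd => (p3.dvd_or_dvd hd).elim h3w h3
    have hms : IsCoprime (w * q') s := by
      have h1 : IsCoprime (w * q') (3 * p ^ 2 - 55 * (w * q') ^ 2) := by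
        have h0 : IsCoprime (w * q') 3 := (p3.coprime_iff_not_dvd.mpr h3wq).symm
        exact cop_congr (h0.mul_right (hpq.symm.pow_right (n := 2))) (-(55 * (w * q'))) (by ring)
      rw [hs] at h1
      exact (IsCoprime.pow_right_iff (by norm_num)).mp h1
    obtain ⟨c, u, v, hc, f1, f2, f3, f4⟩ := cube165' 3 55 p (w * q') s (Or.inr ⟨rfl, rfl⟩) hsodd
      (by linarith) hms hp11 hpq
    have hc5 : ¬ (5:ℤ) ∣ c ^ 3 := by rcases hc with rfl | rfl <;> norm_num
    have hc11 : ¬ (11:ℤ) ∣ c ^ 3 := by rcases hc with rfl | rfl <;> norm_num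
    have hc3 : ¬ (3:ℤ) ∣ c ^ 3 := by rcases hc with rfl | rfl <;> norm_num
    have h3v : ¬ (3:ℤ) ∣ v := by
      intro hd
      have : (3:ℤ) ∣ c ^ 3 * (w * q') := by
        rw [← f4, show 3 * 3 * u ^ 2 * v + 55 * v ^ 3 = v * (9 * u ^ 2 + 55 * v ^ 2) by ring]; exact hd.mul_right _
      exact ((p3.dvd_or_dvd this).elim hc3 h3wq)
    have hv3 : IsCoprime v 3 := (p3.coprime_iff_not_dvd.mpr h3v).symm
    refine core3 i j hw (3 * u) v r s c 3 p (w * r ^ 3) z N hc (Or.inr rfl) ?_ (hv3.mul_right f2) ?_ ?_ ?_ ?_ ?_ ?_ ?_ ?_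
    · rintro rfl; apply hz; rw [← hrs]; ring
    · intro hd
      have hd := (p5.dvd_or_dvd hd).resolve_left (by norm_num)
      have : (5:ℤ) ∣ c ^ 3 * p := by
        rw [← f3, show 3 * u ^ 3 + 3 * 55 * u * v ^ 2 = u * (3 * u ^ 2 + 165 * v ^ 2) by ring]; exact hd.mul_right _
      exact ((p5.dvd_or_dvd this).elim hc5 hp5)
    · intro hd
      have hd := (p11.dvd_or_dvd hd).resolve_left (by norm_num)
      have : (11:ℤ) ∣ c ^ 3 * p := by
        rw [← f3, show 3 * u ^ 3 + 3 * 55 * u * v ^ 2 = u * (3 * u ^ 2 + 165 * v ^ 2) by ring]; exact hd.mul_right _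
      exact ((p11.dvd_or_dvd this).elim hc11 hp11)
    · rw [hr] at f4; linarith
    · linarith
    · linarith
    · rw [← e3, hr]
    · ring
    · rw [← hrs]; ring
end

section
open WeierstrassCurve.Affine

/-- The Mordell curve Y² = X³ - D. -/
def Ec (D : ℤ) : WeierstrassCurve.Affine ℚ := ⟨0, 0, 0, 0, -(D : ℚ)⟩

/-- rational points -/
abbrev Pt (D : ℤ) := (Ec D).Point

variable {D : ℤ}

theorem ns_eq {x y : ℚ} (h : (Ec D).Nonsingular x y) : y ^ 2 = x ^ 3 - D := by
  have := (equation_iff _ _).mp h.1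
  simp [Ec] at this
  linarith

theorem mk_ns (hD : D ≠ 0) {x y : ℚ} (h : y ^ 2 = x ^ 3 - D) : (Ec D).Nonsingular x y := by
  rw [nonsingular_iff, equation_iff]
  have hD' : (D:ℚ) ≠ 0 := by exact_mod_cast hD
  simp only [Ec]
  refine ⟨by linarith, ?_⟩
  by_contra hc
  push Not at hc
  obtain ⟨h1, h2⟩ := hc
  have hy : y = 0 := by linarith
  have hx : x = 0 := by
    have : x ^ 2 = 0 := by linarith
    simpa using this
  rw [hx, hy] at h
  apply hD'; linarith

def nx : Pt D → ℚ
  | .zero => 1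
  | .some x _ _ => x
def hx : Pt D → ℚ
  | .zero => 0
  | .some _ _ _ => 1
def kap : Pt D → ℤ
  | .zero => 1
  | .some x _ _ => x.den
/-- numerator of X -/
def Nn : Pt D → ℤ
  | .zero => 1
  | .some x _ _ => x.num
/-- denominator of X -/
def Hh : Pt D → ℤ
  | .zero => 0
  | .some x _ _ => x.den

theorem Nn_eq (P : Pt D) : (Nn P : ℚ) = kap P * nx P := by
  cases P with
  | zero => simp [Nn, kap, nx]
  | some x y h => simp [Nn, kap, nx, Rat.den_mul_eq_num]
theorem Hh_eq (P : Pt D) : (Hh P : ℚ) = kap P * hx P := by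
  cases P with
  | zero => simp [Hh, kap, hx]
  | some x y h => simp [Hh, kap, hx]
theorem kap_pos (P : Pt D) : 0 < kap P := by
  cases P with
  | zero => simp [kap]
  | some x y h => simp [kap, x.den_pos]
theorem cop (P : Pt D) : IsCoprime (Nn P) (Hh P) := by
  cases P with
  | zero => simp [Nn, Hh, isCoprime_one_left]
  | some x y h => simp only [Nn, Hh]; exact (Int.isCoprime_iff_gcd_eq_one.mpr x.reduced)
theorem Hh_nonneg (P : Pt D) : 0 ≤ Hh P := by
  cases P with
  | zero => simp [Hh]
  | some x y h => simp [Hh]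
theorem Hh_eq_zero (P : Pt D) : Hh P = 0 ↔ P = 0 := by
  cases P with
  | zero => simp [Hh]; rfl
  | some x y h => simp [Hh]

@[simp] theorem Nn_neg (P : Pt D) : Nn (-P) = Nn P := by
  cases P <;> rfl
@[simp] theorem Hh_neg (P : Pt D) : Hh (-P) = Hh P := by
  cases P <;> rfl
@[simp] theorem nx_neg (P : Pt D) : nx (-P) = nx P := by
  cases P <;> rfl
@[simp] theorem hx_neg (P : Pt D) : hx (-P) = hx P := by
  cases P <;> rfl
@[simp] theorem nx_zero : nx (0 : Pt D) = 1 := rfl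
@[simp] theorem hx_zero : hx (0 : Pt D) = 0 := rfl
@[simp] theorem Nn_zero : Nn (0 : Pt D) = 1 := rfl
@[simp] theorem Hh_zero : Hh (0 : Pt D) = 0 := rfl

/-- the three forms -/
def fa {R} [CommRing R] (n1 h1 n2 h2 : R) : R := (n1 * h2 - n2 * h1) ^ 2
def fb {R} [CommRing R] (D n1 h1 n2 h2 : R) : R :=
  2 * (n1 * n2 * (n1 * h2 + n2 * h1) - 2 * D * h1 ^ 2 * h2 ^ 2)
def fc {R} [CommRing R] (D n1 h1 n2 h2 : R) : R :=
  n1 ^ 2 * n2 ^ 2 + 4 * D * h1 * h2 * (n1 * h2 + n2 * h1)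

theorem dbl_x {x y : ℚ} (h : (Ec D).Nonsingular x y) (hy : y ≠ 0) :
    nx (WeierstrassCurve.Affine.Point.some x y h + .some x y h) = (3 * x ^ 2 / (2 * y)) ^ 2 - 2 * x ∧
    hx (WeierstrassCurve.Affine.Point.some x y h + .some x y h) = 1 := by
  have hne : y ≠ (Ec D).negY x y := by
    simp [negY, Ec]; intro h; apply hy; linarith
  rw [Point.add_self_of_Y_ne hne]
  simp only [nx, hx, addX, slope_of_Y_ne rfl hne]
  simp [Ec, negY]
  ring

theorem F_rat (hc : ∀ x : ℚ, x ^ 3 ≠ D) (P Q : Pt D) : ∃ g : ℚ, g ≠ 0 ∧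
    fa (nx P) (hx P) (nx Q) (hx Q) = g * (hx (P + Q) * hx (P - Q)) ∧
    fb (D:ℚ) (nx P) (hx P) (nx Q) (hx Q) = g * (nx (P + Q) * hx (P - Q) + nx (P - Q) * hx (P + Q)) ∧
    fc (D:ℚ) (nx P) (hx P) (nx Q) (hx Q) = g * (nx (P + Q) * nx (P - Q)) := by
  cases P with
  | zero =>
    rw [Point.zero_def.symm]
    refine ⟨1, one_ne_zero, ?_, ?_, ?_⟩ <;> simp [fa, fb, fc] <;> ring
  | some x1 y1 h1 =>
  cases Q with
  | zero =>
    rw [Point.zero_def.symm]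
    refine ⟨1, one_ne_zero, ?_, ?_, ?_⟩ <;> simp [fa, fb, fc] <;> ring
  | some x2 y2 h2 =>
  have e1 := ns_eq h1
  have e2 := ns_eq h2
  by_cases hx12 : x1 = x2
  · subst hx12
    have hy0 : y1 ≠ 0 := by
      rintro rfl
      apply hc x1; linarith
    have hyy : y2 = y1 ∨ y2 = -y1 := by
      have : (y2 - y1) * (y2 + y1) = 0 := by linear_combination e2 - e1
      rcases mul_eq_zero.mp this with h | h
      · left; linarith
      · right; linarith
    have key := dbl_x h1 hy0
    refine ⟨4 * y1 ^ 2, by positivity, ?_⟩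
    rcases hyy with rfl | rfl
    · rw [sub_self]
      obtain ⟨k1, k2⟩ := key
      rw [k1, k2]
      simp only [nx, hx, fa, fb, fc, nx_zero, hx_zero]
      refine ⟨by ring, by linear_combination -4 * e1, ?_⟩
      field_simp
      linear_combination (32 * x1) * e1
    · have hn : Point.some x1 (-y1) h2 = - Point.some x1 y1 h1 := by
        rw [Point.neg_some]; congr 1; simp [negY, Ec]
      rw [hn, sub_neg_eq_add, add_neg_cancel]
      obtain ⟨k1, k2⟩ := key
      rw [k1, k2]
      simp only [nx_neg, hx_neg]
      simp only [nx, hx, fa, fb, fc, nx_zero, hx_zero]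
      refine ⟨by ring, by linear_combination -4 * e1, ?_⟩
      field_simp
      linear_combination (32 * x1) * e1
  · have hs : x1 - x2 ≠ 0 := sub_ne_zero.mpr hx12
    refine ⟨(x1 - x2) ^ 2, by positivity, ?_⟩
    rw [sub_eq_add_neg (Point.some x1 y1 h1), Point.neg_some, Point.add_of_X_ne hx12, Point.add_of_X_ne hx12]
    simp only [nx, hx, fa, fb, fc, addX, slope_of_X_ne hx12]
    simp only [Ec, negY]
    refine ⟨by ring, ?_, ?_⟩
    · field_simp
      linear_combination (-2) * e1 - 2 * e2
    · field_simp
      have e3 : y1 ^ 4 = (x1 ^ 3 - D) ^ 2 := by rw [← e1]; ring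
      have e4 : y2 ^ 4 = (x2 ^ 3 - D) ^ 2 := by rw [← e2]; ring
      have e5 : y1 ^ 2 * y2 ^ 2 = (x1 ^ 3 - D) * (x2 ^ 3 - D) := by rw [← e1, ← e2]
      linear_combination -(e3 + e4 - 2 * e5) + 2 * (x1 + x2) * (x1 - x2) ^ 2 * (e1 + e2)

theorem prim_triple (n1 h1 n2 h2 : ℤ) (c1 : IsCoprime n1 h1) (c2 : IsCoprime n2 h2) :
    ∃ u v w : ℤ, u * (h1 * h2) + v * (n1 * h2 + n2 * h1) + w * (n1 * n2) = 1 := by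
  obtain ⟨t, s, e⟩ := c1
  obtain ⟨t', s', e'⟩ := c2
  have hA : ∃ u v w : ℤ, u * (h1 * h2) + v * (n1 * h2 + n2 * h1) + w * (n1 * n2) =
      (1 - t * s' * (n1 * h2) - s * t' * (n2 * h1)) :=
    ⟨s * s', 0, t * t', by linear_combination (s' * h2 + t' * n2) * e + e'⟩
  obtain ⟨u, v, w, h⟩ := hA
  set m := t * s' * (n1 * h2) + s * t' * (n2 * h1) with hm
  have hB : ∃ u v w : ℤ, u * (h1 * h2) + v * (n1 * h2 + n2 * h1) + w * (n1 * n2) = m ^ 2 := by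
    refine ⟨2 * (t * s') * (s * t') * (n1 * n2) - (t * s') ^ 2 * (n1 * n2) - (s * t') ^ 2 * (n1 * n2),
      (t * s') ^ 2 * (n1 * h2) + (s * t') ^ 2 * (n2 * h1), 0, ?_⟩
    rw [hm]; ring
  obtain ⟨u', v', w', h'⟩ := hB
  refine ⟨(1 + m) * u + u', (1 + m) * v + v', (1 + m) * w + w', ?_⟩
  have : u * (h1 * h2) + v * (n1 * h2 + n2 * h1) + w * (n1 * n2) = 1 - m := by rw [h, hm]; ring
  linear_combination (1 + m) * this + h'

theorem Nn_pos (hD : 0 < D) (P : Pt D) : 0 < Nn P := by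
  cases P with
  | zero => simp [Nn]
  | some x y h =>
    have e := ns_eq h
    have hD' : (0:ℚ) < D := by exact_mod_cast hD
    simp only [Nn]
    rw [Rat.num_pos]
    have : 0 < x ^ 3 := by nlinarith [sq_nonneg y]
    by_contra hx
    push Not at hx
    nlinarith [sq_nonneg x]

theorem F_int (hD : 0 < D) (hc : ∀ x : ℚ, x ^ 3 ≠ D) (P Q : Pt D) : ∃ g : ℤ, 0 < g ∧
    fa (Nn P) (Hh P) (Nn Q) (Hh Q) = g * (Hh (P + Q) * Hh (P - Q)) ∧
    fb D (Nn P) (Hh P) (Nn Q) (Hh Q) = g * (Nn (P + Q) * Hh (P - Q) + Nn (P - Q) * Hh (P + Q)) ∧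
    fc D (Nn P) (Hh P) (Nn Q) (Hh Q) = g * (Nn (P + Q) * Nn (P - Q)) := by
  obtain ⟨g, hg, h1, h2, h3⟩ := F_rat hc P Q
  have kp : (kap (P + Q) : ℚ) ≠ 0 := by exact_mod_cast (kap_pos (P + Q)).ne'
  have km : (kap (P - Q) : ℚ) ≠ 0 := by exact_mod_cast (kap_pos (P - Q)).ne'
  set G : ℚ := g * kap P ^ 2 * kap Q ^ 2 / (kap (P + Q) * kap (P - Q)) with hG
  have hGe : G * (kap (P + Q) * kap (P - Q)) = g * kap P ^ 2 * kap Q ^ 2 := by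
    rw [hG]; field_simp
  have q1 : ((fa (Nn P) (Hh P) (Nn Q) (Hh Q) : ℤ) : ℚ) = G * ((Hh (P + Q) * Hh (P - Q) : ℤ) : ℚ) := by
    simp only [fa] at h1 ⊢
    push_cast
    simp only [Nn_eq, Hh_eq]
    linear_combination (kap P : ℚ) ^ 2 * (kap Q) ^ 2 * h1 - hx (P + Q) * hx (P - Q) * hGe
  have q2 : ((fb D (Nn P) (Hh P) (Nn Q) (Hh Q) : ℤ) : ℚ) =
      G * ((Nn (P + Q) * Hh (P - Q) + Nn (P - Q) * Hh (P + Q) : ℤ) : ℚ) := by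
    simp only [fb] at h2 ⊢
    push_cast
    simp only [Nn_eq, Hh_eq]
    linear_combination (kap P : ℚ) ^ 2 * (kap Q) ^ 2 * h2 -
      (nx (P + Q) * hx (P - Q) + nx (P - Q) * hx (P + Q)) * hGe
  have q3 : ((fc D (Nn P) (Hh P) (Nn Q) (Hh Q) : ℤ) : ℚ) =
      G * ((Nn (P + Q) * Nn (P - Q) : ℤ) : ℚ) := by
    simp only [fc] at h3 ⊢
    push_cast
    simp only [Nn_eq, Hh_eq]
    linear_combination (kap P : ℚ) ^ 2 * (kap Q) ^ 2 * h3 - nx (P + Q) * nx (P - Q) * hGe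
  obtain ⟨u, v, w, e⟩ := prim_triple _ _ _ _ (cop (P + Q)) (cop (P - Q))
  have hGi : G = ((u * fa (Nn P) (Hh P) (Nn Q) (Hh Q) + v * fb D (Nn P) (Hh P) (Nn Q) (Hh Q)
      + w * fc D (Nn P) (Hh P) (Nn Q) (Hh Q) : ℤ) : ℚ) := by
    have e' : ((u * (Hh (P + Q) * Hh (P - Q)) + v * (Nn (P + Q) * Hh (P - Q) + Nn (P - Q) * Hh (P + Q)) +
      w * (Nn (P + Q) * Nn (P - Q)) : ℤ) : ℚ) = 1 := by rw [e]; simp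
    rw [Int.cast_add, Int.cast_add, Int.cast_mul, Int.cast_mul, Int.cast_mul, q1, q2, q3]
    push_cast at e' ⊢
    linear_combination -G * e'
  rw [hGi] at q1 q2 q3
  set g' := (u * fa (Nn P) (Hh P) (Nn Q) (Hh Q) + v * fb D (Nn P) (Hh P) (Nn Q) (Hh Q)
      + w * fc D (Nn P) (Hh P) (Nn Q) (Hh Q) : ℤ) with hg'
  have q3' : fc D (Nn P) (Hh P) (Nn Q) (Hh Q) = g' * (Nn (P + Q) * Nn (P - Q)) := by exact_mod_cast q3
  refine ⟨g', ?_, by exact_mod_cast q1, by exact_mod_cast q2, q3'⟩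
  have hN := Nn_pos hD (P + Q)
  have hN' := Nn_pos hD (P - Q)
  have hp := Nn_pos hD P
  have hq := Nn_pos hD Q
  have hhp := Hh_nonneg P
  have hhq := Hh_nonneg Q
  have : 0 < fc D (Nn P) (Hh P) (Nn Q) (Hh Q) := by simp only [fc]; positivity
  rw [q3'] at this
  exact pos_of_mul_pos_left this (by positivity)
end

section
open WeierstrassCurve.Affine

/-- standing hypotheses on D -/
class GD (D : ℤ) : Prop where
  form : ∃ i j : ℕ, D = 55 * (5 ^ i * 11 ^ j) ^ 2
  nc : ∀ x : ℚ, x ^ 3 ≠ D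

theorem GD.pos {D : ℤ} [h : GD D] : 0 < D := by
  obtain ⟨i, j, h⟩ := h.form
  rw [h]; positivity
theorem GD.five {D : ℤ} [h : GD D] : (5:ℤ) ∣ D := by
  obtain ⟨i, j, h⟩ := h.form
  rw [h]; exact ⟨11 * (5 ^ i * 11 ^ j) ^ 2, by ring⟩
theorem GD.eleven {D : ℤ} [h : GD D] : (11:ℤ) ∣ D := by
  obtain ⟨i, j, h⟩ := h.form
  rw [h]; exact ⟨5 * (5 ^ i * 11 ^ j) ^ 2, by ring⟩
theorem GD.pdvd {D : ℤ} [h : GD D] {p : ℤ} (hp : Prime p) (hd : p ∣ D) : p ∣ 5 ∨ p ∣ 11 := by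
  obtain ⟨i, j, h⟩ := h.form
  rw [h] at hd
  rcases hp.dvd_or_dvd hd with h | h
  · exact hp.dvd_or_dvd (by simpa using h : p ∣ 5 * 11)
  · rcases hp.dvd_or_dvd (hp.dvd_of_dvd_pow h) with h | h
    · exact Or.inl (hp.dvd_of_dvd_pow h)
    · exact Or.inr (hp.dvd_of_dvd_pow h)

set_option linter.unusedSectionVars false

variable {D : ℤ} [hGD : GD D]

theorem FF (P Q : Pt D) : ∃ g : ℤ, 0 < g ∧
    fa (Nn P) (Hh P) (Nn Q) (Hh Q) = g * (Hh (P + Q) * Hh (P - Q)) ∧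
    fb D (Nn P) (Hh P) (Nn Q) (Hh Q) = g * (Nn (P + Q) * Hh (P - Q) + Nn (P - Q) * Hh (P + Q)) ∧
    fc D (Nn P) (Hh P) (Nn Q) (Hh Q) = g * (Nn (P + Q) * Nn (P - Q)) :=
  F_int GD.pos GD.nc P Q

/-- nonsingular reduction at p -/
def Ns (p : ℤ) (Q : Pt D) : Prop :=
  ¬ (p ∣ fb D (Nn Q) (Hh Q) (Nn Q) (Hh Q) ∧ p ∣ fc D (Nn Q) (Hh Q) (Nn Q) (Hh Q))

theorem cop_not {p : ℤ} (hp : Prime p) (P : Pt D) (h : p ∣ Hh P) : ¬ p ∣ Nn P := fun h' =>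
  hp.not_isUnit ((cop P).isUnit_of_dvd' h' h)

theorem g_unit {p : ℤ} (hp : Prime p) (P Q : Pt D) (hQ : Ns p Q)
    (ha : p ∣ fa (Nn P) (Hh P) (Nn Q) (Hh Q)) (hb : p ∣ fb D (Nn P) (Hh P) (Nn Q) (Hh Q))
    (hc : p ∣ fc D (Nn P) (Hh P) (Nn Q) (Hh Q)) : False := by
  have c1 := cop_not hp P
  have c2 := cop_not hp Q
  unfold Ns at hQ
  generalize Nn P = n1 at *
  generalize Hh P = h1 at *
  generalize Nn Q = n2 at *
  generalize Hh Q = h2 at *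
  simp only [fa, fb, fc] at *
  have ha' := hp.dvd_of_dvd_pow ha
  have aux : ∀ {a : ℤ}, ¬ p ∣ a → ∀ {b}, p ∣ a * b → p ∣ b := fun ha b hb =>
    (hp.dvd_or_dvd hb).resolve_left ha
  have k1 : ¬ p ∣ h2 := by
    intro h
    have n2' := c2 h
    have : p ∣ n2 * h1 := by
      have := dvd_sub (h.mul_left n1) ha'
      simpa using this
    have h1' := aux n2' this
    have n1' := c1 h1'
    have : p ∣ n1 ^ 2 * n2 ^ 2 := by
      have e : n1 ^ 2 * n2 ^ 2 = (n1 ^ 2 * n2 ^ 2 + 4 * D * h1 * h2 * (n1 * h2 + n2 * h1)) -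
        (4 * D * h1 * (n1 * h2 + n2 * h1)) * h2 := by ring
      rw [e]
      exact dvd_sub hc (h.mul_left _)
    rcases hp.dvd_or_dvd this with h | h
    · exact n1' (hp.dvd_of_dvd_pow h)
    · exact n2' (hp.dvd_of_dvd_pow h)
  have k2 : ¬ p ∣ h1 := by
    intro h
    have n1' := c1 h
    have : p ∣ n1 * h2 := by
      have := dvd_add (h.mul_left n2) ha'
      simpa using this
    exact k1 (aux n1' this)
  have k : ¬ p ∣ h1 ^ 2 := fun h => k2 (hp.dvd_of_dvd_pow h)
  obtain ⟨t, ht⟩ := ha'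
  obtain ⟨b', hb'⟩ := hb
  obtain ⟨c', hc'⟩ := hc
  have ht' : n1 * h2 = n2 * h1 + p * t := by linarith
  apply hQ
  constructor
  · apply aux k
    refine ⟨h2 ^ 2 * b' - 2 * n2 * h2 * t * (n1 * h2 + 2 * (n2 * h1)), ?_⟩
    linear_combination h2 ^ 2 * hb' - 2 * n2 * h2 * (n1 * h2 + 2 * (n2 * h1)) * ht
  · apply aux k
    refine ⟨h2 ^ 2 * c' - t * ((n1 * h2 + n2 * h1) * n2 ^ 2 + 4 * D * h1 * h2 ^ 3), ?_⟩
    linear_combination h2 ^ 2 * hc' - ((n1 * h2 + n2 * h1) * n2 ^ 2 + 4 * D * h1 * h2 ^ 3) * ht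
end

section
set_option linter.unusedSectionVars false
variable {D : ℤ} [hGD : GD D]

theorem pcancel {p : ℤ} (hp : Prime p) {a b : ℤ} (e : ℕ) (ha : ¬ p ∣ a) (h : p ^ e ∣ a * b) : p ^ e ∣ b :=
  ((hp.coprime_iff_not_dvd.mpr ha).pow_left).dvd_of_dvd_mul_left h

theorem FFp {p : ℤ} (hp : Prime p) (P Q : Pt D) (hQ : Ns p Q) : ∃ g : ℤ, 0 < g ∧ ¬ p ∣ g ∧
    fa (Nn P) (Hh P) (Nn Q) (Hh Q) = g * (Hh (P + Q) * Hh (P - Q)) ∧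
    fb D (Nn P) (Hh P) (Nn Q) (Hh Q) = g * (Nn (P + Q) * Hh (P - Q) + Nn (P - Q) * Hh (P + Q)) ∧
    fc D (Nn P) (Hh P) (Nn Q) (Hh Q) = g * (Nn (P + Q) * Nn (P - Q)) := by
  obtain ⟨g, h0, h1, h2, h3⟩ := FF P Q
  refine ⟨g, h0, fun h => ?_, h1, h2, h3⟩
  exact g_unit hp P Q hQ (h1 ▸ h.mul_right _) (h2 ▸ h.mul_right _) (h3 ▸ h.mul_right _)

theorem Ns_of_H {p : ℤ} (hp : Prime p) (Q : Pt D) (h : p ∣ Hh Q) : Ns p Q := by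
  rintro ⟨-, h2⟩
  have hn := cop_not hp Q h
  apply hn
  apply hp.dvd_of_dvd_pow (n := 4)
  have e : Nn Q ^ 4 = fc D (Nn Q) (Hh Q) (Nn Q) (Hh Q) - (8 * D * Nn Q * Hh Q ^ 2) * Hh Q := by
    simp only [fc]; ring
  rw [e]; exact dvd_sub h2 (h.mul_left _)

theorem Ns_of_D {p : ℤ} (hp : Prime p) (hD : p ∣ 8 * D) (Q : Pt D) (h : ¬ p ∣ Nn Q) : Ns p Q := by
  rintro ⟨-, h2⟩
  apply h
  apply hp.dvd_of_dvd_pow (n := 4)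
  have e : Nn Q ^ 4 = fc D (Nn Q) (Hh Q) (Nn Q) (Hh Q) - (8 * D) * (Nn Q * Hh Q ^ 3) := by
    simp only [fc]; ring
  rw [e]; exact dvd_sub h2 (hD.mul_right _)

theorem Ns_of_not {p : ℤ} (hp : Prime p) (h6 : ¬ p ∣ 2 * 3) (hD : ¬ p ∣ D) (Q : Pt D) : Ns p Q := by
  have h2 : ¬ p ∣ 2 := fun h => h6 (h.mul_right 3)
  have h3 : ¬ p ∣ 3 := fun h => h6 (h.mul_left 2)
  by_cases h : p ∣ Hh Q
  · exact Ns_of_H hp Q h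
  rintro ⟨e1, e2⟩
  have e1' : p ∣ (2 ^ 2 * Hh Q) * (Nn Q ^ 3 - D * Hh Q ^ 3) := by
    have : fb D (Nn Q) (Hh Q) (Nn Q) (Hh Q) = (2 ^ 2 * Hh Q) * (Nn Q ^ 3 - D * Hh Q ^ 3) := by
      simp only [fb]; ring
    rwa [this] at e1
  have k1 : p ∣ Nn Q ^ 3 - D * Hh Q ^ 3 := by
    rcases hp.dvd_or_dvd e1' with h' | h'
    · rcases hp.dvd_or_dvd h' with h' | h'
      · exact absurd (hp.dvd_of_dvd_pow h') h2
      · exact absurd h' h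
    · exact h'
  have hN : ¬ p ∣ Nn Q := by
    intro hn
    have : p ∣ D * Hh Q ^ 3 := by
      have := dvd_sub (dvd_pow hn (by norm_num : 3 ≠ 0)) k1
      simpa using this
    exact (hp.dvd_or_dvd this).elim hD (fun h' => h (hp.dvd_of_dvd_pow h'))
  have k2 : p ∣ 3 ^ 2 * (D * Nn Q * Hh Q ^ 3) := by
    have : 3 ^ 2 * (D * Nn Q * Hh Q ^ 3) = fc D (Nn Q) (Hh Q) (Nn Q) (Hh Q) - (Nn Q ^ 3 - D * Hh Q ^ 3) * Nn Q := by
      simp only [fc]; ring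
    rw [this]; exact dvd_sub e2 (k1.mul_right _)
  rcases hp.dvd_or_dvd k2 with h' | h'
  · exact h3 (hp.dvd_of_dvd_pow h')
  rcases hp.dvd_or_dvd h' with h' | h'
  · exact (hp.dvd_or_dvd h').elim hD hN
  · exact h (hp.dvd_of_dvd_pow h')

def Good (Q : Pt D) : Prop := ∀ p : ℤ, Prime p → Ns p Q

theorem Kg (P Q : Pt D) (hQ : Good Q) : Hh (P + Q) * Hh (P - Q) = (Nn P * Hh Q - Nn Q * Hh P) ^ 2 := by
  obtain ⟨g, h0, h1, h2, h3⟩ := FF P Q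
  have hg : IsUnit g := by
    by_contra hu
    obtain ⟨p, hp, h⟩ := WfDvdMonoid.exists_irreducible_factor hu h0.ne'
    have hp := hp.prime
    exact g_unit hp P Q (hQ p hp) (h1 ▸ h.mul_right _) (h2 ▸ h.mul_right _) (h3 ▸ h.mul_right _)
  have : g = 1 := by
    rcases Int.isUnit_iff.mp hg with h | h
    · exact h
    · omega
  rw [this, one_mul] at h1
  rw [← h1]; rfl


theorem E1_add {p : ℤ} (hp : Prime p) (P Q : Pt D) (hP : p ∣ Hh P)
    (hQ : p ∣ Hh Q) : p ∣ Hh (P + Q) := by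
  obtain ⟨g, h0, hg, e1, e2, e3⟩ := FFp hp P Q (Ns_of_H hp Q hQ)
  have s1 : p ∣ Hh (P + Q) * Hh (P - Q) := by
    apply (hp.dvd_or_dvd (a := g) ?_).resolve_left hg
    rw [← e1]
    simp only [fa]
    exact dvd_pow (dvd_sub (hQ.mul_left _) (hP.mul_left _)) (by norm_num)
  have s2 : p ∣ Nn (P + Q) * Hh (P - Q) + Nn (P - Q) * Hh (P + Q) := by
    apply (hp.dvd_or_dvd (a := g) ?_).resolve_left hg
    rw [← e2]
    simp only [fb]
    apply Dvd.dvd.mul_left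
    apply dvd_sub
    · exact (dvd_add (hQ.mul_left _) (hP.mul_left _)).mul_left _
    · exact (dvd_pow hQ (by norm_num)).mul_left _
  rcases hp.dvd_or_dvd s1 with h | h
  · exact h
  · have : p ∣ Nn (P - Q) * Hh (P + Q) := (dvd_add_right (h.mul_left _)).mp s2
    exact (hp.dvd_or_dvd this).resolve_left (cop_not hp _ h)

theorem E1_nsmul {p : ℤ} (hp : Prime p) (P : Pt D) (hP : p ∣ Hh P) (n : ℕ) : p ∣ Hh (n • P) := by
  induction n with
  | zero => simp
  | succ n ih => rw [succ_nsmul]; exact E1_add hp _ _ ih hP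

theorem rep (P : Pt D) (hP : P ≠ 0) : ∃ z M : ℤ, 0 < z ∧ Hh P = z ^ 2 ∧ M ^ 2 = Nn P ^ 3 - D * z ^ 6 ∧
    IsCoprime (Nn P) z := by
  have cc := cop P
  cases P with
  | zero => exact absurd rfl hP
  | some x y h =>
    have e := ns_eq h
    simp only [Nn, Hh] at cc ⊢
    have hn : IsCoprime (x.num ^ 3 - D * (x.den:ℤ) ^ 3) ((x.den:ℤ) ^ 3) := by
      have := cc.pow (m := 3) (n := 3)
      have h2 := this.add_mul_right_left (-D)
      have e3 : x.num ^ 3 - D * (x.den:ℤ) ^ 3 = x.num ^ 3 + -D * (x.den:ℤ) ^ 3 := by ring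
      rw [e3]; exact h2
    have hm : IsCoprime (y.num ^ 2) ((y.den:ℤ) ^ 2) :=
      (Int.isCoprime_iff_gcd_eq_one.mpr y.reduced : IsCoprime y.num (y.den:ℤ)).pow
    have hxd : (x.den : ℚ) ≠ 0 := by exact_mod_cast x.den_ne_zero
    have hyd : (y.den : ℚ) ≠ 0 := by exact_mod_cast y.den_ne_zero
    have key : y.num ^ 2 * (x.den:ℤ) ^ 3 = (x.num ^ 3 - D * (x.den:ℤ) ^ 3) * (y.den:ℤ) ^ 2 := by
      have e1 : (y.num : ℚ) = y * y.den := (Rat.mul_den_eq_num y).symm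
      have e2 : (x.num : ℚ) = x * x.den := (Rat.mul_den_eq_num x).symm
      have : (y.num : ℚ) ^ 2 * (x.den:ℚ) ^ 3 = ((x.num:ℚ) ^ 3 - D * (x.den:ℚ) ^ 3) * (y.den:ℚ) ^ 2 := by
        rw [e1, e2]; linear_combination (y.den:ℚ) ^ 2 * (x.den:ℚ) ^ 3 * e
      exact_mod_cast this
    have d1 : (x.den:ℤ) ^ 3 ∣ (y.den:ℤ) ^ 2 := hn.symm.dvd_of_dvd_mul_left (Dvd.intro_left _ key)
    have d2 : (y.den:ℤ) ^ 2 ∣ (x.den:ℤ) ^ 3 := hm.symm.dvd_of_dvd_mul_left (Dvd.intro_left _ key.symm)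
    have d3 : (x.den:ℤ) ^ 3 = (y.den:ℤ) ^ 2 := Int.dvd_antisymm (by positivity) (by positivity) d1 d2
    have d4 : (x.den:ℤ) ∣ y.den := by
      rw [← Int.pow_dvd_pow_iff (n := 2) (by norm_num), ← d3]
      exact pow_dvd_pow _ (by norm_num)
    obtain ⟨k, hk⟩ := d4
    have hxp : (0:ℤ) < x.den := by exact_mod_cast x.den_pos
    have hyp : (0:ℤ) < y.den := by exact_mod_cast y.den_pos
    have hkp : 0 < k := by
      rw [hk] at hyp; exact pos_of_mul_pos_right hyp hxp.le
    have hd : (x.den:ℤ) = k ^ 2 := by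
      have : (x.den:ℤ) ^ 2 * (x.den:ℤ) = (x.den:ℤ) ^ 2 * k ^ 2 := by rw [hk] at d3; linear_combination d3
      exact mul_left_cancel₀ (by positivity) this
    refine ⟨k, y.num, hkp, hd, ?_, ?_⟩
    · rw [← d3] at key
      have h3 : (x.den:ℤ) ^ 3 ≠ 0 := by positivity
      have := mul_right_cancel₀ h3 key
      rw [this, hd]; ring
    · rw [hd] at cc
      exact (IsCoprime.pow_right_iff (by norm_num)).mp cc

theorem eq_or_neg (P Q : Pt D) (h1 : Nn P = Nn Q) (h2 : Hh P = Hh Q) : P = Q ∨ P = -Q := by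
  by_cases hP : P = 0
  · have : Hh Q = 0 := by rw [← h2, hP]; rfl
    rw [Hh_eq_zero] at this
    left; rw [hP, this]
  by_cases hQ : Q = 0
  · exact absurd ((Hh_eq_zero P).mp (by rw [h2, hQ]; rfl)) hP
  cases P with
  | zero => exact absurd rfl hP
  | some x y h =>
  cases Q with
  | zero => exact absurd rfl hQ
  | some x' y' h' =>
    simp only [Nn, Hh] at h1 h2
    have hx : x = x' := Rat.ext h1 (by exact_mod_cast h2)
    subst hx
    have e := ns_eq h
    have e' := ns_eq h'
    have : (y - y') * (y + y') = 0 := by linear_combination e - e'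
    rcases mul_eq_zero.mp this with h | h
    · left; congr 1; linarith
    · right; rw [WeierstrassCurve.Affine.Point.neg_some]; congr 1
      simp [WeierstrassCurve.Affine.negY, Ec]; linarith

theorem dbl (P : Pt D) : ∃ g : ℤ, 0 < g ∧ (∀ p : ℤ, Ns p P → ¬ p ∣ g) ∧
    4 * Hh P * (Nn P ^ 3 - D * Hh P ^ 3) = g * Hh (P + P) ∧
    Nn P ^ 4 + 8 * D * Nn P * Hh P ^ 3 = g * Nn (P + P) := by
  obtain ⟨g, h0, h1, h2, h3⟩ := FF P P
  refine ⟨g, h0, ?_, ?_, ?_⟩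
  · intro p hN hg
    exact hN ⟨h2 ▸ hg.mul_right _, h3 ▸ hg.mul_right _⟩
  · simp [fb] at h2; linear_combination h2
  · simp [fc] at h3; linear_combination h3

theorem triple (P : Pt D) (hP : P ≠ 0) : ∃ G : ℤ, 0 < G ∧ (∀ p : ℤ, Prime p → Ns p P → ¬ p ∣ G) ∧
    G * Hh (P + P + P) = 9 * Nn P ^ 2 * Hh P * (Nn P ^ 3 - 4 * D * Hh P ^ 3) ^ 2 ∧
    G * Nn (P + P + P) = Nn P ^ 9 + 96 * D * Nn P ^ 6 * Hh P ^ 3 + 48 * D ^ 2 * Nn P ^ 3 * Hh P ^ 6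
      - 64 * D ^ 3 * Hh P ^ 9 := by
  obtain ⟨k, k0, kp, k1, k2⟩ := dbl P
  obtain ⟨g, g0, a1, a2, a3⟩ := FF (P + P) P
  have hg : ∀ p : ℤ, Prime p → Ns p P → ¬ p ∣ g := by
    intro p hp hN h
    exact g_unit hp _ P hN (a1 ▸ h.mul_right _) (a2 ▸ h.mul_right _) (a3 ▸ h.mul_right _)
  rw [add_sub_cancel_right] at a1 a2 a3
  have hH : Hh P ≠ 0 := fun h => hP ((Hh_eq_zero P).mp h)
  have b1 : g * k ^ 2 * Hh (P + P + P) = 9 * Nn P ^ 2 * Hh P * (Nn P ^ 3 - 4 * D * Hh P ^ 3) ^ 2 := by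
    apply mul_right_cancel₀ hH
    simp only [fa] at a1
    have : k * (Nn (P + P) * Hh P - Nn P * Hh (P + P)) = -3 * Nn P * Hh P * (Nn P ^ 3 - 4 * D * Hh P ^ 3) := by
      linear_combination Nn P * k1 - Hh P * k2
    calc _ = (k * (Nn (P + P) * Hh P - Nn P * Hh (P + P))) ^ 2 := by linear_combination -k ^ 2 * a1
      _ = _ := by rw [this]; ring
  refine ⟨g * k ^ 2, by positivity, ?_, b1, ?_⟩
  · intro p hp hN h
    rcases hp.dvd_or_dvd h with h | h
    · exact hg p hp hN h
    · exact kp p hN (hp.dvd_of_dvd_pow h)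
  · apply mul_right_cancel₀ hH
    have c : g * k ^ 2 * (Nn (P + P + P) * Hh P + Nn P * Hh (P + P + P)) =
       fb D (k * Nn (P + P)) (k * Hh (P + P)) (Nn P) (Hh P) := by
      simp only [fb] at a2 ⊢
      linear_combination -k ^ 2 * a2
    rw [← k1, ← k2] at c
    simp only [fb] at c
    linear_combination c - Nn P * b1
end

section
set_option linter.unusedSectionVars false
variable {D : ℤ} [hGD : GD D]

theorem p3 : Prime (3:ℤ) := by norm_num
theorem p2 : Prime (2:ℤ) := by norm_num
theorem p5 : Prime (5:ℤ) := by norm_num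
theorem p11 : Prime (11:ℤ) := by norm_num

variable (D) in
theorem D_three : ¬ (3:ℤ) ∣ D := fun h => by
  rcases GD.pdvd p3 h with h | h <;> omega
variable (D) in
theorem D_two : ¬ (2:ℤ) ∣ D := fun h => by
  rcases GD.pdvd p2 h with h | h <;> omega

theorem fc_not {p : ℤ} (hp : Prime p) (hD : p ∣ 4 * D) (P Q : Pt D) (h1 : ¬ p ∣ Nn P) (h2 : ¬ p ∣ Nn Q) :
    ¬ p ∣ Nn (P + Q) := by
  intro h
  obtain ⟨g, h0, e1, e2, e3⟩ := FF P Q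
  have : p ∣ fc D (Nn P) (Hh P) (Nn Q) (Hh Q) := by
    rw [e3]; exact (h.mul_right _).mul_left _
  simp only [fc] at this
  have h4 : p ∣ Nn P ^ 2 * Nn Q ^ 2 := by
    have h5 : p ∣ 4 * D * Hh P * Hh Q * (Nn P * Hh Q + Nn Q * Hh P) :=
      ((hD.mul_right _).mul_right _).mul_right _
    exact (dvd_add_left h5).mp this
  rcases hp.dvd_or_dvd h4 with h | h
  · exact h1 (hp.dvd_of_dvd_pow h)
  · exact h2 (hp.dvd_of_dvd_pow h)

variable (D) in
/-- points with nonsingular reduction at 5 and 11 -/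
def Gam : AddSubgroup (Pt D) where
  carrier := {P | ¬ (5:ℤ) ∣ Nn P ∧ ¬ (11:ℤ) ∣ Nn P}
  zero_mem' := by simp
  neg_mem' := by intro P hP; simpa using hP
  add_mem' := by
    rintro P Q ⟨h1, h2⟩ ⟨h3, h4⟩
    exact ⟨fc_not p5 (GD.five.mul_left _) P Q h1 h3, fc_not p11 (GD.eleven.mul_left _) P Q h2 h4⟩

theorem mem_Gam {P : Pt D} : P ∈ Gam D ↔ ¬ (5:ℤ) ∣ Nn P ∧ ¬ (11:ℤ) ∣ Nn P := Iff.rfl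

/-- odd points -/
def Od (P : Pt D) : Prop := ¬ (2:ℤ) ∣ Nn P

theorem Od_add {P Q : Pt D} (h1 : Od P) (h2 : Od Q) : Od (P + Q) :=
  fc_not p2 (Dvd.intro (2 * D) (by ring)) P Q h1 h2
theorem Od_neg {P : Pt D} : Od (-P) ↔ Od P := by simp [Od]
theorem Od_sub {P Q : Pt D} (h1 : Od P) (h2 : Od Q) : Od (P - Q) := by
  rw [sub_eq_add_neg]; exact Od_add h1 (Od_neg.mpr h2)
theorem Od_zero : Od (0 : Pt D) := by simp [Od]

theorem even_even {P Q : Pt D} (h1 : ¬ Od P) (h2 : ¬ Od Q) : (Od (P + Q) ∧ ¬ Od (P - Q)) ∨ (¬ Od (P + Q) ∧ Od (P - Q)) := by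
  obtain ⟨g, h0, e1, e2, e3⟩ := FF P Q
  have hhp : ¬ (2:ℤ) ∣ Hh P := fun h => cop_not p2 P h (not_not.mp h1)
  have hhq : ¬ (2:ℤ) ∣ Hh Q := fun h => cop_not p2 Q h (not_not.mp h2)
  obtain ⟨n1, hn1⟩ := not_not.mp h1
  obtain ⟨n2, hn2⟩ := not_not.mp h2
  have f1 : (2:ℤ) ^ 2 ∣ g * (Hh (P + Q) * Hh (P - Q)) := by
    rw [← e1]; simp only [fa]; rw [hn1, hn2]
    exact ⟨(n1 * Hh Q - n2 * Hh P) ^ 2, by ring⟩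
  have f2 : ¬ (2:ℤ) ^ 3 ∣ g * (Nn (P + Q) * Hh (P - Q) + Nn (P - Q) * Hh (P + Q)) := by
    rw [← e2]; simp only [fb]; rw [hn1, hn2]
    rintro ⟨k, hk⟩
    have : (2:ℤ) ∣ D * Hh P ^ 2 * Hh Q ^ 2 :=
      ⟨-k + 2 * n1 * n2 * (n1 * Hh Q + n2 * Hh P), by linarith⟩
    rcases p2.dvd_or_dvd this with h | h
    · rcases p2.dvd_or_dvd h with h | h
      · exact D_two D h
      · exact hhp (p2.dvd_of_dvd_pow h)
    · exact hhq (p2.dvd_of_dvd_pow h)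
  have f3 : (2:ℤ) ^ 3 ∣ g * (Nn (P + Q) * Nn (P - Q)) := by
    rw [← e3]; simp only [fc]; rw [hn1, hn2]
    exact ⟨2 * n1 ^ 2 * n2 ^ 2 + D * Hh P * Hh Q * (n1 * Hh Q + n2 * Hh P), by ring⟩
  by_cases k1 : Od (P + Q) <;> by_cases k2 : Od (P - Q)
  · exfalso
    have : ¬ (2:ℤ) ∣ Nn (P + Q) * Nn (P - Q) := fun h => (p2.dvd_or_dvd h).elim k1 k2
    rw [mul_comm] at f3
    exact f2 ((pcancel p2 3 this f3).mul_right _)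
  · exact Or.inl ⟨k1, k2⟩
  · exact Or.inr ⟨k1, k2⟩
  · exfalso
    have d1 := not_not.mp k1
    have d2 := not_not.mp k2
    have c1 : ¬ (2:ℤ) ∣ Hh (P + Q) := fun h => cop_not p2 _ h d1
    have c2 : ¬ (2:ℤ) ∣ Hh (P - Q) := fun h => cop_not p2 _ h d2
    have : ¬ (2:ℤ) ∣ Hh (P + Q) * Hh (P - Q) := fun h => (p2.dvd_or_dvd h).elim c1 c2
    rw [mul_comm] at f1
    have := pcancel p2 2 this f1
    apply f2
    rw [pow_succ]
    exact mul_dvd_mul this (dvd_add (d1.mul_right _) (d2.mul_right _))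

theorem even_odd {P Q : Pt D} (h1 : ¬ Od P) (h2 : Od Q) : ¬ Od (P + Q) := fun h => h1 (by
  have := Od_sub h h2
  simpa using this)

theorem Od_two_or (R : Pt D) (h : ¬ Od R) : ¬ Od (R + R) := by
  rcases even_even h h with ⟨-, h⟩ | ⟨h, -⟩
  · rw [sub_self] at h; exact absurd Od_zero h
  · exact h

theorem Od_three (R : Pt D) : Od (R + R + R) := by
  by_cases h : Od R
  · exact Od_add (Od_add h h) h
  · have h2 := Od_two_or R h
    rcases even_even h2 h with ⟨h, -⟩ | ⟨-, h⟩
    · exact h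
    · rw [add_sub_cancel_right] at h; contradiction

/-- nonsingular at three -/
def N3 (P : Pt D) : Prop := ¬ (3:ℤ) ∣ Nn P - D * Hh P

theorem N3_zero : N3 (0 : Pt D) := by simp [N3]
theorem N3_neg {P : Pt D} : N3 (-P) ↔ N3 P := by simp [N3]
theorem n3_aux : ∀ d a b n m : ZMod 3, d ≠ 0 →
    fa a b n m * d ^ 2 - fb d a b n m * d + fc d a b n m = (a - d * b) ^ 2 * (n - d * m) ^ 2 := by
  simp only [fa, fb, fc]; decide

theorem zm {n : ℕ} {a : ℤ} : ((n:ℤ) ∣ a) ↔ (a : ZMod n) = 0 := (ZMod.intCast_zmod_eq_zero_iff_dvd a n).symm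

theorem N3_add {P Q : Pt D} (h1 : N3 P) (h2 : N3 Q) : N3 (P + Q) := by
  obtain ⟨g, h0, e1, e2, e3⟩ := FF P Q
  intro h
  have e : fa (Nn P) (Hh P) (Nn Q) (Hh Q) * D ^ 2 - fb D (Nn P) (Hh P) (Nn Q) (Hh Q) * D +
     fc D (Nn P) (Hh P) (Nn Q) (Hh Q) = g * ((Nn (P + Q) - D * Hh (P + Q)) * (Nn (P - Q) - D * Hh (P - Q))) := by
    rw [e1, e2, e3]; ring
  have : (3:ℤ) ∣ (Nn P - D * Hh P) ^ 2 * (Nn Q - D * Hh Q) ^ 2 := by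
    have h' := (h.mul_right (Nn (P - Q) - D * Hh (P - Q))).mul_left g
    rw [← e] at h'
    have hD := D_three D
    have z3 : ∀ a : ℤ, ((3:ℤ) ∣ a) ↔ (a : ZMod 3) = 0 := fun a => zm (n := 3)
    rw [z3] at h' hD ⊢
    have := n3_aux D (Nn P) (Hh P) (Nn Q) (Hh Q) hD
    simp only [fa, fb, fc] at this h'
    push_cast at h' ⊢
    rw [← this, ← h']
  rcases p3.dvd_or_dvd this with h | h
  · exact h1 (p3.dvd_of_dvd_pow h)
  · exact h2 (p3.dvd_of_dvd_pow h)

theorem n3_fermat (D : ℤ) : (3:ℤ) ∣ D ^ 3 - D := by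
  have z3 : ∀ a : ℤ, ((3:ℤ) ∣ a) ↔ (a : ZMod 3) = 0 := fun a => zm (n := 3)
  rw [z3]; push_cast
  have : ∀ d : ZMod 3, d ^ 3 - d = 0 := by decide
  exact this _

theorem Ns_of_N3 {P : Pt D} (h : N3 P) : Ns 3 P := by
  rintro ⟨h1, h2⟩
  have c := cop P
  have hc := cop_not p3 P
  have z3 : ∀ a : ℤ, ((3:ℤ) ∣ a) ↔ (a : ZMod 3) = 0 := fun a => zm (n := 3)
  unfold N3 at h
  have hD := D_three D
  simp only [fb, fc] at h1 h2
  rw [z3] at h h1 h2 hD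
  rw [z3, z3] at hc
  push_cast at *
  have : ∀ d n k : ZMod 3, d ≠ 0 → (k = 0 → n ≠ 0) → n - d * k ≠ 0 →
    2 * (n * n * (n * k + n * k) - 2 * d * k ^ 2 * k ^ 2) = 0 →
    n ^ 2 * n ^ 2 + 4 * d * k * k * (n * k + n * k) = 0 → False := by decide
  exact this _ _ _ hD hc h h1 h2

theorem N3_two (P : Pt D) : N3 (P + P) := by
  by_cases h : N3 P
  · exact N3_add h h
  by_cases hP : P = 0
  · rw [hP, add_zero]; exact N3_zero
  unfold N3 at h
  rw [not_not] at h
  obtain ⟨g, g0, -, k1, k2⟩ := dbl P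
  obtain ⟨z, M, z0, hz, hM, -⟩ := rep P hP
  have hh : ¬ (3:ℤ) ∣ Hh P := fun h' => cop_not p3 P h' ((dvd_sub_left (h'.mul_left _)).mp h)
  obtain ⟨t, ht⟩ := h
  obtain ⟨f, hf⟩ := n3_fermat D
  have h3 : (3:ℤ) ∣ M := by
    apply p3.dvd_of_dvd_pow (n := 2)
    rw [hM, show z ^ 6 = (z ^ 2) ^ 3 by ring, ← hz, show Nn P = D * Hh P + 3 * t by linarith]
    exact ⟨f * Hh P ^ 3 + 3 * t * D ^ 2 * Hh P ^ 2 + 9 * D * Hh P * t ^ 2 + 9 * t ^ 3, by linear_combination Hh P ^ 3 * hf⟩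
  obtain ⟨m, rfl⟩ := h3
  have hm : Nn P ^ 3 - D * Hh P ^ 3 = 9 * m ^ 2 := by rw [hz]; linear_combination -hM
  have g9 : (9:ℤ) ∣ g := by
    have a1 : (9:ℤ) ∣ g * Hh (P + P) := by
      rw [← k1, hm]; exact ⟨4 * Hh P * m ^ 2, by ring⟩
    have a2 : (9:ℤ) ∣ g * Nn (P + P) := by
      rw [← k2]; exact ⟨Nn P * (m ^ 2 + D * Hh P ^ 3), by linear_combination Nn P * hm⟩
    obtain ⟨u, v, e⟩ := cop (P + P)
    have : g = (g * Nn (P + P)) * u + (g * Hh (P + P)) * v := by linear_combination -g * e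
    rw [this]; exact dvd_add (a2.mul_right _) (a1.mul_right _)
  obtain ⟨k, rfl⟩ := g9
  rintro ⟨s, hs⟩
  have e : m ^ 2 * Nn P + D * Nn P * Hh P ^ 3 - 4 * D * Hh P * m ^ 2 = k * (3 * s) := by
    have : (9:ℤ) * (m ^ 2 * Nn P + D * Nn P * Hh P ^ 3 - 4 * D * Hh P * m ^ 2) = 9 * (k * (3 * s)) := by
      rw [← hs]; linear_combination k2 - D * k1 - (Nn P - 4 * D * Hh P) * hm
    linarith
  have : (3:ℤ) ∣ D ^ 2 * Hh P ^ 4 := by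
    refine ⟨k * s - t * m ^ 2 - D * t * Hh P ^ 3 + D * Hh P * m ^ 2, ?_⟩
    rw [show Nn P = D * Hh P + 3 * t by linarith] at e
    linear_combination e
  rcases p3.dvd_or_dvd this with h | h
  · exact D_three D (p3.dvd_of_dvd_pow h)
  · exact hh (p3.dvd_of_dvd_pow h)

theorem good_of {Q : Pt D} (h1 : Od Q) (h2 : N3 Q) (h3 : Q ∈ Gam D) : Good Q := by
  intro p hp
  have key : ∀ q : ℤ, Prime q → p ∣ q → Associated p q := fun q hq h => (hp.dvd_prime_iff_associated hq).mp h
  have tr : ∀ q : ℤ, Prime q → p ∣ q → ∀ a, p ∣ a ↔ q ∣ a := fun q hq h a => (key q hq h).dvd_iff_dvd_left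
  by_cases hD : p ∣ 8 * D
  · apply Ns_of_D hp hD
    rcases hp.dvd_or_dvd hD with h | h
    · have : p ∣ 2 := hp.dvd_of_dvd_pow (n := 3) (by simpa using h)
      rw [tr 2 p2 this]; exact h1
    · rcases GD.pdvd hp h with h | h
      · rw [tr 5 p5 h]; exact h3.1
      · rw [tr 11 p11 h]; exact h3.2
  · have hd : ¬ p ∣ D := fun h => hD (h.mul_left _)
    have h2' : ¬ p ∣ 2 := fun h => hD ((h.trans (by norm_num : (2:ℤ) ∣ 8)).mul_right _)
    by_cases h : p ∣ 3
    · have := Ns_of_N3 h2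
      unfold Ns at this ⊢
      rwa [tr 3 p3 h, tr 3 p3 h]
    · exact Ns_of_not hp (fun h' => (hp.dvd_or_dvd h').elim h2' h) hd Q

variable (D) in
/-- points nonsingular at 3, 5, 11 -/
def G0 : AddSubgroup (Pt D) where
  carrier := {P | P ∈ Gam D ∧ N3 P}
  zero_mem' := ⟨zero_mem _, N3_zero⟩
  neg_mem' := by rintro P ⟨h1, h2⟩; exact ⟨neg_mem h1, N3_neg.mpr h2⟩
  add_mem' := by rintro P Q ⟨h1, h2⟩ ⟨h3, h4⟩; exact ⟨add_mem h1 h3, N3_add h2 h4⟩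

theorem two_mem_G0 {P : Pt D} (h : P ∈ Gam D) : P + P ∈ G0 D := ⟨add_mem h h, N3_two P⟩

theorem smul_three (P : Pt D) (i : ℕ) : (3 ^ (i + 1) : ℕ) • P = (3 ^ i : ℕ) • P + (3 ^ i : ℕ) • P + (3 ^ i : ℕ) • P := by
  rw [pow_succ, mul_nsmul]
  rw [show (3:ℕ) = 1 + 1 + 1 from rfl]; simp only [add_nsmul, one_nsmul, nsmul_add]

theorem E3_pow {R : Pt D} (h : R ∈ G0 D) (i : ℕ) : (3:ℤ) ^ (2 * i) ∣ Hh ((3 ^ i : ℕ) • R) := by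
  induction i with
  | zero => simp
  | succ i ih =>
    rw [smul_three]
    have hm : (3 ^ i : ℕ) • R ∈ G0 D := nsmul_mem h _
    generalize (3 ^ i : ℕ) • R = P at *
    by_cases hP : P = 0
    · rw [hP]; simp
    obtain ⟨G, G0, hG, e1, -⟩ := triple P hP
    have := hG 3 p3 (Ns_of_N3 hm.2)
    apply pcancel p3 _ this
    rw [e1, show 2 * (i + 1) = 2 + 2 * i by ring, pow_add]
    obtain ⟨k, hk⟩ := ih
    exact ⟨Nn P ^ 2 * k * (Nn P ^ 3 - 4 * D * Hh P ^ 3) ^ 2, by rw [hk]; ring⟩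

theorem good_pow {R : Pt D} (h : R ∈ G0 D) (i : ℕ) (hi : 1 ≤ i) : Good ((3 ^ i : ℕ) • R) := by
  obtain ⟨k, rfl⟩ := Nat.exists_eq_add_of_le' hi
  have hm : (3 ^ (k + 1) : ℕ) • R ∈ G0 D := nsmul_mem h _
  refine good_of ?_ hm.2 hm.1
  rw [smul_three]; exact Od_three _

theorem no_two {P : Pt D} (h : P + P = 0) : P = 0 := by
  by_contra hP
  obtain ⟨g, g0, -, k1, k2⟩ := dbl P
  rw [h] at k1
  have hH : Hh P ≠ 0 := fun h => hP ((Hh_eq_zero P).mp h)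
  have hq : (Hh P : ℚ) ≠ 0 := by exact_mod_cast hH
  have : Nn P ^ 3 - D * Hh P ^ 3 = 0 := by
    have : 4 * Hh P * (Nn P ^ 3 - D * Hh P ^ 3) = 0 := by rw [k1]; simp
    rcases mul_eq_zero.mp this with h | h
    · omega
    · exact h
  apply hGD.nc (Nn P / Hh P)
  field_simp
  have := congrArg (Int.cast : ℤ → ℚ) this
  push_cast at this
  linarith

theorem no_three {P : Pt D} (h : P + P + P = 0) : P = 0 := by
  by_contra hP
  obtain ⟨G, g0, -, k1, k2⟩ := triple P hP
  rw [h] at k1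
  have hH : Hh P ≠ 0 := fun h => hP ((Hh_eq_zero P).mp h)
  have hN := Nn_pos (GD.pos) P
  have k : Nn P ^ 3 - 4 * D * Hh P ^ 3 = 0 := by
    have : 9 * Nn P ^ 2 * Hh P * (Nn P ^ 3 - 4 * D * Hh P ^ 3) ^ 2 = 0 := by rw [← k1]; simp
    rcases mul_eq_zero.mp this with h | h
    · exfalso; have : 9 * Nn P ^ 2 * Hh P ≠ 0 := by positivity
      exact this h
    · exact pow_eq_zero_iff (by norm_num) |>.mp h
  have h2 : (2:ℤ) ∣ Nn P := by
    apply p2.dvd_of_dvd_pow (n := 3)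
    exact ⟨2 * D * Hh P ^ 3, by linarith⟩
  have hh : ¬ (2:ℤ) ∣ Hh P := fun h => cop_not p2 P h h2
  obtain ⟨n, hn⟩ := h2
  rw [hn] at k
  have : (2:ℤ) ∣ D * Hh P ^ 3 := ⟨n ^ 3, by linarith⟩
  rcases p2.dvd_or_dvd this with h | h
  · exact D_two D h
  · exact hh (p2.dvd_of_dvd_pow h)

theorem inf3 {P : Pt D} (h : ∀ k : ℕ, ∃ R ∈ Gam D, P = (3 ^ k : ℕ) • R) : P = 0 := by
  apply no_two
  rw [← Hh_eq_zero]
  by_contra hne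
  have hpos : 0 < Hh (P + P) := lt_of_le_of_ne (Hh_nonneg _) (Ne.symm hne)
  obtain ⟨R, hR, e⟩ := h (Hh (P + P)).toNat
  have := E3_pow (two_mem_G0 hR) (Hh (P + P)).toNat
  rw [nsmul_add, ← e] at this
  have := Int.le_of_dvd hpos this
  have h3 : ((Hh (P + P)).toNat : ℤ) < 3 ^ (2 * (Hh (P + P)).toNat) := by
    have : ∀ k : ℕ, k < 3 ^ (2 * k) := fun k => by
      calc k < 3 ^ k := Nat.lt_pow_self (by norm_num)
        _ ≤ 3 ^ (2 * k) := Nat.pow_le_pow_right (by norm_num) (by omega)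
    exact_mod_cast this _
  rw [Int.toNat_of_nonneg hpos.le] at h3
  omega

theorem tors {P : Pt D} (hP : P ∈ Gam D) (n : ℕ) (hn : n ≠ 0) (h : n • P = 0) : P = 0 := by
  induction n using Nat.strong_induction_on with
  | _ n ih =>
  by_cases h3 : 3 ∣ n
  · obtain ⟨m, rfl⟩ := h3
    refine ih m (by omega) (by omega) ?_
    apply no_three
    rw [← h, mul_comm, mul_nsmul]
    rw [show (3:ℕ) = 1 + 1 + 1 from rfl]; simp only [add_nsmul, one_nsmul, nsmul_add]
  · apply inf3
    intro k
    have hc : IsCoprime (n:ℤ) ((3:ℤ) ^ k) := by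
      apply IsCoprime.pow_right
      have := ((Nat.Prime.coprime_iff_not_dvd Nat.prime_three).mpr h3).symm
      exact_mod_cast Nat.isCoprime_iff_coprime.mpr this
    obtain ⟨u, v, e⟩ := hc
    refine ⟨v • P, zsmul_mem hP _, ?_⟩
    have : P = (1:ℤ) • P := by simp
    rw [← e, add_zsmul, mul_zsmul, natCast_zsmul, h] at this
    rw [zsmul_zero, zero_add, mul_comm, mul_zsmul] at this
    rw [← natCast_zsmul]; push_cast; exact this
end

section
set_option linter.unusedSectionVars false
variable {D : ℤ} [hGD : GD D]

theorem X_const {p : ℤ} (hp : Prime p) (h2 : ¬ p ∣ 2) {e : ℕ} (he : 1 ≤ e) {P Q : Pt D}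
    (hQ : p ^ (2 * e) ∣ Hh Q) (hP : ¬ p ∣ Hh P) :
    ¬ p ∣ Hh (P + Q) ∧ p ^ e ∣ Nn (P + Q) * Hh P - Nn P * Hh (P + Q) := by
  have hpQ : p ∣ Hh Q := (dvd_pow_self p (by omega)).trans hQ
  obtain ⟨g, h0, hg, e1, e2, e3⟩ := FFp hp P Q (Ns_of_H hp Q hpQ)
  have hnQ := cop_not hp Q hpQ
  have hf : ¬ p ∣ Hh (P + Q) * Hh (P - Q) := by
    intro h
    have : p ∣ fa (Nn P) (Hh P) (Nn Q) (Hh Q) := e1 ▸ h.mul_left _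
    simp only [fa] at this
    have := hp.dvd_of_dvd_pow this
    have := (dvd_sub_right (hpQ.mul_left _)).mp this
    exact (hp.dvd_or_dvd this).elim hnQ hP
  have k1 : ¬ p ∣ Hh (P + Q) := fun h => hf (h.mul_right _)
  have k2 : ¬ p ∣ Hh (P - Q) := fun h => hf (h.mul_left _)
  refine ⟨k1, ?_⟩
  obtain ⟨t, ht⟩ := hQ
  generalize Nn (P + Q) = a at *
  generalize Nn (P - Q) = b at *
  generalize Hh (P + Q) = c at *
  generalize Hh (P - Q) = d at *
  generalize Nn P = n at *
  generalize Hh P = k at *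
  generalize Nn Q = m at *
  rw [ht] at e1 e2 e3
  simp only [fa, fb, fc] at e1 e2 e3
  set q := p ^ (2 * e) with hq
  have s1 : q ∣ (a * k - n * c) * (b * k - n * d) := by
    apply pcancel hp (2 * e) hg
    refine ⟨t * (4 * D * k ^ 3 * (n * (q * t) + m * k) - 2 * n ^ 3 * k * m + 4 * D * n * k ^ 3 * (q * t)
       - 2 * n ^ 2 * (n * m * k) + n ^ 2 * n ^ 2 * (q * t)), ?_⟩
    linear_combination -k ^ 2 * e3 + n * k * e2 - n ^ 2 * e1
  have s2 : q ∣ d * (a * k - n * c) + c * (b * k - n * d) := by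
    apply pcancel hp (2 * e) hg
    refine ⟨t * (2 * k * n ^ 2 * m - 4 * D * k ^ 3 * (q * t) + 4 * n ^ 2 * m * k - 2 * n ^ 3 * (q * t)), ?_⟩
    linear_combination -k * e2 + 2 * n * e1
  have s3 : (p ^ e) ^ 2 ∣ (d * (a * k - n * c) - c * (b * k - n * d)) ^ 2 := by
    rw [← pow_mul, mul_comm e 2, ← hq]
    have : (d * (a * k - n * c) - c * (b * k - n * d)) ^ 2 = (d * (a * k - n * c) + c * (b * k - n * d)) *
      (d * (a * k - n * c) + c * (b * k - n * d)) - (4 * c * d) * ((a * k - n * c) * (b * k - n * d)) := by ring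
    rw [this]
    exact dvd_sub (s2.mul_left _) (s1.mul_left _)
  have s4 := (Int.pow_dvd_pow_iff (by norm_num)).mp s3
  have s5 : p ^ e ∣ d * (a * k - n * c) + c * (b * k - n * d) :=
    (pow_dvd_pow p (by omega)).trans s2
  have s6 : p ^ e ∣ (2 * d) * (a * k - n * c) := by
    have := dvd_add s4 s5
    have e : (2 * d) * (a * k - n * c) = d * (a * k - n * c) - c * (b * k - n * d) + (d * (a * k - n * c) + c * (b * k - n * d)) := by
      ring
    rw [e]; exact this
  exact pcancel hp e (fun h => (hp.dvd_or_dvd h).elim h2 k2) s6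

theorem T1 {p : ℤ} {e : ℕ} {P P' Q : Pt D} (hG : Good Q)
    (hQ : p ^ (2 * e) ∣ Hh Q) (h : p ^ e ∣ Nn P' * Hh P - Nn P * Hh P') :
    p ^ (3 * e) ∣ Hh P ^ 2 * (Hh (P' + Q) * Hh (P' - Q)) - Hh P' ^ 2 * (Hh (P + Q) * Hh (P - Q)) := by
  rw [Kg P Q hG, Kg P' Q hG]
  have : Hh P ^ 2 * (Nn P' * Hh Q - Nn Q * Hh P') ^ 2 - Hh P' ^ 2 * (Nn P * Hh Q - Nn Q * Hh P) ^ 2 =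
    (Hh Q * (Nn P' * Hh P - Nn P * Hh P')) * (Hh P * (Nn P' * Hh Q - Nn Q * Hh P') + Hh P' * (Nn P * Hh Q - Nn Q * Hh P)) := by
    ring
  rw [this, show 3 * e = 2 * e + e by ring, pow_add]
  exact (mul_dvd_mul hQ h).mul_right _

theorem lemT {p : ℤ} (hp : Prime p) (h2 : ¬ p ∣ 2) {e : ℕ} (he : 1 ≤ e) {P Q : Pt D} (hG : Good Q)
    (hQ : p ^ (2 * e) ∣ Hh Q) (hP : ¬ p ∣ Hh P) :
    p ^ (3 * e) ∣ Hh P ^ 8 * Hh (P + (Q + Q + Q)) - Hh (P + Q) ^ 6 * Hh (P - Q) ^ 3 := by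
  obtain ⟨a1, b1⟩ := X_const hp h2 he hQ hP
  obtain ⟨a2, b2⟩ := X_const hp h2 he hQ a1
  have b3 : p ^ e ∣ Nn (P + Q + Q) * Hh P - Nn P * Hh (P + Q + Q) := by
    apply pcancel hp e a1
    have e : Hh (P + Q) * (Nn (P + Q + Q) * Hh P - Nn P * Hh (P + Q + Q)) =
      Hh P * (Nn (P + Q + Q) * Hh (P + Q) - Nn (P + Q) * Hh (P + Q + Q)) +
      Hh (P + Q + Q) * (Nn (P + Q) * Hh P - Nn P * Hh (P + Q)) := by ring
    rw [e]; exact dvd_add (b2.mul_left _) (b1.mul_left _)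
  have t1 := T1 hG hQ b1
  have t2 := T1 hG hQ b3
  rw [add_sub_cancel_right] at t1 t2
  rw [show P + (Q + Q + Q) = P + Q + Q + Q by abel]
  generalize Hh (P + Q) = u1 at *
  generalize Hh (P + Q + Q) = u2 at *
  generalize Hh (P + Q + Q + Q) = u3 at *
  generalize Hh P = u0 at *
  generalize Hh (P - Q) = v at *
  have t3 : p ^ (3 * e) ∣ u0 ^ 2 * u3 - u2 ^ 2 * v := by
    apply pcancel hp _ a1
    convert t2 using 1; ring
  have : u0 ^ 8 * u3 - u1 ^ 6 * v ^ 3 = u0 ^ 6 * (u0 ^ 2 * u3 - u2 ^ 2 * v) +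
    v * (u0 ^ 3 * u2 + u1 ^ 3 * v) * (u0 ^ 2 * (u2 * u0) - u1 ^ 2 * (u1 * v)) := by ring
  rw [this]
  exact dvd_add (t3.mul_left _) (t1.mul_left _)

/-- theta function -/
def tau (p : ℕ) [Fact p.Prime] (P : Pt D) : ZMod p := (Hh P : ZMod p) / (Nn P : ZMod p)

theorem tau_par (p : ℕ) [Fact p.Prime] (hD : (p:ℤ) ∣ D) {P Q : Pt D} (h1 : ¬ (p:ℤ) ∣ Nn P) (h2 : ¬ (p:ℤ) ∣ Nn Q) :
    tau p (P + Q) + tau p (P - Q) = 2 * (tau p P + tau p Q) := by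
  have pp : Prime (p:ℤ) := Nat.prime_iff_prime_int.mp Fact.out
  have h3 := fc_not pp (hD.mul_left 4) P Q h1 h2
  have h4 := fc_not pp (hD.mul_left 4) P (-Q) h1 (by simpa using h2)
  rw [← sub_eq_add_neg] at h4
  obtain ⟨g, h0, e1, e2, e3⟩ := FF P Q
  replace e2 := congrArg (Int.cast : ℤ → ZMod p) e2
  replace e3 := congrArg (Int.cast : ℤ → ZMod p) e3
  simp only [fb, fc] at e2 e3
  push_cast at e2 e3
  rw [zm] at hD h1 h2 h3 h4
  unfold tau
  generalize (Nn (P + Q) : ZMod p) = a at *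
  generalize (Nn (P - Q) : ZMod p) = b at *
  generalize (Hh (P + Q) : ZMod p) = c at *
  generalize (Hh (P - Q) : ZMod p) = d at *
  generalize (Nn P : ZMod p) = n at *
  generalize (Hh P : ZMod p) = k at *
  generalize (Nn Q : ZMod p) = m at *
  generalize (Hh Q : ZMod p) = j at *
  rw [hD] at e2 e3
  have hg : (g : ZMod p) ≠ 0 := by
    intro h
    rw [h] at e3
    have : n ^ 2 * m ^ 2 = 0 := by linear_combination e3
    rcases mul_eq_zero.mp this with h | h
    · exact h1 (pow_eq_zero_iff (by norm_num) |>.mp h)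
    · exact h2 (pow_eq_zero_iff (by norm_num) |>.mp h)
  have hne : (g : ZMod p) * n * m ≠ 0 := mul_ne_zero (mul_ne_zero hg h1) h2
  field_simp
  apply mul_left_cancel₀ hne
  linear_combination -n ^ 2 * m ^ 2 * e2 + 2 * n * m * (m * k + n * j) * e3

theorem tau_nsmul (p : ℕ) [Fact p.Prime] (hD : (p:ℤ) ∣ D) {P : Pt D} (h1 : ¬ (p:ℤ) ∣ Nn P) (n : ℕ) :
    tau p (n • P) = (n:ZMod p) ^ 2 * tau p P := by
  have pp : Prime (p:ℤ) := Nat.prime_iff_prime_int.mp Fact.out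
  have hN : ∀ n : ℕ, ¬ (p:ℤ) ∣ Nn (n • P) := by
    intro n
    induction n with
    | zero => simp only [zero_nsmul, Nn_zero]; exact fun h => pp.not_isUnit (isUnit_of_dvd_one h)
    | succ n ih => rw [succ_nsmul]; exact fc_not pp (hD.mul_left 4) _ _ ih h1
  induction n using Nat.strong_induction_on with
  | _ n ih =>
  match n with
  | 0 => simp [tau]
  | 1 => simp
  | n + 2 =>
    have := tau_par p hD (hN (n + 1)) h1
    rw [← succ_nsmul, succ_nsmul P n, add_sub_cancel_right, ← succ_nsmul, ih n (by omega), ih (n + 1) (by omega)] at this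
    rw [show n + 2 = n + 1 + 1 from rfl]
    push_cast at *
    linear_combination this

theorem tau_neg (p : ℕ) [Fact p.Prime] (P : Pt D) : tau p (-P) = tau p P := by simp [tau]

theorem tau_zsmul (p : ℕ) [Fact p.Prime] (hD : (p:ℤ) ∣ D) {P : Pt D} (h1 : ¬ (p:ℤ) ∣ Nn P) (n : ℤ) :
    tau p (n • P) = (n:ZMod p) ^ 2 * tau p P := by
  obtain ⟨m, rfl | rfl⟩ := n.eq_nat_or_neg
  · rw [natCast_zsmul, tau_nsmul p hD h1]; simp
  · rw [neg_zsmul, tau_neg, natCast_zsmul, tau_nsmul p hD h1]; simp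

theorem tau_zero_iff (p : ℕ) [Fact p.Prime] {P : Pt D} (h1 : ¬ (p:ℤ) ∣ Nn P) :
    tau p P = 0 ↔ (p:ℤ) ∣ Hh P := by
  rw [zm] at h1 ⊢
  simp [tau, div_eq_zero_iff, h1]

/-- if p ∣ H (n G') and τ(kG') ≠ 0 then p ∣ n. -/
theorem theta (p : ℕ) [Fact p.Prime] (hD : (p:ℤ) ∣ D) {G' : Pt D} (h1 : ¬ (p:ℤ) ∣ Nn G') (n k : ℤ)
    (h : (p:ℤ) ∣ Hh (n • G')) (hk : ¬ (p:ℤ) ∣ Hh (k • G')) : (p:ℤ) ∣ n := by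
  have hN : ∀ n : ℤ, ¬ (p:ℤ) ∣ Nn (n • G') := by
    have pp : Prime (p:ℤ) := Nat.prime_iff_prime_int.mp Fact.out
    have hN' : ∀ n : ℕ, ¬ (p:ℤ) ∣ Nn (n • G') := by
      intro n
      induction n with
      | zero => simp only [zero_nsmul, Nn_zero]; exact fun h => pp.not_isUnit (isUnit_of_dvd_one h)
      | succ n ih => rw [succ_nsmul]; exact fc_not pp (hD.mul_left 4) _ _ ih h1
    intro n
    obtain ⟨m, rfl | rfl⟩ := n.eq_nat_or_neg
    · rw [natCast_zsmul]; exact hN' m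
    · rw [neg_zsmul, Nn_neg, natCast_zsmul]; exact hN' m
  rw [← tau_zero_iff p (hN _), tau_zsmul p hD h1] at h hk
  rw [zm]
  rcases mul_eq_zero.mp h with h | h
  · exact pow_eq_zero_iff (by norm_num) |>.mp h
  · exact absurd (by rw [h, mul_zero]) hk
end

section
set_option linter.unusedSectionVars false
variable {D : ℤ} [hGD : GD D]

/-- build a point -/
theorem mk_pt {l g m : ℤ} (hg : g ≠ 0) (hc : IsCoprime l g) (h : m ^ 2 + D * g ^ 6 = l ^ 3) :
    ∃ R : Pt D, Nn R = l ∧ Hh R = g ^ 2 := by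
  have hgq : (g : ℚ) ≠ 0 := by exact_mod_cast hg
  have e : ((m:ℚ) / g ^ 3) ^ 2 = ((l:ℚ) / g ^ 2) ^ 3 - D := by
    have := congrArg (Int.cast : ℤ → ℚ) h
    push_cast at this
    field_simp
    linear_combination this
  refine ⟨.some _ _ (mk_ns GD.pos.ne' e), ?_, ?_⟩
  · simp only [Nn]
    have := Rat.num_div_eq_of_coprime (a := l) (b := g ^ 2) (by positivity)
      (Int.isCoprime_iff_gcd_eq_one.mp hc.pow_right)
    push_cast at this; exact this
  · simp only [Hh]
    have := Rat.den_div_eq_of_coprime (a := l) (b := g ^ 2) (by positivity)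
      (Int.isCoprime_iff_gcd_eq_one.mp hc.pow_right)
    push_cast at this; exact this

theorem ratio_eq {a b c d : ℤ} (h1 : IsCoprime a b) (h2 : IsCoprime c d) (ha : 0 < a) (hc : 0 < c)
    (h : a * d = c * b) : a = c ∧ b = d := by
  have k1 : a ∣ c := h1.dvd_of_dvd_mul_right (Dvd.intro d h)
  have k2 : c ∣ a := h2.dvd_of_dvd_mul_right (Dvd.intro b h.symm)
  have : a = c := Int.dvd_antisymm ha.le hc.le k1 k2
  subst this
  exact ⟨rfl, (mul_left_cancel₀ ha.ne' h).symm⟩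

theorem div_pt {P : Pt D} (hP : P ∈ Gam D) (hO : Od P) : ∃ R ∈ Gam D, P = R + R + R ∧ Nn R ^ 9 ≤ 5184 * Nn P := by
  by_cases h0 : P = 0
  · exact ⟨0, zero_mem _, by simp [h0], by simp [h0]⟩
  obtain ⟨i, j, hD⟩ := hGD.form
  obtain ⟨z, M, z0, hz, hM, hc⟩ := rep P h0
  have hN := Nn_pos GD.pos P
  have hodd : Nn P % 2 = 1 := by unfold Od at hO; omega
  obtain ⟨l, g, m, κ, e1, c1, l5, l11, g0, κ0, κ1, e2, e3⟩ := div3 i j rfl M z (Nn P) hN z0.ne'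
    (by linear_combination hM - z ^ 6 * hD) hodd hc.symm hP.1 hP.2
  rw [← hD] at e1 e2 e3
  obtain ⟨R, hR1, hR2⟩ := mk_pt g0 c1 e1
  have hR0 : R ≠ 0 := fun h => by
    rw [h] at hR2; simp at hR2; exact g0 (pow_eq_zero_iff (by norm_num) |>.mp hR2.symm)
  obtain ⟨K, K0, -, f1, f2⟩ := triple R hR0
  rw [hR1, hR2] at f1 f2
  have hl := Nn_pos GD.pos R
  have hN3 := Nn_pos GD.pos (R + R + R)
  rw [hR1] at hl
  have r := ratio_eq (cop (R + R + R)) (cop P) hN3 hN (by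
    have : (K * κ) * (Nn (R + R + R) * Hh P) = (K * κ) * (Nn P * Hh (R + R + R)) := by
      rw [hz]
      have t1 : K * Hh (R + R + R) = κ * z ^ 2 := by rw [f1, ← e2]; ring
      have t2 : K * Nn (R + R + R) = κ * Nn P := by rw [f2, ← e3]; ring
      calc _ = (K * Nn (R + R + R)) * (κ * z ^ 2) := by ring
        _ = _ := by rw [t2, ← t1]; ring
    exact mul_left_cancel₀ (by positivity) this)
  have hbound : l ^ 9 ≤ 5184 * Nn P := by
    have : l ^ 9 ≤ κ * Nn P := by
      rw [← e3]
      have hDp : 0 < D := GD.pos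
      have s : D * g ^ 6 ≤ l ^ 3 := by nlinarith [sq_nonneg m]
      have g6 : 0 < g ^ 6 := by positivity
      have s1 : D ^ 2 * g ^ 12 * (D * g ^ 6) ≤ D ^ 2 * g ^ 12 * l ^ 3 := mul_le_mul_of_nonneg_left s (by positivity)
      have s2 : D * g ^ 6 * l ^ 3 * (D * g ^ 6) ≤ D * g ^ 6 * l ^ 3 * l ^ 3 := mul_le_mul_of_nonneg_left s (by positivity)
      have s3 : 0 < D ^ 3 * g ^ 18 := by positivity
      linarith
    nlinarith
  have hRG : R ∈ Gam D := ⟨by rw [hR1]; exact l5, by rw [hR1]; exact l11⟩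
  rcases eq_or_neg _ _ r.1 r.2 with h | h
  · exact ⟨R, hRG, h.symm, by rw [hR1]; exact hbound⟩
  · exact ⟨-R, neg_mem hRG, by rw [show -R + -R + -R = -(R + R + R) by abel, h, neg_neg],
      by rw [Nn_neg, hR1]; exact hbound⟩

theorem decomp {G P : Pt D} (hG : G ∈ Gam D) (hGe : ¬ Od G) (hP : P ∈ Gam D) :
    ∃ e : ℤ, (e = 0 ∨ e = 1 ∨ e = -1) ∧ ∃ R ∈ Gam D, P = e • G + (R + R + R) ∧ Nn R ^ 9 ≤ 5184 * Nn (P - e • G) := by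
  by_cases hO : Od P
  · obtain ⟨R, h1, h2, h3⟩ := div_pt hP hO
    exact ⟨0, Or.inl rfl, R, h1, by simpa using h2, by simpa using h3⟩
  rcases even_even hO hGe with ⟨h, -⟩ | ⟨-, h⟩
  · obtain ⟨R, h1, h2, h3⟩ := div_pt (add_mem hP hG) h
    exact ⟨-1, by simp, R, h1, by rw [← h2]; simp, by simpa using h3⟩
  · obtain ⟨R, h1, h2, h3⟩ := div_pt (sub_mem hP hG) h
    exact ⟨1, by simp, R, h1, by rw [← h2]; simp, by simpa using h3⟩

theorem H_le_N (P : Pt D) : Hh P ≤ Nn P := by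
  by_cases h : P = 0
  · rw [h]; simp
  obtain ⟨z, M, z0, hz, hM, -⟩ := rep P h
  have hDp : 0 < D := GD.pos
  have hN := Nn_pos hDp P
  have : Hh P ^ 3 ≤ Nn P ^ 3 := by
    rw [hz]
    have : 0 < z ^ 6 := by positivity
    nlinarith [sq_nonneg M]
  exact le_of_pow_le_pow_left₀ (by norm_num) hN.le this

theorem N_add_le (P G : Pt D) : Nn (P + G) ≤ Nn P ^ 2 * (Nn G ^ 2 + 8 * D * Nn G ^ 2) := by
  obtain ⟨g, h0, e1, e2, e3⟩ := FF P G
  have hDp : 0 < D := GD.pos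
  have a1 := Nn_pos hDp (P + G)
  have a2 := Nn_pos hDp (P - G)
  have a3 := Nn_pos hDp P
  have a4 := Nn_pos hDp G
  have b1 := H_le_N P
  have b2 := H_le_N G
  have c1 := Hh_nonneg P
  have c2 := Hh_nonneg G
  have k1 : Nn (P + G) ≤ fc D (Nn P) (Hh P) (Nn G) (Hh G) := by
    rw [e3]
    have : 1 ≤ g * Nn (P - G) := by
      have : 0 < g * Nn (P - G) := by positivity
      omega
    nlinarith
  refine k1.trans ?_
  simp only [fc]
  have : 4 * D * Hh P * Hh G * (Nn P * Hh G + Nn G * Hh P) ≤ 4 * D * Nn P * Nn G * (Nn P * Nn G + Nn G * Nn P) := by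
    gcongr
  nlinarith

theorem fin_N (C : ℤ) : {P : Pt D | Nn P ≤ C}.Finite := by
  have : ({P : Pt D | Nn P ≤ C}) ⊆ (fun P : Pt D => (Nn P, Hh P)) ⁻¹' (Set.Icc 0 C ×ˢ Set.Icc 0 C) := by
    intro P hP
    have h1 := (Nn_pos GD.pos P).le
    have h2 := Hh_nonneg P
    have h3 := H_le_N P
    simp only [Set.mem_ofPred_eq] at hP
    simp only [Set.mem_preimage, Set.mem_prod, Set.mem_Icc]
    omega
  refine Set.Finite.subset ?_ this
  refine Set.Finite.preimage' ((Set.finite_Icc _ _).prod (Set.finite_Icc _ _)) ?_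
  rintro ⟨n, k⟩ -
  by_cases h : ∃ Q : Pt D, Nn Q = n ∧ Hh Q = k
  · obtain ⟨Q, rfl, rfl⟩ := h
    refine Set.Finite.subset (Set.toFinite {Q, -Q}) ?_
    intro P hP
    simp only [Set.mem_preimage, Set.mem_singleton_iff, Prod.mk.injEq] at hP
    rcases eq_or_neg P Q hP.1 hP.2 with h | h <;> simp [h]
  · convert Set.finite_empty
    ext P
    simp only [Set.mem_preimage, Set.mem_singleton_iff, Prod.mk.injEq, Set.mem_empty_iff_false, iff_false]
    exact fun hP => h ⟨P, hP⟩

theorem fg {G : Pt D} (hG : G ∈ Gam D) (hGe : ¬ Od G) : ∃ S : Set (Pt D), S.Finite ∧ AddSubgroup.closure S = Gam D := by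
  set K : ℤ := Nn G ^ 2 + 8 * D * Nn G ^ 2 + 1 with hK
  have hDp : 0 < D := GD.pos
  have hKp : 0 < K := by positivity
  set C : ℤ := 5184 * K with hC
  refine ⟨{P | P ∈ Gam D ∧ Nn P ≤ C} ∪ {G}, ((fin_N C).subset (fun P h => h.2)).union (Set.finite_singleton _), ?_⟩
  apply le_antisymm
  · rw [AddSubgroup.closure_le]
    rintro P (h | h)
    · exact h.1
    · rw [Set.mem_singleton_iff.mp h]; exact hG
  · have key : ∀ n : ℕ, ∀ P : Pt D, P ∈ Gam D → (Nn P).toNat = n → P ∈ AddSubgroup.closure ({P | P ∈ Gam D ∧ Nn P ≤ C} ∪ {G}) := by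
      intro n
      induction n using Nat.strong_induction_on with
      | _ n ih =>
      intro P hP hn
      by_cases hle : Nn P ≤ C
      · exact AddSubgroup.subset_closure (Or.inl ⟨hP, hle⟩)
      push Not at hle
      obtain ⟨e, he, R, hR, h1, h2⟩ := decomp hG hGe hP
      have hp := Nn_pos hDp P
      have hr := Nn_pos hDp R
      have hb : Nn (P - e • G) ≤ Nn P ^ 2 * K := by
        have b0 := N_add_le P G
        have b1 := N_add_le P (-G)
        rw [Nn_neg] at b1
        have hsq : 0 < Nn P ^ 2 := by positivity
        have hgn := Nn_pos hDp G
        rcases he with rfl | rfl | rfl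
        · rw [zero_zsmul, sub_zero]
          nlinarith
        · rw [one_zsmul, sub_eq_add_neg]
          nlinarith
        · rw [neg_zsmul, one_zsmul, sub_neg_eq_add]
          nlinarith
      have hlt : Nn R < Nn P := by
        by_contra hc
        push Not at hc
        have : Nn P ^ 9 ≤ Nn R ^ 9 := pow_le_pow_left₀ hp.le hc 9
        have h3 : Nn P ^ 9 ≤ C * Nn P ^ 2 := by nlinarith
        have h4 : C * Nn P ^ 2 < Nn P * Nn P ^ 2 := by
          apply mul_lt_mul_of_pos_right hle; positivity
        have h5 : Nn P ^ 3 ≤ Nn P ^ 9 := pow_le_pow_right₀ (by omega) (by norm_num)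
        nlinarith
      have hRm := ih (Nn R).toNat (by omega) R hR rfl
      rw [h1]
      have hGm : G ∈ AddSubgroup.closure ({P | P ∈ Gam D ∧ Nn P ≤ C} ∪ {G}) :=
        AddSubgroup.subset_closure (Set.mem_union_right _ (Set.mem_singleton G))
      exact add_mem (AddSubgroup.zsmul_mem _ hGm _) (add_mem (add_mem hRm hRm) hRm)
    intro P hP
    exact key _ P hP rfl

theorem cyc {G : Pt D} (hG : G ∈ Gam D) (hGe : ¬ Od G) : ∃ G' ∈ Gam D, ∀ P ∈ Gam D, ∃ n : ℤ, P = n • G' := by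
  obtain ⟨S, hS, hcl⟩ := fg hG hGe
  have : Module.Finite ℤ (Gam D) := by
    rw [Module.Finite.iff_addGroup_fg, AddGroup.fg_iff_addSubgroup_fg, AddSubgroup.fg_iff]
    exact ⟨S, hcl, hS⟩
  have : IsAddTorsionFree (Gam D) := by
    constructor
    intro n hn P Q hPQ
    simp only at hPQ
    have : n • (P - Q) = 0 := by rw [nsmul_sub, hPQ, sub_self]
    have h0 : ((P - Q : Gam D) : Pt D) = 0 := by
      apply tors (P - Q).2 n hn
      have := congrArg Subtype.val this
      simpa using this
    exact sub_eq_zero.mp (Subtype.ext h0)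
  obtain ⟨r, b⟩ : Σ n : ℕ, Module.Basis (Fin n) ℤ (Gam D) := Module.basisOfFiniteTypeTorsionFree'
  have dec : ∀ P : Gam D, ∃ e : ℤ, ∃ R : Gam D, P = e • (⟨G, hG⟩ : Gam D) + (3:ℤ) • R := by
    rintro ⟨P, hP⟩
    obtain ⟨e, -, R, hR, h1, -⟩ := decomp hG hGe hP
    refine ⟨e, ⟨R, hR⟩, Subtype.ext ?_⟩
    simp only [AddSubgroup.coe_add, AddSubgroup.coe_zsmul]
    rw [h1, show (3:ℤ) = 1 + 1 + 1 from rfl]; simp only [add_zsmul, one_zsmul]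
  have hr : r ≤ 1 := by
    by_contra hr
    push Not at hr
    set i : Fin r := ⟨0, by omega⟩
    set j : Fin r := ⟨1, by omega⟩
    have hij : i ≠ j := by simp [i, j]
    obtain ⟨e, R, h⟩ := dec (b i)
    obtain ⟨e', R', h'⟩ := dec (b j)
    have t1 := congrArg (fun v => b.repr v i) h
    have t2 := congrArg (fun v => b.repr v j) h
    have t4 := congrArg (fun v => b.repr v j) h'
    simp [Finsupp.single_apply, hij, hij.symm] at t1 t2 t4
    generalize b.repr R i = u at *
    generalize b.repr R j = u2 at *
    generalize b.repr R' j = u4 at *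
    generalize b.repr ⟨G, hG⟩ i = c at *
    generalize b.repr ⟨G, hG⟩ j = c' at *
    have : (3:ℤ) ∣ 1 := ⟨-u2 * c * e' + u * e' * c' + u4 * e * c + 3 * u * u4, by
      linear_combination t1 + (e * c + 3 * u) * t4 - c * e' * t2⟩
    omega
  interval_cases r
  · refine ⟨0, zero_mem _, fun P hP => ⟨0, ?_⟩⟩
    have := b.ext_elem (x := ⟨P, hP⟩) (y := 0) (fun i => i.elim0)
    have := congrArg Subtype.val this
    simpa using this
  · refine ⟨b 0, (b 0).2, fun P hP => ⟨b.repr ⟨P, hP⟩ 0, ?_⟩⟩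
    have := b.sum_repr ⟨P, hP⟩
    simp at this
    have := congrArg Subtype.val this
    simpa using this.symm
end

section
set_option linter.unusedSectionVars false
variable {D : ℤ} [hGD : GD D]

/-- `g` generates `G0` modulo `3 G0` -/
def Gen (g : Pt D) : Prop := g ∈ G0 D ∧ ∀ R ∈ G0 D, ∃ e : ℤ, (e = 0 ∨ e = 1 ∨ e = -1) ∧
  ∃ R' ∈ G0 D, R = e • g + (3:ℕ) • R'

theorem three_smul' (R : Pt D) : (3:ℕ) • R = R + R + R := by
  have := smul_three R 0
  simpa using this

theorem mem_G0_of_three {R : Pt D} (h : R ∈ Gam D) (h3 : (3:ℕ) • R ∈ G0 D) : R ∈ G0 D := by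
  have h2 := two_mem_G0 h
  rw [three_smul'] at h3
  have := sub_mem h3 h2
  simpa using this

theorem gen_of {G g T : Pt D} (hG : G ∈ Gam D) (hGe : ¬ Od G) (hg : g ∈ G0 D) (hT : T ∈ Gam D) (s : ℤ)
    (hs : s = 1 ∨ s = -1) (h : G = s • g + (3:ℕ) • T) : Gen g := by
  refine ⟨hg, fun R hR => ?_⟩
  obtain ⟨e, he, R', hR', h1, -⟩ := decomp hG hGe hR.1
  have key : R = (e * s) • g + (3:ℕ) • (e • T + R') := by
    rw [h1, h, three_smul', three_smul']; simp only [zsmul_add, mul_zsmul]; abel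
  have h3 : (3:ℕ) • (e • T + R') ∈ G0 D := by
    have : (3:ℕ) • (e • T + R') = R - (e * s) • g := by rw [key]; abel
    rw [this]; exact sub_mem hR (zsmul_mem hg _)
  refine ⟨e * s, ?_, e • T + R', mem_G0_of_three (add_mem (zsmul_mem hT _) hR') h3, key⟩
  rcases he with rfl | rfl | rfl <;> rcases hs with rfl | rfl <;> simp

theorem pow_form {g R : Pt D} (hg : Gen g) (hR : R ∈ G0 D) (h0 : R ≠ 0) : ∃ k : ℕ, ∃ e : ℤ, (e = 1 ∨ e = -1) ∧
    ∃ R' ∈ G0 D, R = (3 ^ k : ℕ) • (e • g + (3:ℕ) • R') := by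
  by_contra hc
  apply h0
  have : ∀ k : ℕ, ∃ R' ∈ G0 D, R = (3 ^ k : ℕ) • R' := by
    intro k
    induction k with
    | zero => exact ⟨R, hR, by simp⟩
    | succ k ih =>
      obtain ⟨R', h1, h2⟩ := ih
      obtain ⟨e, he, R'', h3, h4⟩ := hg.2 R' h1
      rcases he with rfl | he
      · refine ⟨R'', h3, ?_⟩
        rw [h2, h4, zero_zsmul, zero_add, ← mul_nsmul', pow_succ]
      · exact absurd ⟨k, e, he, R'', h3, by rw [h2, h4]⟩ hc
  apply inf3
  intro k
  obtain ⟨R', h1, h2⟩ := this k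
  exact ⟨R', h1.1, h2⟩

def Hyp (B : Pt D) (i m : ℕ) : Prop := ∀ R ∈ G0 D, (3:ℤ) ^ m ∣ Hh (B + (3 ^ i : ℕ) • R) - 1

def Sk (g B : Pt D) (i m : ℕ) (c : ℤ → ℤ) : Prop := ∀ e : ℤ, (e = 0 ∨ e = 1 ∨ e = -1) → ∀ R ∈ G0 D,
  (3:ℤ) ^ (m + 1) ∣ Hh (B + (3 ^ i : ℕ) • (e • g + (3:ℕ) • R)) - (1 + c e * 3 ^ m)

theorem sk_alg {t x y c d : ℤ} (ht : 3 ∣ t) (hx : 3 ∣ x - c) (hy : 3 ∣ y - d) :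
    9 * t ∣ (1 + t * x) ^ 6 * (1 + t * y) ^ 3 - (1 + (d - c) * (3 * t)) := by
  obtain ⟨s, rfl⟩ := ht
  obtain ⟨u, hu⟩ := hx
  obtain ⟨v, hv⟩ := hy
  obtain rfl : x = c + 3 * u := by linarith
  obtain rfl : y = d + 3 * v := by linarith
  have a : ∃ A, (1 + 3 * s * (c + 3 * u)) ^ 6 = 1 + 18 * s * c + 9 * (3 * s) * A := by
    generalize hw : c + 3 * u = w
    obtain rfl : c = w - 3 * u := by linarith
    refine ⟨2 * u + 5 * s * w ^ 2 + 20 * s ^ 2 * w ^ 3 + 45 * s ^ 3 * w ^ 4 + 54 * s ^ 4 * w ^ 5 + 27 * s ^ 5 * w ^ 6, by ring⟩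
  have b : ∃ B, (1 + 3 * s * (d + 3 * v)) ^ 3 = 1 + 9 * s * d + 9 * (3 * s) * B := by
    generalize hw : d + 3 * v = w
    obtain rfl : d = w - 3 * v := by linarith
    refine ⟨v + s * w ^ 2 + s ^ 2 * w ^ 3, by ring⟩
  obtain ⟨A, hA⟩ := a
  obtain ⟨B, hB⟩ := b
  rw [hA, hB]
  refine ⟨A + B + c + 6 * s * c * d + 18 * s * c * B + 9 * s * d * A + 27 * s * A * B, by ring⟩

theorem Sk_step {g B : Pt D} {i m : ℕ} {c : ℤ → ℤ} (hg : g ∈ G0 D) (hB : Hh B = 1) (hi : 1 ≤ i) (hm : 1 ≤ m)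
    (him : m + 2 ≤ 3 * i) (h : Sk g B i m c) : Sk g B (i + 1) (m + 1) (fun e => c (-e) - c e) := by
  intro e he R hR
  set r := e • g + (3:ℕ) • R with hr
  have hrm : r ∈ G0 D := add_mem (zsmul_mem hg _) (nsmul_mem hR _)
  have T := lemT (P := B) p3 (by norm_num) hi (good_pow hrm i hi) (E3_pow hrm i) (by rw [hB]; norm_num)
  rw [hB, ← smul_three] at T
  have u := h e he R hR
  have v := h (-e) (by omega) (-R) (neg_mem hR)
  rw [← hr] at u
  rw [show (-e) • g + (3:ℕ) • (-R) = -r by rw [hr]; simp [add_comm], neg_nsmul, ← sub_eq_add_neg] at v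
  have T' : (3:ℤ) ^ (m + 2) ∣ 1 ^ 8 * Hh (B + (3 ^ (i + 1) : ℕ) • r) - Hh (B + (3 ^ i : ℕ) • r) ^ 6 * Hh (B - (3 ^ i : ℕ) • r) ^ 3 :=
    (pow_dvd_pow 3 him).trans T
  obtain ⟨x, hx⟩ := u
  obtain ⟨y, hy⟩ := v
  have ex : Hh (B + (3 ^ i : ℕ) • r) = 1 + 3 ^ m * (c e + 3 * x) := by rw [pow_succ] at hx; linarith
  have ey : Hh (B - (3 ^ i : ℕ) • r) = 1 + 3 ^ m * (c (-e) + 3 * y) := by rw [pow_succ] at hy; linarith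
  rw [ex, ey] at T'
  have K := sk_alg (t := 3 ^ m) (x := c e + 3 * x) (y := c (-e) + 3 * y) (c := c e) (d := c (-e))
    (dvd_pow_self 3 (by omega)) ⟨x, by ring⟩ ⟨y, by ring⟩
  rw [show (9:ℤ) * 3 ^ m = 3 ^ (m + 2) by ring] at K
  have := dvd_add T' K
  rw [show m + 1 + 1 = m + 2 by ring]
  refine this.trans (dvd_of_eq ?_)
  ring

theorem Sk_end {g B : Pt D} (hg : Gen g) (hB : Hh B = 1) (k : ℕ) : ∀ {i m : ℕ} {c : ℤ → ℤ}, 1 ≤ i → 1 ≤ m →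
    m + 2 ≤ 3 * i → Sk g B i m c → ¬ 3 ∣ c 1 → ¬ 3 ∣ c (-1) → ¬ 3 ∣ c (-1) - c 1 →
    ∀ e : ℤ, (e = 1 ∨ e = -1) → ∀ R ∈ G0 D, Hh (B + (3 ^ i : ℕ) • (3 ^ k : ℕ) • (e • g + (3:ℕ) • R)) ≠ 1 := by
  induction k with
  | zero =>
    intro i m c hi hm him h h1 h2 h3 e he R hR hh
    rw [pow_zero, one_smul] at hh
    have := h e (Or.inr he) R hR
    rw [hh, pow_succ] at this
    have h4 : (3:ℤ) ^ m * 3 ∣ 3 ^ m * (- c e) := by convert this using 1; ring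
    have := (mul_dvd_mul_iff_left (by positivity)).mp h4
    rw [dvd_neg] at this
    rcases he with rfl | rfl
    · exact h1 this
    · exact h2 this
  | succ k ih =>
    intro i m c hi hm him h h1 h2 h3 e he R hR
    have := ih (by omega) (by omega) (by omega) (Sk_step hg.1 hB hi hm him h) (by simpa using h3)
      (by simp only [neg_neg]; omega) (by simp only [neg_neg]; omega) e he R hR
    rw [← mul_nsmul', show 3 ^ (i + 1) * 3 ^ k = 3 ^ i * 3 ^ (k + 1) by ring] at this
    rw [← mul_nsmul']
    exact this

theorem Sk_fin {g B : Pt D} (hg : Gen g) (hB : Hh B = 1) {i m : ℕ} {c : ℤ → ℤ} (hi : 1 ≤ i) (hm : 1 ≤ m)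
    (him : m + 2 ≤ 3 * i) (h : Sk g B i m c) (h1 : ¬ 3 ∣ c 1) (h2 : ¬ 3 ∣ c (-1)) (h3 : ¬ 3 ∣ c (-1) - c 1)
    {R : Pt D} (hR : R ∈ G0 D) (hH : Hh (B + (3 ^ i : ℕ) • R) = 1) : R = 0 := by
  by_contra h0
  obtain ⟨k, e, he, R', hR', rfl⟩ := pow_form hg hR h0
  exact Sk_end hg hB k hi hm him h h1 h2 h3 e he R' hR' hH

theorem Kstep {B : Pt D} {i m n : ℕ} (hi : 1 ≤ i) (hm : 1 ≤ m) (hn : n ≤ m + 1) (hn3 : n ≤ 3 * i) (h : Hyp B i m)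
    {r R : Pt D} (hr : r ∈ G0 D) (hR : R ∈ G0 D) :
    (3:ℤ) ^ n ∣ Hh (B + (3 ^ i : ℕ) • (r + (3:ℕ) • R)) - Hh (B + (3 ^ i : ℕ) • r) := by
  have h0 := h r hr
  have h1 := h (r + R) (add_mem hr hR)
  have h2 := h (r - R) (sub_mem hr hR)
  have hnd : ¬ (3:ℤ) ∣ Hh (B + (3 ^ i : ℕ) • r) := by
    have := (dvd_pow_self (3:ℤ) (by omega : m ≠ 0)).trans h0
    omega
  have T := lemT (P := B + (3 ^ i : ℕ) • r) p3 (by norm_num) hi (good_pow hR i hi) (E3_pow hR i) hnd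
  have e1 : B + (3 ^ i : ℕ) • r + (3 ^ i : ℕ) • R = B + (3 ^ i : ℕ) • (r + R) := by rw [nsmul_add]; abel
  have e2 : B + (3 ^ i : ℕ) • r - (3 ^ i : ℕ) • R = B + (3 ^ i : ℕ) • (r - R) := by rw [nsmul_sub]; abel
  have e3 : B + (3 ^ i : ℕ) • r + ((3 ^ i : ℕ) • R + (3 ^ i : ℕ) • R + (3 ^ i : ℕ) • R) =
      B + (3 ^ i : ℕ) • (r + (3:ℕ) • R) := by rw [three_smul']; simp only [nsmul_add]; abel
  rw [e1, e2, e3] at T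
  have cub : ∀ a : ℤ, (3:ℤ) ^ m ∣ a - 1 → (3:ℤ) ^ (m + 1) ∣ a ^ 3 - 1 := by
    rintro a ⟨x, hx⟩
    obtain ⟨k, rfl⟩ := Nat.exists_eq_add_of_le' hm
    obtain rfl : a = 1 + 3 ^ (k + 1) * x := by linarith
    refine ⟨x + 3 * 3 ^ k * x ^ 2 + 3 * (3 ^ k) ^ 2 * x ^ 3, by ring⟩
  have T' := (pow_dvd_pow 3 hn3).trans T
  have c0 := (pow_dvd_pow 3 hn).trans (cub _ h0)
  have c1 := (pow_dvd_pow 3 hn).trans (cub _ h1)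
  have c2 := (pow_dvd_pow 3 hn).trans (cub _ h2)
  generalize Hh (B + (3 ^ i : ℕ) • r) = a at *
  generalize Hh (B + (3 ^ i : ℕ) • (r + R)) = b at *
  generalize Hh (B + (3 ^ i : ℕ) • (r - R)) = c at *
  generalize Hh (B + (3 ^ i : ℕ) • (r + (3:ℕ) • R)) = w at *
  apply pcancel p3 n (a := a ^ 8) (fun h => hnd (p3.dvd_of_dvd_pow h))
  have : a ^ 8 * (w - a) = (a ^ 8 * w - b ^ 6 * c ^ 3) + (b ^ 3 - 1) * ((b ^ 3 + 1) * c ^ 3) + (c ^ 3 - 1)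
    - (a ^ 3 - 1) * (a ^ 6 + a ^ 3 + 1) := by ring
  rw [this]
  exact dvd_sub (dvd_add (dvd_add T' (c1.mul_right _)) c2) (c0.mul_right _)

theorem Hyp_one {B : Pt D} (hB : Hh B = 1) : Hyp B 1 1 := by
  intro R hR
  have h := (X_const (P := B) p3 (by norm_num) (le_refl 1) (E3_pow hR 1) (by rw [hB]; norm_num)).1
  by_cases h0 : B + (3 ^ 1 : ℕ) • R = 0
  · rw [h0] at h; simp at h
  obtain ⟨z, M, -, hz, -, -⟩ := rep _ h0
  rw [hz] at h ⊢
  have h' : ¬ (3:ℤ) ∣ z := fun hh => h (hh.trans (dvd_pow_self _ (by norm_num)))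
  rw [pow_one]
  have : (3:ℤ) ∣ (z - 1) * (z + 1) := by
    rcases (by omega : z % 3 = 1 ∨ z % 3 = 2) with h | h
    · exact Dvd.dvd.mul_right (by omega) _
    · exact Dvd.dvd.mul_left (by omega) _
  convert this using 1; ring

theorem Hyp_up {B : Pt D} {i m : ℕ} (hi : 1 ≤ i) (hm : 1 ≤ m) (him : m + 1 ≤ 3 * i) (hB : Hh B = 1) (h : Hyp B i m) :
    Hyp B (i + 1) (m + 1) := by
  intro R hR
  have := Kstep hi hm le_rfl him h (zero_mem _) hR
  rw [nsmul_zero, add_zero, hB, zero_add, ← mul_nsmul', ← pow_succ] at this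
  exact this

theorem Sk_of {g B : Pt D} {i m : ℕ} (hg : g ∈ G0 D) (hi : 1 ≤ i) (hm : 1 ≤ m) (him : m + 1 ≤ 3 * i) (hB : Hh B = 1) (h : Hyp B i m)
    (c : ℤ → ℤ) (c0 : c 0 = 0) (h1 : (3:ℤ) ^ (m + 1) ∣ Hh (B + (3 ^ i : ℕ) • g) - (1 + c 1 * 3 ^ m))
    (h2 : (3:ℤ) ^ (m + 1) ∣ Hh (B - (3 ^ i : ℕ) • g) - (1 + c (-1) * 3 ^ m)) : Sk g B i m c := by
  intro e he R hR
  have K := Kstep hi hm le_rfl him h (zsmul_mem hg e) hR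
  have L : (3:ℤ) ^ (m + 1) ∣ Hh (B + (3 ^ i : ℕ) • e • g) - (1 + c e * 3 ^ m) := by
    rcases he with rfl | rfl | rfl
    · simp [hB, c0]
    · simpa using h1
    · simpa [sub_eq_add_neg] using h2
  exact (dvd_add K L).trans (dvd_of_eq (by ring))

/-- cube residue obstruction -/
theorem cube_obs {p : ℤ} (hp : Prime p) (h2 : ¬ p ∣ 2) {P Q : Pt D} (hG : Good Q) (hQ : p ∣ Hh Q) (hP : ¬ p ∣ Hh P)
    (h : Hh (P + (3:ℕ) • Q) = 1) : ∃ u : ℤ, p ∣ Hh P ^ 8 - u ^ 3 := by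
  have hQ2 : p ^ (2 * 1) ∣ Hh Q := by
    by_cases h0 : Q = 0
    · rw [h0]; simp
    obtain ⟨z, M, -, hz, -, -⟩ := rep _ h0
    rw [hz] at hQ ⊢
    exact pow_dvd_pow_of_dvd (hp.dvd_of_dvd_pow hQ) 2
  have T := lemT hp h2 le_rfl hG hQ2 hP
  rw [← three_smul', h] at T
  refine ⟨Hh (P + Q) ^ 2 * Hh (P - Q), (dvd_pow_self p (by norm_num)).trans (T.trans (by rw [mul_one]; apply dvd_of_eq; ring))⟩
end

section
set_option linter.unusedSectionVars false
variable {D : ℤ} [hGD : GD D]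

/-- the abscissa of P is n / h in lowest terms -/
def At (P : Pt D) (n h : ℤ) : Prop := Nn P = n ∧ Hh P = h

theorem At_add {P Q : Pt D} {n1 h1 n2 h2 n3 h3 n h : ℤ} (a1 : At P n1 h1) (a2 : At Q n2 h2) (a3 : At (P - Q) n3 h3)
    (hn : 0 < n) (hc : IsCoprime n h) (h0 : (n1 * h2 - n2 * h1) * h3 ≠ 0)
    (he : fa n1 h1 n2 h2 * h3 * n = (fb D n1 h1 n2 h2 * h3 - n3 * fa n1 h1 n2 h2) * h) : At (P + Q) n h := by
  obtain ⟨g, g0, e1, e2, -⟩ := FF P Q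
  rw [a1.1, a1.2, a2.1, a2.2, a3.1, a3.2] at e2
  rw [a1.1, a1.2, a2.1, a2.2, a3.2] at e1
  have hne : fa n1 h1 n2 h2 * h3 ≠ 0 := by
    simp only [fa]
    have := mul_ne_zero_iff.mp h0
    exact mul_ne_zero (pow_ne_zero _ this.1) this.2
  have k : fa n1 h1 n2 h2 * h3 * (Nn (P + Q) * h) = fa n1 h1 n2 h2 * h3 * (n * Hh (P + Q)) := by
    have k1 : fa n1 h1 n2 h2 * h3 * Nn (P + Q) = Hh (P + Q) * (fb D n1 h1 n2 h2 * h3 - n3 * fa n1 h1 n2 h2) := by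
      rw [e1, e2]; ring
    linear_combination h * k1 - Hh (P + Q) * he
  exact ratio_eq (cop _) hc (Nn_pos GD.pos _) hn (mul_left_cancel₀ hne k)

theorem At_dbl {P : Pt D} {n1 h1 n h : ℤ} (a1 : At P n1 h1)
    (hn : 0 < n) (hc : IsCoprime n h)
    (he : 4 * h1 * (n1 ^ 3 - D * h1 ^ 3) * n = (n1 ^ 4 + 8 * D * n1 * h1 ^ 3) * h) : At (P + P) n h := by
  obtain ⟨g, g0, -, e1, e2⟩ := dbl P
  rw [a1.1, a1.2] at e1 e2
  refine ratio_eq (cop _) hc (Nn_pos GD.pos _) hn ?_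
  apply mul_left_cancel₀ g0.ne'
  linear_combination n * e1 - h * e2 - he

theorem ch {G : Pt D} (a b c d : ℤ) (hc' : a + b = c) (hd : a - b = d) {n1 h1 n2 h2 n3 h3 n h : ℤ} (a1 : At (a • G) n1 h1) (a2 : At (b • G) n2 h2)
    (a3 : At (d • G) n3 h3)
    (hn : 0 < n) (hc : Int.gcd n h = 1) (h0 : (n1 * h2 - n2 * h1) * h3 ≠ 0)
    (he : fa n1 h1 n2 h2 * h3 * n = (fb D n1 h1 n2 h2 * h3 - n3 * fa n1 h1 n2 h2) * h) : At (c • G) n h := by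
  rw [← hc', add_zsmul]
  refine At_add a1 a2 ?_ hn (Int.isCoprime_iff_gcd_eq_one.mpr hc) h0 he
  rw [sub_eq_add_neg, ← sub_zsmul, hd]; exact a3

theorem chd {G : Pt D} (a c : ℤ) (hc' : a + a = c) {n1 h1 n h : ℤ} (a1 : At (a • G) n1 h1)
    (hn : 0 < n) (hc : Int.gcd n h = 1)
    (he : 4 * h1 * (n1 ^ 3 - D * h1 ^ 3) * n = (n1 ^ 4 + 8 * D * n1 * h1 ^ 3) * h) : At (c • G) n h := by
  rw [← hc', add_zsmul]
  exact At_dbl a1 hn (Int.isCoprime_iff_gcd_eq_one.mpr hc) he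

theorem idx2 {G A B : Pt D} (hG : G ∈ Gam D) (hGe : ¬ Od G) (hA : A ∈ Gam D) (hB : B ∈ Gam D)
    (hA' : A ∉ G0 D) (hB' : B ∉ G0 D) : A + B ∈ G0 D := by
  obtain ⟨G', h1, h2⟩ := cyc hG hGe
  obtain ⟨n, rfl⟩ := h2 A hA
  obtain ⟨m, rfl⟩ := h2 B hB
  have ev : ∀ k : ℤ, k % 2 = 0 → k • G' ∈ G0 D := by
    intro k hk
    obtain ⟨j, rfl⟩ : ∃ j, k = j + j := ⟨k / 2, by omega⟩
    rw [add_zsmul]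
    exact two_mem_G0 (zsmul_mem h1 j)
  have hn : n % 2 ≠ 0 := fun h => hA' (ev n h)
  have hm : m % 2 ≠ 0 := fun h => hB' (ev m h)
  rw [← add_zsmul]
  exact ev _ (by omega)

theorem G0_eq {G : Pt D} (hG : G ∈ G0 D) (hGe : ¬ Od G) (hno : ∀ R : Pt D, R + R ≠ G) {P : Pt D} (hP : P ∈ Gam D) :
    P ∈ G0 D := by
  obtain ⟨G', h1, h2⟩ := cyc hG.1 hGe
  obtain ⟨n, hn⟩ := h2 G hG.1
  have hodd : n % 2 = 1 := by
    by_contra h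
    obtain ⟨j, rfl⟩ : ∃ j, n = j + j := ⟨n / 2, by omega⟩
    rw [add_zsmul] at hn
    exact hno _ hn.symm
  have hG' : G' ∈ G0 D := by
    obtain ⟨j, rfl⟩ : ∃ j, n = (j + j) + 1 := ⟨n / 2, by omega⟩
    rw [add_zsmul, add_zsmul, one_zsmul] at hn
    have : G' = G - (j • G' + j • G') := by rw [hn]; abel
    rw [this]
    exact sub_mem hG (two_mem_G0 (zsmul_mem h1 j))
  obtain ⟨m, rfl⟩ := h2 P hP
  exact zsmul_mem hG' m

theorem Od_nsmul {R : Pt D} (h : Od R) (n : ℕ) : Od (n • R) := by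
  induction n with
  | zero => simpa using Od_zero
  | succ n ih => rw [succ_nsmul]; exact Od_add ih h

theorem spart {G : Pt D} (hG : G ∈ Gam D) (hGe : ¬ Od G) (h5 : ¬ (5:ℤ) ∣ Hh G) (h11 : ¬ (11:ℤ) ∣ Hh G)
    (L : Pt D → Prop) (hI : ∀ P ∈ Gam D, ¬ Od P → Hh P = 1 → L P)
    (n5 : ∀ R, L R → ∃ q : ℤ, Prime q ∧ q ∣ Hh ((5:ℕ) • R) ∧ ¬ q ∣ 5 ∧ ¬ q ∣ 11)
    (n11 : ∀ R, L R → ∃ q : ℤ, Prime q ∧ q ∣ Hh ((11:ℕ) • R) ∧ ¬ q ∣ 5 ∧ ¬ q ∣ 11)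
    {P : Pt D} (hP : P ∈ Gam D) (hPe : ¬ Od P) (hS : ∀ q : ℤ, Prime q → q ∣ Hh P → q ∣ 5 ∨ q ∣ 11) :
    L P ∧ Hh P = 1 := by
  obtain ⟨G', h1, h2⟩ := cyc hG hGe
  obtain ⟨k, rfl⟩ := h2 G hG
  have key : ∀ N : ℕ, ∀ n : ℤ, n.natAbs = N → ¬ Od (n • G') → (∀ q : ℤ, Prime q → q ∣ Hh (n • G') → q ∣ 5 ∨ q ∣ 11) →
      L (n • G') ∧ Hh (n • G') = 1 := by
    intro N
    induction N using Nat.strong_induction_on with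
    | _ N ih =>
    intro n hnN hOd hS
    have hn0 : n ≠ 0 := by rintro rfl; rw [zero_zsmul] at hOd; exact hOd Od_zero
    have red : ∀ p : ℕ, 2 ≤ p → (p:ℤ) ∣ n → ∃ R : Pt D, L R ∧ n • G' = p • R := by
      rintro p hp ⟨m, rfl⟩
      have e : ((p:ℤ) * m) • G' = p • (m • G') := by rw [mul_zsmul, natCast_zsmul]
      refine ⟨m • G', ?_, e⟩
      rw [e] at hOd hS
      refine (ih m.natAbs ?_ m rfl (fun h => hOd (Od_nsmul h p)) ?_).1
      · rw [← hnN, Int.natAbs_mul, Int.natAbs_natCast]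
        have : 0 < m.natAbs := by
          rw [Int.natAbs_pos]; rintro rfl; simp at hn0
        nlinarith
      · intro q hq hd
        exact hS q hq (E1_nsmul hq _ hd p)
    have no5 : ¬ (5:ℤ) ∣ Hh (n • G') := by
      intro h
      have : Fact (Nat.Prime 5) := ⟨by norm_num⟩
      have := theta 5 (by exact_mod_cast GD.five) (G' := G') (by exact_mod_cast h1.1) n k (by exact_mod_cast h) (by exact_mod_cast h5)
      obtain ⟨R, hR, e⟩ := red 5 (by norm_num) this
      obtain ⟨q, hq, hd, q5, q11⟩ := n5 R hR
      rw [← e] at hd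
      rcases hS q hq hd with h | h
      · exact q5 h
      · exact q11 h
    have no11 : ¬ (11:ℤ) ∣ Hh (n • G') := by
      intro h
      have : Fact (Nat.Prime 11) := ⟨by norm_num⟩
      have := theta 11 (by exact_mod_cast GD.eleven) (G' := G') (by exact_mod_cast h1.2) n k (by exact_mod_cast h) (by exact_mod_cast h11)
      obtain ⟨R, hR, e⟩ := red 11 (by norm_num) this
      obtain ⟨q, hq, hd, q5, q11⟩ := n11 R hR
      rw [← e] at hd
      rcases hS q hq hd with h | h
      · exact q5 h
      · exact q11 h
    have hH0 : Hh (n • G') ≠ 0 := by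
      intro h
      rw [Hh_eq_zero] at h
      rw [h] at hOd; exact hOd Od_zero
    have hu : IsUnit (Hh (n • G')) := by
      by_contra hu
      obtain ⟨p, hp, h⟩ := WfDvdMonoid.exists_irreducible_factor hu hH0
      have hp := hp.prime
      rcases hS p hp h with h' | h'
      · exact no5 (((hp.dvd_prime_iff_associated p5).mp h').dvd_iff_dvd_left.mp h)
      · exact no11 (((hp.dvd_prime_iff_associated p11).mp h').dvd_iff_dvd_left.mp h)
    have hH1 : Hh (n • G') = 1 := by
      have := Hh_nonneg (n • G')
      rcases Int.isUnit_iff.mp hu with h | h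
      · exact h
      · omega
    exact ⟨hI _ (zsmul_mem h1 n) hOd hH1, hH1⟩
  obtain ⟨n, rfl⟩ := h2 P hP
  exact key _ n rfl hPe hS

/-- even points are ±(G+3R) -/
theorem even_form {G P : Pt D} (hG : G ∈ Gam D) (hGe : ¬ Od G) (hP : P ∈ Gam D) (hPe : ¬ Od P) :
    ∃ R ∈ Gam D, P = G + (3:ℕ) • R ∨ -P = G + (3:ℕ) • R := by
  obtain ⟨e, he, R, hR, h, -⟩ := decomp hG hGe hP
  rw [← three_smul'] at h
  rcases he with rfl | rfl | rfl
  · rw [zero_zsmul, zero_add, three_smul'] at h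
    rw [h] at hPe; exact absurd (Od_three R) hPe
  · exact ⟨R, hR, Or.inl (by simpa using h)⟩
  · exact ⟨-R, neg_mem hR, Or.inr (by rw [h]; simp [add_comm])⟩

/-- D ≡ 7 mod 9: everything is nonsingular at 3 -/
theorem G0_of_seven (h7 : D % 9 = 7) {P : Pt D} (hP : P ∈ Gam D) : P ∈ G0 D := by
  refine ⟨hP, fun h => ?_⟩
  by_cases h0 : P = 0
  · rw [h0] at h; simp at h
  obtain ⟨z, M, z0, hz, hM, hc⟩ := rep P h0
  rw [hz] at h
  have hz3 : z % 3 ≠ 0 := by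
    intro h3
    have h3 : (3:ℤ) ∣ z := by omega
    have : (3:ℤ) ∣ Nn P := by
      have := dvd_add h ((dvd_pow h3 two_ne_zero).mul_left D)
      simpa using this
    exact p3.not_isUnit (hc.isUnit_of_dvd' this h3)
  have hD : D = 9 * (D / 9) + 7 := by omega
  generalize D / 9 = d at hD
  generalize Nn P = n at *
  have hn : n % 3 = 1 := by
    have : (z ^ 2) % 3 = 1 := by
      rcases (by omega : z % 3 = 1 ∨ z % 3 = 2) with h | h <;> simp [pow_two, Int.mul_emod, h]
    obtain ⟨s, hs⟩ := h
    have e : z ^ 2 = 3 * (z ^ 2 / 3) + 1 := by omega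
    generalize z ^ 2 / 3 = w at e
    rw [e, hD] at hs
    have : n = 3 * (s + 9 * d * w + 3 * d + 7 * w + 2) + 1 := by linarith
    omega
  have f : ∀ m n z : ZMod 9, (m ^ 2 = n ^ 3 - 7 * z ^ 6) → (n = 1 ∨ n = 4 ∨ n = 7) → (z = 0 ∨ z = 3 ∨ z = 6) := by decide +kernel
  have g := congrArg (Int.cast : ℤ → ZMod 9) hM
  have D9 : (D : ZMod 9) = 7 := by
    rw [hD]; push_cast; rw [show (9 : ZMod 9) = 0 from rfl]; ring
  push_cast at g
  rw [D9] at g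
  have cl : ∀ a k : ℤ, (a : ZMod 9) = (k : ZMod 9) ↔ (9:ℤ) ∣ k - a := fun a k => ZMod.intCast_eq_intCast_iff_dvd_sub a k 9
  have hn' : (n : ZMod 9) = 1 ∨ (n : ZMod 9) = 4 ∨ (n : ZMod 9) = 7 := by
    have c1 := cl n 1
    have c4 := cl n 4
    have c7 := cl n 7
    push_cast at c1 c4 c7
    rw [c1, c4, c7]; omega
  have hz' := f _ _ _ g hn'
  have c1 := cl z 0
  have c4 := cl z 3
  have c7 := cl z 6
  push_cast at c1 c4 c7
  rw [c1, c4, c7] at hz'; omega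
end

section
set_option linter.unusedSectionVars false

theorem nc_of {D : ℤ} (k : ℤ) (h0 : 0 ≤ k) (h1 : k ^ 3 < D) (h2 : D < (k + 1) ^ 3) : ∀ x : ℚ, x ^ 3 ≠ D := by
  intro x hx
  have hd : x.den = 1 := by
    have : (x ^ 3).den = x.den ^ 3 := Rat.den_pow x 3
    rw [hx] at this
    simpa using this.symm
  have hx' : x = (x.num : ℚ) := by
    conv_lhs => rw [← Rat.num_div_den x, hd]
    simp
  rw [hx'] at hx
  have h : x.num ^ 3 = D := by exact_mod_cast hx
  generalize x.num = n at h
  rcases lt_or_ge k n with h3 | h3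
  · have : (k + 1) ^ 3 ≤ n ^ 3 := pow_le_pow_left₀ (by omega) (by omega) 3
    omega
  · have : n ^ 3 ≤ k ^ 3 := by
      rcases lt_or_ge n 0 with h4 | h4
      · have : n ^ 3 < 0 := Odd.pow_neg (by decide) h4
        have : 0 ≤ k ^ 3 := by positivity
        omega
      · exact pow_le_pow_left₀ h4 h3 3
    omega

instance gd55 : GD 55 := ⟨⟨0, 0, by norm_num⟩, nc_of 3 (by norm_num) (by norm_num) (by norm_num)⟩
instance gd1375 : GD 1375 := ⟨⟨1, 0, by norm_num⟩, nc_of 11 (by norm_num) (by norm_num) (by norm_num)⟩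
instance gd805255 : GD 805255 := ⟨⟨0, 2, by norm_num⟩, nc_of 93 (by norm_num) (by norm_num) (by norm_num)⟩
instance gd4159375 : GD 4159375 := ⟨⟨2, 1, by norm_num⟩, nc_of 160 (by norm_num) (by norm_num) (by norm_num)⟩
instance gd503284375 : GD 503284375 := ⟨⟨2, 2, by norm_num⟩, nc_of 795 (by norm_num) (by norm_num) (by norm_num)⟩

variable {D : ℤ} [hGD : GD D]

theorem E1_zsmul {p : ℤ} (hp : Prime p) (P : Pt D) (hP : p ∣ Hh P) (n : ℤ) : p ∣ Hh (n • P) := by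
  obtain ⟨m, rfl | rfl⟩ := n.eq_nat_or_neg
  · rw [natCast_zsmul]; exact E1_nsmul hp P hP m
  · rw [neg_zsmul, Hh_neg, natCast_zsmul]; exact E1_nsmul hp P hP m

theorem oth {H m : ℤ} (hm : m ∣ H) (h1 : 1 < m) (hc : Int.gcd m 55 = 1) : ∃ q : ℤ, Prime q ∧ q ∣ H ∧ ¬ q ∣ 5 ∧ ¬ q ∣ 11 := by
  have hu : ¬ IsUnit m := by
    rw [Int.isUnit_iff]; omega
  obtain ⟨p, hp, h⟩ := WfDvdMonoid.exists_irreducible_factor hu (by omega)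
  have hp := hp.prime
  have hc := Int.isCoprime_iff_gcd_eq_one.mpr hc
  have k : ¬ p ∣ 55 := fun h' => hp.not_isUnit (hc.isUnit_of_dvd' h h')
  exact ⟨p, hp, h.trans hm, fun h => k (h.trans ⟨11, by norm_num⟩), fun h => k (h.trans ⟨5, by norm_num⟩)⟩

theorem oth_mul {G R : Pt D} (n : ℕ) {N h : ℤ} (hA : At ((n:ℤ) • G) N h) (m : ℤ) (hm : m ∣ h) (h1 : 1 < m) (hc : Int.gcd m 55 = 1)
    (hR : ∃ j : ℤ, R = j • G) : ∃ q : ℤ, Prime q ∧ q ∣ Hh (n • R) ∧ ¬ q ∣ 5 ∧ ¬ q ∣ 11 := by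
  obtain ⟨q, hq, h2, h3⟩ := oth hm h1 hc
  obtain ⟨j, rfl⟩ := hR
  refine ⟨q, hq, ?_, h3⟩
  have : n • (j • G) = j • ((n:ℤ) • G) := by
    rw [← natCast_zsmul, ← mul_zsmul, ← mul_zsmul, mul_comm]
  rw [this]
  exact E1_zsmul hq _ (by rw [hA.2]; exact h2) j

theorem cls {g B R : Pt D} {i m n : ℕ} (hg : Gen g) (hi : 1 ≤ i) (hm : 1 ≤ m) (hn : n ≤ m + 1) (hn3 : n ≤ 3 * i) (h : Hyp B i m)
    (hR : R ∈ G0 D) :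
    ((3:ℤ) ^ n ∣ Hh (B + (3 ^ i : ℕ) • R) - Hh B ∧ ∃ R' ∈ G0 D, R = (3:ℕ) • R') ∨
    ((3:ℤ) ^ n ∣ Hh (B + (3 ^ i : ℕ) • R) - Hh (B + (3 ^ i : ℕ) • g) ∧ ∃ R' ∈ G0 D, R = g + (3:ℕ) • R') ∨
    ((3:ℤ) ^ n ∣ Hh (B + (3 ^ i : ℕ) • R) - Hh (B - (3 ^ i : ℕ) • g) ∧ ∃ R' ∈ G0 D, R = -g + (3:ℕ) • R') := by
  obtain ⟨e, he, R', hR', rfl⟩ := hg.2 R hR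
  have K := Kstep hi hm hn hn3 h (zsmul_mem hg.1 e) hR'
  rcases he with rfl | rfl | rfl
  · left; exact ⟨by simpa using K, R', hR', by simp⟩
  · right; left; exact ⟨by simpa using K, R', hR', by simp⟩
  · right; right; exact ⟨by simpa [sub_eq_add_neg] using K, R', hR', by simp⟩

theorem Hyp_cls {g B : Pt D} {i m n : ℕ} (hg : Gen g) (hi : 1 ≤ i) (hm : 1 ≤ m) (hn : n ≤ m + 1) (hn3 : n ≤ 3 * i) (h : Hyp B i m)
    (h0 : (3:ℤ) ^ n ∣ Hh B - 1) (h1 : (3:ℤ) ^ n ∣ Hh (B + (3 ^ i : ℕ) • g) - 1) (h2 : (3:ℤ) ^ n ∣ Hh (B - (3 ^ i : ℕ) • g) - 1) :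
    Hyp B i n := by
  intro R hR
  rcases cls hg hi hm hn hn3 h hR with ⟨h, -⟩ | ⟨h, -⟩ | ⟨h, -⟩
  · simpa using dvd_add h h0
  · simpa using dvd_add h h1
  · simpa using dvd_add h h2

theorem Hyp_one' {B : Pt D} (hB : ¬ (3:ℤ) ∣ Hh B) : Hyp B 1 1 := by
  intro R hR
  have h := (X_const (P := B) p3 (by norm_num) (le_refl 1) (E3_pow hR 1) hB).1
  by_cases h0 : B + (3 ^ 1 : ℕ) • R = 0
  · rw [h0] at h; simp at h
  obtain ⟨z, M, -, hz, -, -⟩ := rep _ h0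
  rw [hz] at h ⊢
  have h' : ¬ (3:ℤ) ∣ z := fun hh => h (hh.trans (dvd_pow_self _ (by norm_num)))
  rw [pow_one]
  have : (3:ℤ) ∣ (z - 1) * (z + 1) := by
    rcases (by omega : z % 3 = 1 ∨ z % 3 = 2) with h | h
    · exact Dvd.dvd.mul_right (by omega) _
    · exact Dvd.dvd.mul_left (by omega) _
  convert this using 1; ring

/-- projective abscissa mod p -/
def Xrel (p : ℕ) (P : Pt D) (n h : ZMod p) : Prop := ∃ u : ZMod p, u ≠ 0 ∧ (Nn P : ZMod p) = u * n ∧ (Hh P : ZMod p) = u * h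

theorem Xrel_triple (p : ℕ) [Fact p.Prime] (h6 : ¬ (p:ℤ) ∣ 2 * 3) (hD : ¬ (p:ℤ) ∣ D) {P : Pt D} (hP : P ≠ 0) {n h : ZMod p} (hr : Xrel p P n h) :
    Xrel p ((3:ℕ) • P) (n ^ 9 + 96 * D * n ^ 6 * h ^ 3 + 48 * D ^ 2 * n ^ 3 * h ^ 6 - 64 * D ^ 3 * h ^ 9)
      (9 * n ^ 2 * h * (n ^ 3 - 4 * D * h ^ 3) ^ 2) := by
  have pp : Prime (p:ℤ) := Nat.prime_iff_prime_int.mp Fact.out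
  obtain ⟨u, hu, e1, e2⟩ := hr
  obtain ⟨g, -, hg, k1, k2⟩ := triple P hP
  have hg := hg p pp (Ns_of_not pp h6 hD P)
  rw [zm] at hg
  rw [three_smul']
  have k1 := congrArg (Int.cast : ℤ → ZMod p) k1
  have k2 := congrArg (Int.cast : ℤ → ZMod p) k2
  push_cast at k1 k2
  rw [e1, e2] at k1 k2
  refine ⟨u ^ 9 / g, div_ne_zero (pow_ne_zero _ hu) hg, ?_, ?_⟩
  · field_simp; rw [mul_comm, k2]; ring
  · field_simp; rw [mul_comm, k1]; ring

theorem Xrel_start (p : ℕ) [Fact p.Prime] {P : Pt D} (hH : ¬ (p:ℤ) ∣ Hh P) :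
    ∃ x y : ZMod p, y ^ 2 = x ^ 3 - D ∧ Xrel p P x 1 := by
  have hP : P ≠ 0 := by rintro rfl; simp at hH
  obtain ⟨z, M, z0, hz, hM, -⟩ := rep P hP
  rw [zm] at hH
  have hz' : (z : ZMod p) ≠ 0 := by
    intro h; apply hH; rw [hz]; push_cast; rw [h]; simp
  refine ⟨Nn P / z ^ 2, M / z ^ 3, ?_, (Hh P : ZMod p), hH, ?_, by simp⟩
  · have := congrArg (Int.cast : ℤ → ZMod p) hM
    push_cast at this
    field_simp
    linear_combination this
  · rw [hz]; push_cast; field_simp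
end

section
set_option exponentiation.threshold 2000

theorem c1c_2 {G : Pt 55} (a1 : At ((1:ℤ) • G) 4 1) : At ((2:ℤ) • G) 56 1 :=
  chd 1 2 (by norm_num) a1 (by norm_num) (by decide +kernel) (by norm_num)

theorem c1c_3 {G : Pt 55} (a1 : At ((1:ℤ) • G) 4 1) : At ((3:ℤ) • G) 3961 676 :=
  ch 2 1 3 1 (by norm_num) (by norm_num) (c1c_2 a1) a1 a1 (by norm_num) (by decide +kernel) (by norm_num) (by norm_num [fa, fb])

theorem c1c_4 {G : Pt 55} (a1 : At ((1:ℤ) • G) 4 1) : At ((4:ℤ) • G) 2464784 175561 :=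
  chd 2 4 (by norm_num) (c1c_2 a1) (by norm_num) (by decide +kernel) (by norm_num)

theorem c1c_5 {G : Pt 55} (a1 : At ((1:ℤ) • G) 4 1) : At ((5:ℤ) • G) 13855340524 1148871025 :=
  ch 3 2 5 1 (by norm_num) (by norm_num) (c1c_3 a1) (c1c_2 a1) a1 (by norm_num) (by decide +kernel) (by norm_num) (by norm_num [fa, fb])

theorem c1c_7 {G : Pt 55} (a1 : At ((1:ℤ) • G) 4 1) : At ((7:ℤ) • G) 39244038797996970844 942446549210640769 :=
  ch 4 3 7 1 (by norm_num) (by norm_num) (c1c_4 a1) (c1c_3 a1) a1 (by norm_num) (by decide +kernel) (by norm_num) (by norm_num [fa, fb])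

theorem c1c_8 {G : Pt 55} (a1 : At ((1:ℤ) • G) 4 1) : At ((8:ℤ) • G) 10693979155560600513197024 2576594340147631317501289 :=
  ch 5 3 8 2 (by norm_num) (by norm_num) (c1c_5 a1) (c1c_3 a1) (c1c_2 a1) (by norm_num) (by decide +kernel) (by norm_num) (by norm_num [fa, fb])

theorem c1c_9 {G : Pt 55} (a1 : At ((1:ℤ) • G) 4 1) : At ((9:ℤ) • G) 87490020181775011286537986491241 39852432901859471300764533124 :=
  ch 5 4 9 1 (by norm_num) (by norm_num) (c1c_5 a1) (c1c_4 a1) a1 (by norm_num) (by decide +kernel) (by norm_num) (by norm_num [fa, fb])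

theorem c1c_11 {G : Pt 55} (a1 : At ((1:ℤ) • G) 4 1) : At ((11:ℤ) • G) 611693158044170102718128667261093537117827279764 7712877707873795338634325009829374496038263761 :=
  ch 8 3 11 5 (by norm_num) (by norm_num) (c1c_8 a1) (c1c_3 a1) (c1c_5 a1) (by norm_num) (by decide +kernel) (by norm_num) (by norm_num [fa, fb])

theorem c1c_17 {G : Pt 55} (a1 : At ((1:ℤ) • G) 4 1) : At ((17:ℤ) • G) 220120059765889196707067401379005309713474048210043674377020051326141876647223293790690109333296690778562484023164 50625049379867742627435416991159049255363039413119022930545495221710315926489507488771772212570471831644678608929 :=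
  ch 9 8 17 1 (by norm_num) (by norm_num) (c1c_9 a1) (c1c_8 a1) a1 (by norm_num) (by decide +kernel) (by norm_num) (by norm_num [fa, fb])

theorem c1c_19 {G : Pt 55} (a1 : At ((1:ℤ) • G) 4 1) : At ((19:ℤ) • G) 3158400260757160457691879962832560139961221412156124656785900507167559098933534087131910171437537123185470096886836013152523705100383846350284 825019318841263613921388298047352546685781051719740387704577749148412256907501008782348673679087262661337291624005508097842497319806104704081 :=
  ch 11 8 19 3 (by norm_num) (by norm_num) (c1c_11 a1) (c1c_8 a1) (c1c_3 a1) (by norm_num) (by decide +kernel) (by norm_num) (by norm_num [fa, fb])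

theorem c3c_2 {G : Pt 1375} (a1 : At ((1:ℤ) • G) 14 1) : At ((2:ℤ) • G) 48104 1369 :=
  chd 1 2 (by norm_num) a1 (by norm_num) (by decide +kernel) (by norm_num)

theorem c3c_3 {G : Pt 1375} (a1 : At ((1:ℤ) • G) 14 1) : At ((3:ℤ) • G) 17143793731 209351961 :=
  ch 2 1 3 1 (by norm_num) (by norm_num) (c3c_2 a1) a1 a1 (by norm_num) (by decide +kernel) (by norm_num) (by norm_num [fa, fb])

theorem c3c_4 {G : Pt 1375} (a1 : At ((1:ℤ) • G) 14 1) : At ((4:ℤ) • G) 1678052685859692464 147557025425773441 :=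
  chd 2 4 (by norm_num) (c3c_2 a1) (by norm_num) (by decide +kernel) (by norm_num)

theorem c3c_5 {G : Pt 1375} (a1 : At ((1:ℤ) • G) 14 1) : At ((5:ℤ) • G) 52355420201877982715946766934 179538209200460710372782025 :=
  ch 3 2 5 1 (by norm_num) (by norm_num) (c3c_3 a1) (c3c_2 a1) a1 (by norm_num) (by decide +kernel) (by norm_num) (by norm_num [fa, fb])

theorem c3c_8 {G : Pt 1375} (a1 : At ((1:ℤ) • G) 14 1) : At ((8:ℤ) • G) 16808062034630438404516160189645250170393446644937102152986494593909535904 45389080210164140562497456716801864582678270725793392483539414309255329 :=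
  ch 5 3 8 2 (by norm_num) (by norm_num) (c3c_5 a1) (c3c_3 a1) (c3c_2 a1) (by norm_num) (by decide +kernel) (by norm_num) (by norm_num [fa, fb])

theorem c3c_10 {G : Pt 1375} (a1 : At ((1:ℤ) • G) 14 1) : At ((10:ℤ) • G) 1879226860839710844131336512091269632893221635133405045010970444735628827804559238304120630751675306182746425624184 25764264921027746585060586553127818314425144978610111069807521400743041160409097309056208353418726467673217731225 :=
  chd 5 10 (by norm_num) (c3c_5 a1) (by norm_num) (by decide +kernel) (by norm_num)

theorem c3c_11 {G : Pt 1375} (a1 : At ((1:ℤ) • G) 14 1) : At ((11:ℤ) • G) 1590232054969982310011638958702504740878623998966250818407638126264807540691709765488965872228553405928858122762103199981370377325944599614 41836307311320420377190914347679552542130970877529143343941679153297371885429004441584248202494019303019862287498885146217246572677299521 :=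
  ch 8 3 11 5 (by norm_num) (by norm_num) (c3c_8 a1) (c3c_3 a1) (c3c_5 a1) (by norm_num) (by decide +kernel) (by norm_num) (by norm_num [fa, fb])

theorem c6c_2 {G : Pt 503284375} (a1 : At ((1:ℤ) • G) 1226 1) : At ((2:ℤ) • G) 1798862652944 1339486801 :=
  chd 1 2 (by norm_num) a1 (by norm_num) (by decide +kernel) (by norm_num)

theorem c6c_3 {G : Pt 503284375} (a1 : At ((1:ℤ) • G) 1226 1) : At ((3:ℤ) • G) 2883954572669304737571636559 6134949345794081016681 :=
  ch 2 1 3 1 (by norm_num) (by norm_num) (c6c_2 a1) a1 a1 (by norm_num) (by decide +kernel) (by norm_num) (by norm_num [fa, fb])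

theorem c6c_4 {G : Pt 503284375} (a1 : At ((1:ℤ) • G) 1226 1) : At ((4:ℤ) • G) 6969451391252267455314411424052099513758155110624 6176893654424249273349202991978492049478295209 :=
  chd 2 4 (by norm_num) (c6c_2 a1) (by norm_num) (by decide +kernel) (by norm_num)

theorem c6c_5 {G : Pt 503284375} (a1 : At ((1:ℤ) • G) 1226 1) : At ((5:ℤ) • G) 22004693861872883023537925812491987236446559294936737377895994049058699859066 14837774214988608691131390665749864140834723661973583981965705318323221025 :=
  ch 3 2 5 1 (by norm_num) (by norm_num) (c6c_3 a1) (c6c_2 a1) a1 (by norm_num) (by decide +kernel) (by norm_num) (by norm_num [fa, fb])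

theorem c6c_8 {G : Pt 503284375} (a1 : At ((1:ℤ) • G) 1226 1) : At ((8:ℤ) • G) 2243143050531108484907347527963643762256959176942664398080170895791337270551320074117874018910011323381807886113481782425306698709273776505698243077268861900190257943901041650135659364931242657344 1358411561695729987680295094544080520734252989226011972604747537287950361019295814971826963943410943066799000639515585177248521933923541392811291020278469572781421077261667078094608714050876041 :=
  ch 5 3 8 2 (by norm_num) (by norm_num) (c6c_5 a1) (c6c_3 a1) (c6c_2 a1) (by norm_num) (by decide +kernel) (by norm_num) (by norm_num [fa, fb])

theorem c6c_11 {G : Pt 503284375} (a1 : At ((1:ℤ) • G) 1226 1) : At ((11:ℤ) • G) 1904843796329283640604583221836950430939012346450478688655796827780596902459009276357756130058394900027657881670507242134295088182599248162154063850404599914448532019555650746775544572195081536264807448078856286356378246898975980788502083228217383598227698197465425864240594151767667470587942198477156080906222394643226555726089922766119657416192050652284009871606436426 1027103707453876449749039990683402116571880487203575256807023522026836597184005977437633901806769834616392387893351867166624213218879038167046650129845075199131913490311621600711185879678057938299503694973284198071242602496931649594007754793134774976709063777199585082780493326702957126852291871050633345328190195424611229829209590113647978572214019560910032068514321 :=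
  ch 8 3 11 5 (by norm_num) (by norm_num) (c6c_8 a1) (c6c_3 a1) (c6c_5 a1) (by norm_num) (by decide +kernel) (by norm_num) (by norm_num [fa, fb])

theorem c2c_2 {G : Pt 805255} (a1 : At ((1:ℤ) • G) 589274 6241) : At ((2:ℤ) • G) 260842266138977730071984 55385016478658106529 :=
  chd 1 2 (by norm_num) a1 (by norm_num) (by decide +kernel) (by norm_num)

theorem c2c_4 {G : Pt 805255} (a1 : At ((1:ℤ) • G) 589274 6241) : At ((4:ℤ) • G) 1157387129961077228034134736034838272055113649191775720514702799168915926508789522575337610144 982930554245341495966056721214258658789531051012861061456132241616954317068834779684109561 :=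
  chd 2 4 (by norm_num) (c2c_2 a1) (by norm_num) (by decide +kernel) (by norm_num)

theorem c5c_2 {G : Pt 4159375} (a1 : At ((1:ℤ) • G) 867669688560007424 297222116897161) : At ((2:ℤ) • G) 141885560131217489765910851037613144951489242793867252388645282341420544 194120671713277792005408847135232058901990134693617033170662691753489 :=
  chd 1 2 (by norm_num) a1 (by norm_num) (by decide +kernel) (by norm_num)

theorem c5c_4 {G : Pt 4159375} (a1 : At ((1:ℤ) • G) 867669688560007424 297222116897161) : At ((4:ℤ) • G) 109953437326330976955378238714826045662230018987462785507157100574951335608139252868888868895797952932022922481598220319964682626419079471434252074136661741583422725546368073583125108326180999472873462151242325941081735868573591097901368553871988665600168526549071820460076493713409024 548574337949745587706897412720267925673368010500796712065193675081618016589041010089218661701700768920449634418138548217622665487611433343864564503656620014731972297261143709815070195923515901125350072201640838101328960884174048279497264038204715704789540783249431248374472911143601 :=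
  chd 2 4 (by norm_num) (c5c_2 a1) (by norm_num) (by decide +kernel) (by norm_num)
end

section

theorem mem_Gam' {D : ℤ} [GD D] {P : Pt D} {n h : ℤ} (hA : At P n h) (h5 : ¬ (5:ℤ) ∣ n) (h11 : ¬ (11:ℤ) ∣ n) : P ∈ Gam D := by
  rw [mem_Gam, hA.1]; exact ⟨h5, h11⟩

theorem nOd' {D : ℤ} [GD D] {P : Pt D} {n h : ℤ} (hA : At P n h) (h2 : (2:ℤ) ∣ n) : ¬ Od P := by
  unfold Od; rw [hA.1]; exact not_not.mpr h2

theorem N3' {D : ℤ} [GD D] {P : Pt D} {n h : ℤ} (hA : At P n h) (h2 : ¬ (3:ℤ) ∣ n - D * h) : N3 P := by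
  unfold N3; rw [hA.1, hA.2]; exact h2

theorem f73 : ∀ x y : ZMod 73, y ^ 2 = x ^ 3 - 55 →
      ((x ^ 9 + 96 * 55 * x ^ 6 * 1 ^ 3 + 48 * 55 ^ 2 * x ^ 3 * 1 ^ 6 - 64 * 55 ^ 3 * 1 ^ 9) = 0 ∨
      (9 * x ^ 2 * 1 * (x ^ 3 - 4 * 55 * 1 ^ 3) ^ 2) = 0 ∨
      (x ^ 9 + 96 * 55 * x ^ 6 * 1 ^ 3 + 48 * 55 ^ 2 * x ^ 3 * 1 ^ 6 - 64 * 55 ^ 3 * 1 ^ 9) ^ 3 - 4 * 55 *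
      (9 * x ^ 2 * 1 * (x ^ 3 - 4 * 55 * 1 ^ 3) ^ 2) ^ 3 = 0) := by decide +kernel

theorem e73 {R : Pt 55} : (73:ℤ) ∣ Hh ((3 ^ 2 : ℕ) • R) := by
  haveI : Fact (Nat.Prime 73) := ⟨by norm_num⟩
  have pp : Prime (73:ℤ) := by norm_num
  by_cases h : (73:ℤ) ∣ Hh R
  · exact E1_nsmul pp R h _
  by_cases h0 : R = 0
  · rw [h0]; simp
  obtain ⟨x, y, hxy, hr⟩ := Xrel_start 73 (by exact_mod_cast h)
  have r1 := Xrel_triple 73 (by norm_num) (by norm_num) h0 hr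
  have h30 : (3:ℕ) • R ≠ 0 := fun hh => h0 (no_three (by rw [← three_smul']; exact hh))
  obtain ⟨u, hu, -, e⟩ := Xrel_triple 73 (by norm_num) (by norm_num) h30 r1
  rw [show (3 ^ 2 : ℕ) • R = (3:ℕ) • (3:ℕ) • R by rw [← mul_nsmul']; norm_num]
  have := (zm (n := 73) (a := Hh ((3:ℕ) • (3:ℕ) • R))).mpr (by
    rw [e]
    apply mul_eq_zero_of_right
    have f := f73
    have := f x y (by exact_mod_cast hxy)
    push_cast
    rcases this with h | h | h
    · rw [h]; ring
    · rw [h]; ring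
    · rw [h]; ring)
  exact_mod_cast this

theorem c1_int {G : Pt 55} (hA : At G 4 1) {P : Pt 55} (hP : P ∈ Gam 55) (hPe : ¬ Od P) (hH : Hh P = 1) :
    (P = G ∨ P = -G) ∨ (P = (2:ℤ) • G ∨ P = -((2:ℤ) • G)) := by
  have a1 : At ((1:ℤ) • G) 4 1 := by rw [one_zsmul]; exact hA
  have hG : G ∈ Gam 55 := mem_Gam' hA (by norm_num) (by norm_num)
  have hGe : ¬ Od G := nOd' hA (by norm_num)
  set g : Pt 55 := (2:ℤ) • G with hg
  have hg0 : g ∈ G0 55 := ⟨zsmul_mem hG 2, N3' (c1c_2 a1) (by norm_num)⟩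
  have hGn : G ∉ G0 55 := fun h => h.2 (by rw [hA.1, hA.2]; norm_num)
  have gen : Gen g := gen_of hG hGe hg0 hG (-1) (Or.inr rfl) (by rw [hg]; abel)
  have main : ∀ P : Pt 55, Hh P = 1 → ∀ R ∈ Gam 55, P = G + (3:ℕ) • R → P = G ∨ P = -g := by
    intro P hH R hR h
    have H17 : Hh (G - (3 ^ 2 : ℕ) • g) = Hh ((17:ℤ) • G) := by
      rw [← Hh_neg, hg]; congr 1; abel
    have H19 : Hh (G + (3 ^ 2 : ℕ) • g) = Hh ((19:ℤ) • G) := by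
      rw [hg]; congr 1; abel
    have H7 : Hh (G + (3 ^ 1 : ℕ) • g) = Hh ((7:ℤ) • G) := by
      rw [hg]; congr 1; abel
    have H5 : Hh (G - (3 ^ 1 : ℕ) • g) = Hh ((5:ℤ) • G) := by
      rw [← Hh_neg, hg]; congr 1; abel
    have H8 : Hh (g + (3 ^ 1 : ℕ) • g) = Hh ((8:ℤ) • G) := by
      rw [hg]; congr 1; abel
    have H4 : Hh (g - (3 ^ 1 : ℕ) • g) = Hh ((4:ℤ) • G) := by
      rw [← Hh_neg, hg]; congr 1; abel
    rw [(c1c_17 a1).2] at H17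
    rw [(c1c_19 a1).2] at H19
    rw [(c1c_7 a1).2] at H7
    rw [(c1c_5 a1).2] at H5
    rw [(c1c_8 a1).2] at H8
    rw [(c1c_4 a1).2] at H4
    by_cases hR0 : R ∈ G0 55
    · left
      have y12 : Hyp G 1 2 := Hyp_cls gen le_rfl le_rfl (by norm_num) (by norm_num) (Hyp_one hA.2)
        (by rw [hA.2]; norm_num) (by rw [H7]; norm_num) (by rw [H5]; norm_num)
      have h' : P = G + (3 ^ 1 : ℕ) • R := by rw [pow_one]; exact h
      rcases cls (n := 3) gen le_rfl (by norm_num) (by norm_num) (by norm_num) y12 hR0 with ⟨-, h1⟩ | ⟨h1, -⟩ | ⟨h1, -⟩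
      rotate_left
      · rw [← h', hH, H7] at h1; norm_num at h1
      · rw [← h', hH, H5] at h1; norm_num at h1
      obtain ⟨R1, hR1, rfl⟩ := h1
      have y23 : Hyp G 2 3 := Hyp_up le_rfl (by norm_num) (by norm_num) hA.2 y12
      have y24 : Hyp G 2 4 := Hyp_cls gen (by norm_num) (by norm_num) (by norm_num) (by norm_num) y23
        (by rw [hA.2]; norm_num) (by rw [H19]; norm_num) (by rw [H17]; norm_num)
      have s24 : Sk g G 2 4 (fun e => if e = 1 then 1 else 0) := Sk_of hg0 (by norm_num) (by norm_num) (by norm_num) hA.2 y24 _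
        (by norm_num) (by rw [H19]; norm_num) (by rw [H17]; norm_num)
      have h2 : P = G + (3 ^ 2 : ℕ) • R1 := by rw [h, ← mul_nsmul']; norm_num
      rcases cls (n := 5) gen (by norm_num) (by norm_num) (by norm_num) (by norm_num) y24 hR1 with ⟨-, h1⟩ | ⟨h1, -⟩ | ⟨-, h1⟩
      · obtain ⟨R2, hR2, rfl⟩ := h1
        have s35 := Sk_step hg0 hA.2 (by norm_num) (by norm_num) (by norm_num) s24
        have h3 : P = G + (3 ^ (2 + 1) : ℕ) • R2 := by rw [h2, ← mul_nsmul']; norm_num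
        have := Sk_fin gen hA.2 (by norm_num) (by norm_num) (by norm_num) s35 (by norm_num) (by norm_num) (by norm_num) hR2
          (by rw [← h3]; exact hH)
        rw [h3, this]; simp
      · rw [← h2, hH, H19] at h1; norm_num at h1
      · exfalso
        obtain ⟨R2, hR2, rfl⟩ := h1
        have e : P = (G - (3 ^ 2 : ℕ) • g) + (3:ℕ) • ((3 ^ 2 : ℕ) • R2) := by
          rw [h2, nsmul_add, neg_nsmul, ← mul_nsmul', ← mul_nsmul']; norm_num; abel
        rw [e] at hH
        obtain ⟨u, hu⟩ := cube_obs (p := 73) (by norm_num) (by norm_num) (good_pow hR2 2 (by norm_num)) e73 (by rw [H17]; norm_num) hH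
        rw [H17] at hu
        have := (zm (n := 73)).mp (by exact_mod_cast hu)
        push_cast at this
        revert this
        generalize (u : ZMod 73) = v
        revert v
        decide +kernel
    · right
      have hS : -(R + G) ∈ G0 55 := neg_mem (idx2 hG hGe hR hG hR0 hGn)
      have hg1 : Hh g = 1 := (c1c_2 a1).2
      have s : Sk g g 1 1 (fun e => if e = 1 then 1 else if e = -1 then 2 else 0) := Sk_of hg0 le_rfl le_rfl (by norm_num) hg1 (Hyp_one hg1) _
        (by norm_num) (by rw [H8]; norm_num) (by rw [H4]; norm_num)
      have e : -P = g + (3 ^ 1 : ℕ) • (-(R + G)) := by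
        rw [h, hg]; abel
      have := Sk_fin gen hg1 le_rfl le_rfl (by norm_num) s (by norm_num) (by norm_num) (by norm_num) hS
          (by rw [← e, Hh_neg]; exact hH)
      rw [this] at e
      rw [← neg_neg P, e]; simp
  obtain ⟨R, hR, h | h⟩ := even_form hG hGe hP hPe
  · rcases main P hH R hR h with h | h <;> simp [h]
  · rcases main (-P) (by rw [Hh_neg]; exact hH) R hR h with h | h
    · left; right; rw [← h]; simp
    · right; left; rwa [neg_inj] at h
end

section

theorem c3_int {G : Pt 1375} (hA : At G 14 1) {P : Pt 1375} (hP : P ∈ Gam 1375) (hPe : ¬ Od P) (hH : Hh P = 1) :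
    P = G ∨ P = -G := by
  have a1 : At ((1:ℤ) • G) 14 1 := by rw [one_zsmul]; exact hA
  have hG : G ∈ Gam 1375 := mem_Gam' hA (by norm_num) (by norm_num)
  have hGe : ¬ Od G := nOd' hA (by norm_num)
  have hg0 : G ∈ G0 1375 := G0_of_seven (by norm_num) hG
  have gen : Gen G := gen_of hG hGe hg0 (zero_mem _) 1 (Or.inl rfl) (by rw [one_zsmul, nsmul_zero, add_zero])
  have main : ∀ P : Pt 1375, Hh P = 1 → ∀ R ∈ Gam 1375, P = G + (3:ℕ) • R → P = G := by
    intro P hH R hR h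
    have H10 : Hh (G + (3 ^ 2 : ℕ) • G) = Hh ((10:ℤ) • G) := by
      congr 1; abel
    have H8 : Hh (G - (3 ^ 2 : ℕ) • G) = Hh ((8:ℤ) • G) := by
      rw [← Hh_neg]; congr 1; abel
    have H4 : Hh (G + (3 ^ 1 : ℕ) • G) = Hh ((4:ℤ) • G) := by
      congr 1; abel
    have H2 : Hh (G - (3 ^ 1 : ℕ) • G) = Hh ((2:ℤ) • G) := by
      rw [← Hh_neg]; congr 1; abel
    rw [(c3c_10 a1).2] at H10
    rw [(c3c_8 a1).2] at H8
    rw [(c3c_4 a1).2] at H4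
    rw [(c3c_2 a1).2] at H2
    have hR0 : R ∈ G0 1375 := G0_of_seven (by norm_num) hR
    have y12 : Hyp G 1 2 := Hyp_cls gen le_rfl le_rfl (by norm_num) (by norm_num) (Hyp_one hA.2)
        (by rw [hA.2]; norm_num) (by rw [H4]; norm_num) (by rw [H2]; norm_num)
    have h' : P = G + (3 ^ 1 : ℕ) • R := by rw [pow_one]; exact h
    rcases cls (n := 3) gen le_rfl (by norm_num) (by norm_num) (by norm_num) y12 hR0 with ⟨-, h1⟩ | ⟨h1, -⟩ | ⟨h1, -⟩
    rotate_left
    · rw [← h', hH, H4] at h1; norm_num at h1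
    · rw [← h', hH, H2] at h1; norm_num at h1
    obtain ⟨R1, hR1, rfl⟩ := h1
    have y23 : Hyp G 2 3 := Hyp_up le_rfl (by norm_num) (by norm_num) hA.2 y12
    have s : Sk G G 2 3 (fun e => if e = 1 then 2 else if e = -1 then 1 else 0) := Sk_of hg0 (by norm_num) (by norm_num) (by norm_num) hA.2 y23 _
        (by norm_num) (by rw [H10]; norm_num) (by rw [H8]; norm_num)
    have h2 : P = G + (3 ^ 2 : ℕ) • R1 := by rw [h, ← mul_nsmul']; norm_num
    have := Sk_fin gen hA.2 (by norm_num) (by norm_num) (by norm_num) s (by norm_num) (by norm_num) (by norm_num) hR1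
          (by rw [← h2]; exact hH)
    rw [h2, this]; simp
  obtain ⟨R, hR, h | h⟩ := even_form hG hGe hP hPe
  · exact Or.inl (main P hH R hR h)
  · right; rw [← main (-P) (by rw [Hh_neg]; exact hH) R hR h]; simp

theorem f7no : ∀ n h : ZMod 7, n ^ 4 + 8 * 503284375 * n * h ^ 3 - 4 * 1226 * h * (n ^ 3 - 503284375 * h ^ 3) = 0 → n = 0 ∧ h = 0 := by
  decide +kernel

theorem c6_int {G : Pt 503284375} (hA : At G 1226 1) {P : Pt 503284375} (hP : P ∈ Gam 503284375) (hPe : ¬ Od P) (hH : Hh P = 1) :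
    P = G ∨ P = -G := by
  have a1 : At ((1:ℤ) • G) 1226 1 := by rw [one_zsmul]; exact hA
  have hG : G ∈ Gam 503284375 := mem_Gam' hA (by norm_num) (by norm_num)
  have hGe : ¬ Od G := nOd' hA (by norm_num)
  have hg0 : G ∈ G0 503284375 := ⟨hG, N3' hA (by norm_num)⟩
  have hno : ∀ R : Pt 503284375, R + R ≠ G := by
    intro R h
    obtain ⟨g, -, -, e1, e2⟩ := dbl R
    rw [h, hA.1] at e2
    rw [h, hA.2] at e1
    have e3 : Nn R ^ 4 + 8 * 503284375 * Nn R * Hh R ^ 3 - 4 * 1226 * Hh R * (Nn R ^ 3 - 503284375 * Hh R ^ 3) = 0 := by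
      linear_combination e2 - 1226 * e1
    have e4 := congrArg (Int.cast : ℤ → ZMod 7) e3
    push_cast at e4
    obtain ⟨z1, z2⟩ := f7no _ _ e4
    have p7 : Prime (7:ℤ) := by norm_num
    exact cop_not p7 R ((zm (n := 7)).mpr z2) ((zm (n := 7)).mpr z1)
  have gen : Gen G := gen_of hG hGe hg0 (zero_mem _) 1 (Or.inl rfl) (by rw [one_zsmul, nsmul_zero, add_zero])
  have main : ∀ P : Pt 503284375, Hh P = 1 → ∀ R ∈ Gam 503284375, P = G + (3:ℕ) • R → P = G := by
    intro P hH R hR h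
    have H4 : Hh (G + (3 ^ 1 : ℕ) • G) = Hh ((4:ℤ) • G) := by
      congr 1; abel
    have H2 : Hh (G - (3 ^ 1 : ℕ) • G) = Hh ((2:ℤ) • G) := by
      rw [← Hh_neg]; congr 1; abel
    rw [(c6c_4 a1).2] at H4
    rw [(c6c_2 a1).2] at H2
    have hR0 : R ∈ G0 503284375 := G0_eq hg0 hGe hno hR
    have h' : P = G + (3 ^ 1 : ℕ) • R := by rw [pow_one]; exact h
    have s : Sk G G 1 1 (fun e => if e = 1 then 1 else if e = -1 then 2 else 0) := Sk_of hg0 (by norm_num) (by norm_num) (by norm_num) hA.2 (Hyp_one hA.2) _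
        (by norm_num) (by rw [H4]; norm_num) (by rw [H2]; norm_num)
    have := Sk_fin gen hA.2 (by norm_num) (by norm_num) (by norm_num) s (by norm_num) (by norm_num) (by norm_num) hR0
          (by rw [← h']; exact hH)
    rw [h', this]; simp
  obtain ⟨R, hR, h | h⟩ := even_form hG hGe hP hPe
  · exact Or.inl (main P hH R hR h)
  · right; rw [← main (-P) (by rw [Hh_neg]; exact hH) R hR h]; simp

theorem c2_int {G : Pt 805255} (hA : At G 589274 6241) {P : Pt 805255} (hP : P ∈ Gam 805255) (hPe : ¬ Od P) (hH : Hh P = 1) :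
    False := by
  have a1 : At ((1:ℤ) • G) 589274 6241 := by rw [one_zsmul]; exact hA
  have hG : G ∈ Gam 805255 := mem_Gam' hA (by norm_num) (by norm_num)
  have hGe : ¬ Od G := nOd' hA (by norm_num)
  have hg0 : G ∈ G0 805255 := G0_of_seven (by norm_num) hG
  have gen : Gen G := gen_of hG hGe hg0 (zero_mem _) 1 (Or.inl rfl) (by rw [one_zsmul, nsmul_zero, add_zero])
  have main : ∀ P : Pt 805255, Hh P = 1 → ∀ R ∈ Gam 805255, P = G + (3:ℕ) • R → False := by
    intro P hH R hR h
    have H4 : Hh (G + (3 ^ 1 : ℕ) • G) = Hh ((4:ℤ) • G) := by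
      congr 1; abel
    have H2 : Hh (G - (3 ^ 1 : ℕ) • G) = Hh ((2:ℤ) • G) := by
      rw [← Hh_neg]; congr 1; abel
    rw [(c2c_4 a1).2] at H4
    rw [(c2c_2 a1).2] at H2
    have hR0 : R ∈ G0 805255 := G0_of_seven (by norm_num) hR
    have h' : P = G + (3 ^ 1 : ℕ) • R := by rw [pow_one]; exact h
    have y11 : Hyp G 1 1 := Hyp_one' (by rw [hA.2]; norm_num)
    rcases cls (n := 2) gen le_rfl (by norm_num) (by norm_num) (by norm_num) y11 hR0 with ⟨h1, -⟩ | ⟨h1, -⟩ | ⟨h1, -⟩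
    · rw [← h', hH, hA.2] at h1; norm_num at h1
    · rw [← h', hH, H4] at h1; norm_num at h1
    · rw [← h', hH, H2] at h1; norm_num at h1
  obtain ⟨R, hR, h | h⟩ := even_form hG hGe hP hPe
  · exact main P hH R hR h
  · exact main (-P) (by rw [Hh_neg]; exact hH) R hR h

theorem f7 : ∀ x y : ZMod 7, y ^ 2 = x ^ 3 - 4159375 → 9 * x ^ 2 * 1 * (x ^ 3 - 4 * 4159375 * 1 ^ 3) ^ 2 = 0 := by
  decide +kernel

theorem e7 {R : Pt 4159375} : (7:ℤ) ∣ Hh ((3:ℕ) • R) := by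
  have : Fact (Nat.Prime 7) := ⟨by norm_num⟩
  have pp : Prime (7:ℤ) := by norm_num
  by_cases h : (7:ℤ) ∣ Hh R
  · exact E1_nsmul pp R h _
  by_cases h0 : R = 0
  · rw [h0]; simp
  obtain ⟨x, y, hxy, hr⟩ := Xrel_start 7 (by exact_mod_cast h)
  obtain ⟨u, hu, -, e⟩ := Xrel_triple 7 (by norm_num) (by norm_num) h0 hr
  have := (zm (n := 7) (a := Hh ((3:ℕ) • R))).mpr (by
    rw [e]
    apply mul_eq_zero_of_right
    have := f7 x y (by exact_mod_cast hxy)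
    exact_mod_cast this)
  exact_mod_cast this

theorem c5_int {G : Pt 4159375} (hA : At G 867669688560007424 297222116897161) {P : Pt 4159375} (hP : P ∈ Gam 4159375) (hPe : ¬ Od P) (hH : Hh P = 1) :
    False := by
  have a1 : At ((1:ℤ) • G) 867669688560007424 297222116897161 := by rw [one_zsmul]; exact hA
  have hG : G ∈ Gam 4159375 := mem_Gam' hA (by norm_num) (by norm_num)
  have hGe : ¬ Od G := nOd' hA (by norm_num)
  have hg0 : G ∈ G0 4159375 := G0_of_seven (by norm_num) hG
  have gen : Gen G := gen_of hG hGe hg0 (zero_mem _) 1 (Or.inl rfl) (by rw [one_zsmul, nsmul_zero, add_zero])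
  have main : ∀ P : Pt 4159375, Hh P = 1 → ∀ R ∈ Gam 4159375, P = G + (3:ℕ) • R → False := by
    intro P hH R hR h
    have H4 : Hh (G + (3 ^ 1 : ℕ) • G) = Hh ((4:ℤ) • G) := by
      congr 1; abel
    have H2 : Hh (G - (3 ^ 1 : ℕ) • G) = Hh ((2:ℤ) • G) := by
      rw [← Hh_neg]; congr 1; abel
    rw [(c5c_4 a1).2] at H4
    rw [(c5c_2 a1).2] at H2
    have hR0 : R ∈ G0 4159375 := G0_of_seven (by norm_num) hR
    have h' : P = G + (3 ^ 1 : ℕ) • R := by rw [pow_one]; exact h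
    have y11 : Hyp G 1 1 := Hyp_one' (by rw [hA.2]; norm_num)
    have y12 : Hyp G 1 2 := Hyp_cls gen le_rfl le_rfl (by norm_num) (by norm_num) y11
        (by rw [hA.2]; norm_num) (by rw [H4]; norm_num) (by rw [H2]; norm_num)
    rcases cls (n := 3) gen le_rfl (by norm_num) (by norm_num) (by norm_num) y12 hR0 with ⟨h1, -⟩ | ⟨h1, -⟩ | ⟨-, h1⟩
    · rw [← h', hH, hA.2] at h1; norm_num at h1
    · rw [← h', hH, H4] at h1; norm_num at h1
    · obtain ⟨R2, hR2, rfl⟩ := h1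
      have e : P = (G - (3 ^ 1 : ℕ) • G) + (3:ℕ) • ((3 ^ 1 : ℕ) • R2) := by
        rw [h', nsmul_add, neg_nsmul, ← mul_nsmul', ← mul_nsmul']; norm_num; abel
      rw [e] at hH
      obtain ⟨u, hu⟩ := cube_obs (p := 7) (by norm_num) (by norm_num) (good_pow hR2 1 le_rfl) (by rw [pow_one]; exact e7) (by rw [H2]; norm_num) hH
      rw [H2] at hu
      have := (zm (n := 7)).mp (by exact_mod_cast hu)
      push_cast at this
      revert this
      generalize (u : ZMod 7) = v
      revert v
      decide +kernel
  obtain ⟨R, hR, h | h⟩ := even_form hG hGe hP hPe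
  · exact main P hH R hR h
  · exact main (-P) (by rw [Hh_neg]; exact hH) R hR h
end

section

theorem pt_of {D : ℤ} [GD D] (s t : ℕ) {x y h : ℤ} (hh : h = 5 ^ s * 11 ^ t) (e : x ^ 2 + D * h ^ 6 = y ^ 3)
    (h2 : (2:ℤ) ∣ y) (h5 : ¬ (5:ℤ) ∣ y) (h11 : ¬ (11:ℤ) ∣ y) :
    ∃ R : Pt D, At R y (h ^ 2) ∧ R ∈ Gam D ∧ ¬ Od R ∧ ∀ q : ℤ, Prime q → q ∣ Hh R → q ∣ 5 ∨ q ∣ 11 := by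
  have h0 : h ≠ 0 := by rw [hh]; positivity
  obtain ⟨R, r1, r2⟩ := mk_pt h0 (cop_w s t hh h5 h11).symm e
  have hA : At R y (h ^ 2) := ⟨r1, r2⟩
  refine ⟨R, hA, mem_Gam' hA h5 h11, nOd' hA h2, ?_⟩
  intro q hq hd
  rw [r2, hh] at hd
  rcases hq.dvd_or_dvd (hq.dvd_of_dvd_pow hd) with h | h
  · exact Or.inl (hq.dvd_of_dvd_pow h)
  · exact Or.inr (hq.dvd_of_dvd_pow h)

theorem one_of_sq {h : ℤ} {s t : ℕ} (hh : h = 5 ^ s * 11 ^ t) (e : h ^ 2 = 1) : h = 1 := by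
  have : 0 < h := by rw [hh]; positivity
  nlinarith

theorem fin1 (s t : ℕ) {x y h : ℤ} (hh : h = 5 ^ s * 11 ^ t) (e : x ^ 2 + 55 * h ^ 6 = y ^ 3)
    (h2 : (2:ℤ) ∣ y) (h5 : ¬ (5:ℤ) ∣ y) (h11 : ¬ (11:ℤ) ∣ y) : h = 1 ∧ (y = 4 ∨ y = 56) := by
  obtain ⟨R, rA, rG, rE, rS⟩ := pt_of (D := 55) s t hh e h2 h5 h11
  obtain ⟨G, hA1, hA2⟩ := mk_pt (D := 55) (l := 4) (g := 1) (m := 3) (by norm_num) (by rw [Int.isCoprime_iff_gcd_eq_one]; decide +kernel) (by norm_num)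
  have hA : At G 4 (1 ^ 2) := ⟨hA1, hA2⟩
  norm_num at hA
  have a1 : At ((1:ℤ) • G) 4 1 := by rw [one_zsmul]; exact hA
  obtain ⟨-, h1⟩ := spart (mem_Gam' hA (by norm_num) (by norm_num)) (nOd' hA (by norm_num)) (by rw [hA.2]; norm_num) (by rw [hA.2]; norm_num)
    (fun R => ∃ j : ℤ, R = j • G)
    (by
      intro P p1 p2 p3
      rcases c1_int hA p1 p2 p3 with (rfl | rfl) | rfl | rfl
      · exact ⟨1, by simp⟩
      · exact ⟨-1, by simp⟩
      · exact ⟨2, rfl⟩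
      · exact ⟨-2, by rw [neg_zsmul]⟩)
    (fun R hR => oth_mul 5 (c1c_5 a1) 45954841 (by norm_num) (by norm_num) (by norm_num) hR)
    (fun R hR => oth_mul 11 (c1c_11 a1) 63742790974163597839953099254788218975522841 (by norm_num) (by norm_num) (by norm_num) hR)
    rG rE rS
  refine ⟨one_of_sq hh (by rw [← rA.2]; exact h1), ?_⟩
  rw [← rA.1]
  rcases c1_int hA rG rE h1 with (rfl | rfl) | rfl | rfl
  · left; exact hA.1
  · left; rw [Nn_neg]; exact hA.1
  · right; exact (c1c_2 a1).1
  · right; rw [Nn_neg]; exact (c1c_2 a1).1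

theorem fin3 (s t : ℕ) {x y h : ℤ} (hh : h = 5 ^ s * 11 ^ t) (e : x ^ 2 + 1375 * h ^ 6 = y ^ 3)
    (h2 : (2:ℤ) ∣ y) (h5 : ¬ (5:ℤ) ∣ y) (h11 : ¬ (11:ℤ) ∣ y) : h = 1 ∧ (y = 14) := by
  obtain ⟨R, rA, rG, rE, rS⟩ := pt_of (D := 1375) s t hh e h2 h5 h11
  obtain ⟨G, hA1, hA2⟩ := mk_pt (D := 1375) (l := 14) (g := 1) (m := 37) (by norm_num) (by rw [Int.isCoprime_iff_gcd_eq_one]; decide +kernel) (by norm_num)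
  have hA : At G 14 (1 ^ 2) := ⟨hA1, hA2⟩
  norm_num at hA
  have a1 : At ((1:ℤ) • G) 14 1 := by rw [one_zsmul]; exact hA
  obtain ⟨-, h1⟩ := spart (mem_Gam' hA (by norm_num) (by norm_num)) (nOd' hA (by norm_num)) (by rw [hA.2]; norm_num) (by rw [hA.2]; norm_num)
    (fun R => ∃ j : ℤ, R = j • G)
    (by
      intro P p1 p2 p3
      rcases c3_int hA p1 p2 p3 with rfl | rfl
      · exact ⟨1, by simp⟩
      · exact ⟨-1, by simp⟩)
    (fun R hR => oth_mul 5 (c3c_5 a1) 7181528368018428414911281 (by norm_num) (by norm_num) (by norm_num) hR)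
    (fun R hR => oth_mul 11 (c3c_11 a1) 345754605878681160142073672294872335058933643615943333421005612837168362689495904475902877706562143000164151136354422696010302253531401 (by norm_num) (by norm_num) (by norm_num) hR)
    rG rE rS
  refine ⟨one_of_sq hh (by rw [← rA.2]; exact h1), ?_⟩
  rw [← rA.1]
  rcases c3_int hA rG rE h1 with rfl | rfl
  · exact hA.1
  · rw [Nn_neg]; exact hA.1

theorem fin6 (s t : ℕ) {x y h : ℤ} (hh : h = 5 ^ s * 11 ^ t) (e : x ^ 2 + 503284375 * h ^ 6 = y ^ 3)
    (h2 : (2:ℤ) ∣ y) (h5 : ¬ (5:ℤ) ∣ y) (h11 : ¬ (11:ℤ) ∣ y) : h = 1 ∧ (y = 1226) := by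
  obtain ⟨R, rA, rG, rE, rS⟩ := pt_of (D := 503284375) s t hh e h2 h5 h11
  obtain ⟨G, hA1, hA2⟩ := mk_pt (D := 503284375) (l := 1226) (g := 1) (m := 36599) (by norm_num) (by rw [Int.isCoprime_iff_gcd_eq_one]; decide +kernel) (by norm_num)
  have hA : At G 1226 (1 ^ 2) := ⟨hA1, hA2⟩
  norm_num at hA
  have a1 : At ((1:ℤ) • G) 1226 1 := by rw [one_zsmul]; exact hA
  obtain ⟨-, h1⟩ := spart (mem_Gam' hA (by norm_num) (by norm_num)) (nOd' hA (by norm_num)) (by rw [hA.2]; norm_num) (by rw [hA.2]; norm_num)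
    (fun R => ∃ j : ℤ, R = j • G)
    (by
      intro P p1 p2 p3
      rcases c6_int hA p1 p2 p3 with rfl | rfl
      · exact ⟨1, by simp⟩
      · exact ⟨-1, by simp⟩)
    (fun R hR => oth_mul 5 (c6c_5 a1) 593510968599544347645255626629994565633388946478943359278628212732928841 (by norm_num) (by norm_num) (by norm_num) hR)
    (fun R hR => oth_mul 11 (c6c_11 a1) 8488460392180797105363966865152083608032070142178307907496062165511046257719057664773833899229502765424730478457453447658051348916355687330964050659876654538280276779434889262075916360975685440491766074159373537778864483445716112347171527215989875840570775018178389113888374600850885345886709678104407812629671036567034957266194959616925442745570409594297785690201 (by norm_num) (by norm_num) (by norm_num) hR)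
    rG rE rS
  refine ⟨one_of_sq hh (by rw [← rA.2]; exact h1), ?_⟩
  rw [← rA.1]
  rcases c6_int hA rG rE h1 with rfl | rfl
  · exact hA.1
  · rw [Nn_neg]; exact hA.1

theorem fin2 (s t : ℕ) {x y h : ℤ} (hh : h = 5 ^ s * 11 ^ t) (e : x ^ 2 + 805255 * h ^ 6 = y ^ 3)
    (h2 : (2:ℤ) ∣ y) (h5 : ¬ (5:ℤ) ∣ y) (h11 : ¬ (11:ℤ) ∣ y) : False := by
  obtain ⟨R, rA, rG, rE, rS⟩ := pt_of (D := 805255) s t hh e h2 h5 h11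
  obtain ⟨G, hA1, hA2⟩ := mk_pt (D := 805255) (l := 589274) (g := 79) (m := 94203937) (by norm_num) (by rw [Int.isCoprime_iff_gcd_eq_one]; decide +kernel) (by norm_num)
  have hA : At G 589274 (79 ^ 2) := ⟨hA1, hA2⟩
  norm_num at hA
  exact (spart (mem_Gam' hA (by norm_num) (by norm_num)) (nOd' hA (by norm_num)) (by rw [hA.2]; norm_num) (by rw [hA.2]; norm_num)
    (fun _ => False) (fun P p1 p2 p3 => c2_int hA p1 p2 p3)
    (fun R hR => hR.elim) (fun R hR => hR.elim) rG rE rS).1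

theorem fin5 (s t : ℕ) {x y h : ℤ} (hh : h = 5 ^ s * 11 ^ t) (e : x ^ 2 + 4159375 * h ^ 6 = y ^ 3)
    (h2 : (2:ℤ) ∣ y) (h5 : ¬ (5:ℤ) ∣ y) (h11 : ¬ (11:ℤ) ∣ y) : False := by
  obtain ⟨R, rA, rG, rE, rS⟩ := pt_of (D := 4159375) s t hh e h2 h5 h11
  obtain ⟨G, hA1, hA2⟩ := mk_pt (D := 4159375) (l := 867669688560007424) (g := 17240131) (m := 808156241145811045139848093) (by norm_num) (by rw [Int.isCoprime_iff_gcd_eq_one]; decide +kernel) (by norm_num)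
  have hA : At G 867669688560007424 (17240131 ^ 2) := ⟨hA1, hA2⟩
  norm_num at hA
  exact (spart (mem_Gam' hA (by norm_num) (by norm_num)) (nOd' hA (by norm_num)) (by rw [hA.2]; norm_num) (by rw [hA.2]; norm_num)
    (fun _ => False) (fun P p1 p2 p3 => c5_int hA p1 p2 p3)
    (fun R hR => hR.elim) (fun R hR => hR.elim) rG rE rS).1
end

section

theorem f9a : ∀ p q w : ZMod 9, (w = 2 ∨ w = 7) → 64 * w ≠ 9 * p ^ 2 * q - 165 * q ^ 3 - (p ^ 3 - 165 * p * q ^ 2) := by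
  decide +kernel
theorem f9b : ∀ p q w : ZMod 9, (w = 2 ∨ w = 7) → 64 * w ≠ 9 * p ^ 2 * q - 165 * q ^ 3 + (p ^ 3 - 165 * p * q ^ 2) := by
  decide +kernel
theorem f9c : ∀ h w : ZMod 9, (w = 2 ∨ w = 7) → (h ^ 3 = 1 ∨ h ^ 3 = 8) → (w * h ^ 3 = 2 ∨ w * h ^ 3 = 7) := by
  decide +kernel
theorem f9d : ∀ h : ZMod 9, 3 * h = 0 ∨ (h ^ 3 = 1 ∨ h ^ 3 = 8) := by
  decide +kernel

theorem three_not {h : ℤ} {s t : ℕ} (hh : h = 5 ^ s * 11 ^ t) : ¬ (3:ℤ) ∣ h := by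
  have p3 : Prime (3:ℤ) := by norm_num
  intro h3
  rw [hh] at h3
  rcases p3.dvd_or_dvd h3 with h | h
  · have := p3.dvd_of_dvd_pow h; norm_num at this
  · have := p3.dvd_of_dvd_pow h; norm_num at this

theorem obst (w0 h x W y : ℤ) (hw : (w0 : ZMod 9) = 2 ∨ (w0 : ZMod 9) = 7) (h3 : ¬ (3:ℤ) ∣ h) (hWd : W = w0 * h ^ 3)
    (hy : 0 < y) (h2 : (2:ℤ) ∣ y) (e : x ^ 2 + 55 * W ^ 2 = y ^ 3) (hW : IsCoprime W y) : False := by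
  have hW9 : (W : ZMod 9) = 2 ∨ (W : ZMod 9) = 7 := by
    rw [hWd]; push_cast
    apply f9c _ _ hw
    refine (f9d (h : ZMod 9)).resolve_left ?_
    intro hz
    have : ((3 * h : ℤ) : ZMod 9) = 0 := by push_cast; exact hz
    have := (zm (n := 9)).mpr this
    apply h3
    push_cast at this
    omega
  rcases cube55 x _ y hy e hW with ⟨p, q, h1, h2', h3⟩ | ⟨p, q, e', he, h1, h2', h3⟩
  · have hodd : ¬ (2:ℤ) ∣ W := fun hh => not_both nu2 hW hh h2
    apply hodd
    have k : (2:ℤ) ∣ p * (p - 1) := even_iff_two_dvd.mp (Int.even_mul_pred_self p)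
    have k' : (2:ℤ) ∣ q * (q - 1) := even_iff_two_dvd.mp (Int.even_mul_pred_self q)
    obtain ⟨a, ha⟩ := k
    obtain ⟨b, hb⟩ := k'
    obtain ⟨c, hc⟩ := h2
    have hpq : (2:ℤ) ∣ p + q := ⟨c - a - 55 * b - 27 * q, by linarith⟩
    obtain ⟨d, hd⟩ := hpq
    have hp : p = 2 * d - q := by linarith
    rw [← h2', hp]
    exact ⟨q * (6 * d ^ 2 - 6 * d * q - 26 * q ^ 2), by ring⟩
  · rcases he with rfl | rfl
    · have : 64 * W = 9 * p ^ 2 * q - 165 * q ^ 3 - (p ^ 3 - 165 * p * q ^ 2) := by linear_combination h1 - 3 * h2'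
      have := congrArg (Int.cast : ℤ → ZMod 9) this
      push_cast at this
      exact f9a _ _ _ hW9 this
    · have : 64 * W = 9 * p ^ 2 * q - 165 * q ^ 3 + (p ^ 3 - 165 * p * q ^ 2) := by linear_combination -h1 - 3 * h2'
      have := congrArg (Int.cast : ℤ → ZMod 9) this
      push_cast at this
      exact f9b _ _ _ hW9 this
end

section

theorem sq_pos_of {a b c : ℤ} (h : IsCoprime a b) (ha : 0 < a) (e : a * b = c ^ 2) : ∃ p : ℤ, 0 < p ∧ a = p ^ 2 := by
  obtain ⟨p, hp | hp⟩ := Int.sq_of_isCoprime h e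
  · have : p ≠ 0 := by rintro rfl; simp at hp; omega
    exact ⟨|p|, abs_pos.mpr this, by rw [sq_abs]; exact hp⟩
  · nlinarith [sq_nonneg p]

theorem zz5 : (5 : ZMod 5) = 0 := rfl
theorem zz11 : (11 : ZMod 11) = 0 := rfl
theorem zz3 : (3 : ZMod 3) = 0 := rfl
theorem mod5_3 : ∀ a b : ZMod 5, a ^ 2 = 3 * b ^ 4 → b = 0 := by decide +kernel
theorem mod5_m3 : ∀ a b : ZMod 5, -(3 * a ^ 2) = 4 * b ^ 2 → b = 0 := by decide +kernel
theorem mod11_m3 : ∀ a b : ZMod 11, -(3 * a ^ 2) = 4 * b ^ 2 → b = 0 := by decide +kernel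
theorem mod3_m1 : ∀ a b : ZMod 3, -(a ^ 2) = 4 * b ^ 2 → a = 0 := by decide +kernel

theorem c4_core {V s t P Q : ℤ} (i j : ℕ) (hV : V = 5 ^ i * 11 ^ j) (h5V : (5:ℤ) ∣ V) (h11V : (11:ℤ) ∣ V) (h5 : ¬ (5:ℤ) ∣ s) (h11 : ¬ (11:ℤ) ∣ s)
    (hP : P = 2 * t - 2 * s ^ 2 - 3 * V) (hQ : Q = 2 * t + 2 * s ^ 2 + 3 * V) (e : P * Q = 3 * V ^ 2) (hc : IsCoprime P Q)
    (hP0 : 0 < P) : False := by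
  have hV0 : 0 < V := by rw [hV]; positivity
  have hQ0 : 0 < Q := by nlinarith [sq_nonneg s]
  have h3V : ¬ (3:ℤ) ∣ V := three_not hV
  have p3 : Prime (3:ℤ) := by norm_num
  have p5 : Prime (5:ℤ) := by norm_num
  have p11 : Prime (11:ℤ) := by norm_num
  rcases p3.dvd_or_dvd (Dvd.intro _ e.symm) with ⟨P', rfl⟩ | ⟨Q', rfl⟩
  · have e' : P' * Q = V ^ 2 := by linarith
    have hc' : IsCoprime P' Q := hc.of_mul_left_right
    obtain ⟨p, p0, hp⟩ := sq_pos_of hc' (by omega) e'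
    obtain ⟨q, q0, hq⟩ := sq_pos_of hc'.symm hQ0 (by rw [mul_comm]; exact e')
    have hpq : p * q = V := by
      have : (p * q) ^ 2 = V ^ 2 := by rw [← e', hp, hq]; ring
      exact (sq_eq_sq₀ (by positivity) hV0.le).mp this
    have E : q ^ 2 - 3 * p ^ 2 = 4 * s ^ 2 + 6 * V := by rw [← hq, ← hp]; linarith
    have q5 : ¬ (5:ℤ) ∣ q := by
      rintro ⟨c, hc⟩
      obtain ⟨d, hd⟩ := h5V
      have := congrArg (Int.cast : ℤ → ZMod 5) E
      rw [hc, hd] at this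
      push_cast at this
      have := mod5_m3 p s (by linear_combination this + zz5 * (6 * d - 5 * c ^ 2 : ZMod 5))
      exact h5 ((zm (n := 5)).mpr this)
    have q11 : ¬ (11:ℤ) ∣ q := by
      rintro ⟨c, hc⟩
      obtain ⟨d, hd⟩ := h11V
      have := congrArg (Int.cast : ℤ → ZMod 11) E
      rw [hc, hd] at this
      push_cast at this
      have := mod11_m3 p s (by linear_combination this + zz11 * (6 * d - 11 * c ^ 2 : ZMod 11))
      exact h11 ((zm (n := 11)).mpr this)
    have cu := cop_w i j hV q5 q11
    have : IsUnit q := cu.isUnit_of_dvd' (Dvd.intro_left p hpq) dvd_rfl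
    rcases Int.isUnit_iff.mp this with rfl | rfl
    · nlinarith [sq_nonneg s, sq_nonneg p]
    · omega
  · have e' : P * Q' = V ^ 2 := by linarith
    have hc' : IsCoprime P Q' := hc.of_mul_right_right
    obtain ⟨p, p0, hp⟩ := sq_pos_of hc' hP0 e'
    obtain ⟨q, q0, hq⟩ := sq_pos_of hc'.symm (by omega) (by rw [mul_comm]; exact e')
    have E : 3 * q ^ 2 - p ^ 2 = 4 * s ^ 2 + 6 * V := by rw [← hq, ← hp]; linarith
    have := congrArg (Int.cast : ℤ → ZMod 3) E
    push_cast at this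
    have := mod3_m1 p s (by linear_combination this + zz3 * (2 * V - q ^ 2 : ZMod 3))
    have := (zm (n := 3)).mpr this
    apply h3V
    apply p3.dvd_of_dvd_pow (n := 2)
    rw [← e', hp]
    exact Dvd.dvd.mul_right (dvd_pow this (by norm_num)) _

theorem c4 {x y V : ℤ} (i j : ℕ) (hV : V = 5 ^ i * 11 ^ j) (h5V : (5:ℤ) ∣ V) (h11V : (11:ℤ) ∣ V) (h5 : ¬ (5:ℤ) ∣ y) (h11 : ¬ (11:ℤ) ∣ y)
    (hy : (2:ℤ) ∣ y) (hy0 : 0 < y) (hx : 0 < x) (e : x ^ 2 + V ^ 3 = y ^ 3) : False := by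
  have hV0 : 0 < V := by rw [hV]; positivity
  have h3V : ¬ (3:ℤ) ∣ V := three_not hV
  have p3 : Prime (3:ℤ) := by norm_num
  have p5 : Prime (5:ℤ) := by norm_num
  have p11 : Prime (11:ℤ) := by norm_num
  have cV := cop_w i j hV h5 h11
  have V2 : ¬ (2:ℤ) ∣ V := by
    have p2 : Prime (2:ℤ) := by norm_num
    intro h
    rw [hV] at h
    rcases p2.dvd_or_dvd h with h | h
    · have := p2.dvd_of_dvd_pow h; norm_num at this
    · have := p2.dvd_of_dvd_pow h; norm_num at this
  obtain ⟨A, hA⟩ : ∃ A, A = y - V := ⟨_, rfl⟩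
  obtain ⟨B, hB⟩ : ∃ B, B = A ^ 2 + 3 * A * V + 3 * V ^ 2 := ⟨_, rfl⟩
  have hAB : A * B = x ^ 2 := by rw [hB, hA]; linear_combination -e
  have B0 : 0 < B := by nlinarith [sq_nonneg (2 * A + 3 * V), sq_pos_of_pos hV0]
  have A0 : 0 < A := by
    by_contra h
    have : A * B ≤ 0 := mul_nonpos_of_nonpos_of_nonneg (by omega) B0.le
    nlinarith [sq_pos_of_pos hx]
  have yA : y = A + V := by omega
  have cAV : IsCoprime V A := by rw [hA]; exact cop_congr cV (-1) (by ring)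
  have A5 : ¬ (5:ℤ) ∣ A := fun h => h5 (by rw [yA]; exact dvd_add h h5V)
  have A11 : ¬ (11:ℤ) ∣ A := fun h => h11 (by rw [yA]; exact dvd_add h h11V)
  have cA3 : ∀ q : ℤ, Prime q → q ∣ A → q ∣ B → q ∣ 3 := by
    intro q hq qa qb
    have : q ∣ 3 * V ^ 2 := by
      have : 3 * V ^ 2 = B - A * (A + 3 * V) := by rw [hB]; ring
      rw [this]; exact dvd_sub qb (qa.mul_right _)
    rcases hq.dvd_or_dvd this with h | h
    · exact h
    · exact absurd (cAV.isUnit_of_dvd' (hq.dvd_of_dvd_pow h) qa) hq.not_isUnit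
  by_cases hA3 : (3:ℤ) ∣ A
  · obtain ⟨a, ha⟩ := hA3
    obtain ⟨b, hb⟩ : ∃ b, b = 3 * a ^ 2 + 3 * a * V + V ^ 2 := ⟨_, rfl⟩
    have hBb : B = 3 * b := by rw [hB, hb, ha]; ring
    have x3 : (3:ℤ) ∣ x := p3.dvd_of_dvd_pow (n := 2) (by rw [← hAB, ha]; exact ⟨a * B, by ring⟩)
    obtain ⟨w, hw⟩ := x3
    have hab : a * b = w ^ 2 := by
      have : 9 * (a * b) = 9 * w ^ 2 := by
        have := hAB; rw [ha, hBb, hw] at this; linarith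
      linarith
    have cab : IsCoprime a b := by
      have : IsCoprime a (V ^ 2) := by
        have : IsCoprime V a := by rw [ha] at cAV; exact cAV.of_mul_right_right
        exact this.symm.pow_right
      exact cop_congr this (3 * a + 3 * V) (by rw [hb]; ring)
    obtain ⟨s, s0, hs⟩ := sq_pos_of cab (by omega) hab
    obtain ⟨t, t0, ht⟩ := sq_pos_of cab.symm (by omega) (by rw [mul_comm]; exact hab)
    have E : t ^ 2 = 3 * s ^ 4 + 3 * s ^ 2 * V + V ^ 2 := by rw [← ht, hb, hs]; ring
    obtain ⟨d, hd⟩ := h5V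
    have := congrArg (Int.cast : ℤ → ZMod 5) E
    rw [hd] at this
    push_cast at this
    have := mod5_3 t s (by linear_combination this + zz5 * (3 * s ^ 2 * d + 5 * d ^ 2 : ZMod 5))
    have := (zm (n := 5)).mpr this
    apply A5
    rw [ha, hs]
    exact Dvd.dvd.mul_left (dvd_pow this (by norm_num)) _
  · have cAB : IsCoprime A B := by
      have : IsCoprime A (3 * V ^ 2) := (p3.coprime_iff_not_dvd.mpr hA3).symm.mul_right cAV.symm.pow_right
      exact cop_congr this (A + 3 * V) (by rw [hB]; ring)
    obtain ⟨s, s0, hs⟩ := sq_pos_of cAB A0 hAB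
    obtain ⟨t, t0, ht⟩ := sq_pos_of cAB.symm B0 (by rw [mul_comm]; exact hAB)
    have s5 : ¬ (5:ℤ) ∣ s := fun h => A5 (by rw [hs]; exact dvd_pow h (by norm_num))
    have s11 : ¬ (11:ℤ) ∣ s := fun h => A11 (by rw [hs]; exact dvd_pow h (by norm_num))
    have eB : t ^ 2 = s ^ 4 + 3 * s ^ 2 * V + 3 * V ^ 2 := by rw [← ht, hB, hs]; ring
    have e' : (2 * t - 2 * s ^ 2 - 3 * V) * (2 * t + 2 * s ^ 2 + 3 * V) = 3 * V ^ 2 := by linear_combination 4 * eB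
    refine c4_core i j hV h5V h11V s5 s11 rfl rfl e' ?_ ?_
    · obtain ⟨P, hP⟩ : ∃ P, P = 2 * t - 2 * s ^ 2 - 3 * V := ⟨_, rfl⟩
      obtain ⟨Q, hQ⟩ : ∃ Q, Q = 2 * t + 2 * s ^ 2 + 3 * V := ⟨_, rfl⟩
      rw [← hP, ← hQ] at e' ⊢
      have P2 : ¬ (2:ℤ) ∣ P := by omega
      have P0 : P ≠ 0 := by rintro rfl; simp at P2
      apply isCoprime_of_prime_dvd (fun h => P0 h.1)
      intro q hq h1 h2
      have q2 : ¬ q ∣ 2 := by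
        intro h
        have : Associated q 2 := hq.associated_of_dvd (by norm_num) h
        exact P2 (this.symm.dvd.trans h1)
      have qt : q ∣ t := by
        have : q ∣ 2 * (2 * t) := by
          have : 2 * (2 * t) = P + Q := by rw [hP, hQ]; ring
          rw [this]; exact dvd_add h1 h2
        exact ((hq.dvd_or_dvd (((hq.dvd_or_dvd this).resolve_left q2))).resolve_left q2)
      have qB : q ∣ B := by rw [ht]; exact dvd_pow qt (by norm_num)
      have hPV : q ∣ 3 * V ^ 2 := by rw [← e']; exact h1.mul_right _
      have qA : q ∣ A := by
        have : q ∣ A * (A + 3 * V) := by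
          have : A * (A + 3 * V) = B - 3 * V ^ 2 := by rw [hB]; ring
          rw [this]; exact dvd_sub qB hPV
        rcases hq.dvd_or_dvd this with h | h
        · exact h
        · rcases hq.dvd_or_dvd hPV with h' | h'
          · have := dvd_sub h (h'.mul_right V)
            simpa using this
          · have := dvd_sub h ((hq.dvd_of_dvd_pow h').mul_left 3)
            simpa using this
      exact hq.not_isUnit (cAB.isUnit_of_dvd' qA qB)
    · have : 2 * s ^ 2 + 3 * V < 2 * t := by
        apply lt_of_pow_lt_pow_left₀ 2 (by positivity)
        nlinarith [sq_pos_of_pos hV0]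
      linarith
end

theorem st_zero {s t : ℕ} (h : (5:ℤ) ^ s * 11 ^ t = 1) : s = 0 ∧ t = 0 := by
  have h' : 5 ^ s * 11 ^ t = 1 := by exact_mod_cast h
  rw [mul_eq_one] at h'
  simpa using h'

theorem sqv {x : ℤ} (hx : 0 < x) (c : ℤ) (hc : 0 < c) (h : x ^ 2 = c ^ 2) : x = c :=
  (sq_eq_sq₀ hx.le hc.le).mp h

theorem odd_odd (α β : ℕ) (x y : ℤ) (hx : 0 < x) (hy : 0 < y) (h2 : (2:ℤ) ∣ y)
    (e : x ^ 2 + 55 * (5 ^ α * 11 ^ β) ^ 2 = y ^ 3) (hc : IsCoprime (55 * (5 ^ α * 11 ^ β) ^ 2) y) :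
    (α = 0 ∧ β = 0 ∧ x = 3 ∧ y = 4) ∨ (α = 0 ∧ β = 0 ∧ x = 419 ∧ y = 56) ∨
    (α = 1 ∧ β = 0 ∧ x = 37 ∧ y = 14) ∨ (α = 2 ∧ β = 2 ∧ x = 36599 ∧ y = 1226) := by
  have hW : IsCoprime ((5:ℤ) ^ α * 11 ^ β) y := (IsCoprime.pow_left_iff (by norm_num)).mp hc.of_mul_left_right
  have h5 : ¬ (5:ℤ) ∣ y := fun h => not_both nu5 hc.of_mul_left_left (by norm_num) h
  have h11 : ¬ (11:ℤ) ∣ y := fun h => not_both nu11 hc.of_mul_left_left (by norm_num) h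
  obtain ⟨s, i, hi, rfl⟩ : ∃ s i, i < 3 ∧ α = 3 * s + i := ⟨α / 3, α % 3, by omega, by omega⟩
  obtain ⟨t, j, hj, rfl⟩ : ∃ t j, j < 3 ∧ β = 3 * t + j := ⟨β / 3, β % 3, by omega, by omega⟩
  obtain ⟨h, hh⟩ : ∃ h : ℤ, h = 5 ^ s * 11 ^ t := ⟨_, rfl⟩
  have hw : (5:ℤ) ^ (3 * s + i) * 11 ^ (3 * t + j) = (5 ^ i * 11 ^ j) * h ^ 3 := by
    rw [hh]; ring
  rw [hw] at e hW
  clear hw hc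
  have h3 := three_not hh
  interval_cases i <;> interval_cases j
  · obtain ⟨h1, hy'⟩ := fin1 (x := x) (y := y) s t hh (by linear_combination e) h2 h5 h11
    rw [h1] at hh e
    obtain ⟨rfl, rfl⟩ := st_zero hh.symm
    rcases hy' with rfl | rfl
    · left; exact ⟨rfl, rfl, sqv hx 3 (by norm_num) (by linarith), rfl⟩
    · right; left; exact ⟨rfl, rfl, sqv hx 419 (by norm_num) (by linarith), rfl⟩
  · exact (obst _ h x _ y (by decide +kernel) h3 rfl hy h2 e hW).elim
  · exact (fin2 (x := x) (y := y) s t hh (by linear_combination e) h2 h5 h11).elim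
  · obtain ⟨h1, rfl⟩ := fin3 (x := x) (y := y) s t hh (by linear_combination e) h2 h5 h11
    rw [h1] at hh e
    obtain ⟨rfl, rfl⟩ := st_zero hh.symm
    right; right; left; exact ⟨rfl, rfl, sqv hx 37 (by norm_num) (by linarith), rfl⟩
  · exact (c4 (V := 55 * h ^ 2) (2 * s + 1) (2 * t + 1) (by rw [hh]; ring) ⟨11 * h ^ 2, by ring⟩ ⟨5 * h ^ 2, by ring⟩ h5 h11 h2 hy hx
      (by linear_combination e)).elim
  · exact (obst _ h x _ y (by decide +kernel) h3 rfl hy h2 e hW).elim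
  · exact (obst _ h x _ y (by decide +kernel) h3 rfl hy h2 e hW).elim
  · exact (fin5 (x := x) (y := y) s t hh (by linear_combination e) h2 h5 h11).elim
  · obtain ⟨h1, rfl⟩ := fin6 (x := x) (y := y) s t hh (by linear_combination e) h2 h5 h11
    rw [h1] at hh e
    obtain ⟨rfl, rfl⟩ := st_zero hh.symm
    right; right; right; exact ⟨rfl, rfl, sqv hx 36599 (by norm_num) (by linarith), rfl⟩

theorem forward (x y a b : ℕ) (hx : 1 ≤ x) (hy : 1 ≤ y) (hcop : Nat.gcd x y = 1) (h : x ^ 2 + 5 ^ a * 11 ^ b = y ^ 3) :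
      (a, b, x, y) = (0, 1, 4, 3) ∨ (a, b, x, y) = (0, 1, 58, 15) ∨
      (a, b, x, y) = (0, 2, 2, 5) ∨ (a, b, x, y) = (0, 3, 9324, 443) ∨
      (a, b, x, y) = (1, 1, 3, 4) ∨ (a, b, x, y) = (1, 1, 419, 56) ∨
      (a, b, x, y) = (2, 3, 968, 99) ∨ (a, b, x, y) = (3, 1, 37, 14) ∨
      (a, b, x, y) = (5, 5, 36599, 1226) := by
  have e : (x:ℤ) ^ 2 + 5 ^ a * 11 ^ b = (y:ℤ) ^ 3 := by exact_mod_cast h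
  have hx' : 0 < (x:ℤ) := by exact_mod_cast hx
  have hy' : 0 < (y:ℤ) := by exact_mod_cast hy
  have hc : IsCoprime (x:ℤ) y := Nat.isCoprime_iff_coprime.mpr hcop
  have hc' : IsCoprime ((5:ℤ) ^ a * 11 ^ b) y := by
    have : IsCoprime (y:ℤ) (-(x:ℤ) ^ 2) := (hc.symm.pow_right).neg_right
    exact (cop_congr this ((y:ℤ) ^ 2) (by linear_combination e)).symm
  clear h
  have key : ∀ d W : ℤ, d * W ^ 2 = (5:ℤ) ^ a * 11 ^ b → IsCoprime W y := by
    intro d W hd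
    rw [← hd] at hc'
    exact (IsCoprime.pow_left_iff (by norm_num)).mp hc'.of_mul_left_right
  obtain ⟨α, rfl | rfl⟩ := Nat.even_or_odd' a <;> obtain ⟨β, rfl | rfl⟩ := Nat.even_or_odd' b
  · obtain ⟨rfl, rfl, h3, h4⟩ := part_d1 α β x y hx' hy' (by rw [← e]; ring) (key 1 _ (by ring))
    have : x = 2 := by exact_mod_cast h3
    have : y = 5 := by exact_mod_cast h4
    simp_all
  · rcases part_d11 α β x y hx' hy' (by rw [← e]; ring) (key 11 _ (by ring)) with ⟨rfl, rfl, h3, h4⟩ | ⟨rfl, rfl, h3, h4⟩ | ⟨rfl, rfl, h3, h4⟩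
    · obtain rfl : x = 4 := by exact_mod_cast h3
      obtain rfl : y = 3 := by exact_mod_cast h4
      simp
    · obtain rfl : x = 58 := by exact_mod_cast h3
      obtain rfl : y = 15 := by exact_mod_cast h4
      simp
    · obtain rfl : x = 9324 := by exact_mod_cast h3
      obtain rfl : y = 443 := by exact_mod_cast h4
      simp
  · exact (part_d5 α β x y hy' (by rw [← e]; ring) (key 5 _ (by ring))).elim
  · have e55 : (x:ℤ) ^ 2 + 55 * (5 ^ α * 11 ^ β) ^ 2 = (y:ℤ) ^ 3 := by rw [← e]; ring
    by_cases h2 : (2:ℤ) ∣ y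
    · rcases odd_odd α β x y hx' hy' h2 e55 (by
        have : (55:ℤ) * (5 ^ α * 11 ^ β) ^ 2 = 5 ^ (2 * α + 1) * 11 ^ (2 * β + 1) := by ring
        rw [this]; exact hc') with ⟨rfl, rfl, h3, h4⟩ | ⟨rfl, rfl, h3, h4⟩ | ⟨rfl, rfl, h3, h4⟩ | ⟨rfl, rfl, h3, h4⟩
      · obtain rfl : x = 3 := by exact_mod_cast h3
        obtain rfl : y = 4 := by exact_mod_cast h4
        simp
      · obtain rfl : x = 419 := by exact_mod_cast h3
        obtain rfl : y = 56 := by exact_mod_cast h4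
        simp
      · obtain rfl : x = 37 := by exact_mod_cast h3
        obtain rfl : y = 14 := by exact_mod_cast h4
        simp
      · obtain rfl : x = 36599 := by exact_mod_cast h3
        obtain rfl : y = 1226 := by exact_mod_cast h4
        simp
    · exact (part_d55_odd α β x y hy' (by omega) e55 (key 55 _ (by ring))).elim

theorem eq_x_sq_add_5a_11b_eq_y_cubed (x y a b : ℕ) (hx : 1 ≤ x) (hy : 1 ≤ y)
    (hcop : Nat.gcd x y = 1) :
    x ^ 2 + 5 ^ a * 11 ^ b = y ^ 3 ↔
      (a, b, x, y) = (0, 1, 4, 3) ∨ (a, b, x, y) = (0, 1, 58, 15) ∨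
      (a, b, x, y) = (0, 2, 2, 5) ∨ (a, b, x, y) = (0, 3, 9324, 443) ∨
      (a, b, x, y) = (1, 1, 3, 4) ∨ (a, b, x, y) = (1, 1, 419, 56) ∨
      (a, b, x, y) = (2, 3, 968, 99) ∨ (a, b, x, y) = (3, 1, 37, 14) ∨
      (a, b, x, y) = (5, 5, 36599, 1226) := by
  refine ⟨forward x y a b hx hy hcop, ?_⟩
  intro h
  simp only [Prod.mk.injEq] at h
  rcases h with h | h | h | h | h | h | h | h | h <;> obtain ⟨rfl, rfl, rfl, rfl⟩ := h <;> norm_num
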